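/- (Two-sided heat kernel bounds.) Assume σ satisfies hypothesis (H^σ_α) for some α ∈ (0,1] and b satisfies hypothesis (H^b_0). Fix T > 0. Then there exist constants λ₀ ∈ (0,1] and C₀ ≥ 1 depending only on Θ = (T,α,0,κ₀,κ₁,d) such that: for every (s,t) ∈ 𝔻^T_0, every x ∈ ℝ^d and every solution ℙ_{s,x} of the martingale problem for (b,σ) started at (s,x), the law of X_t under ℙ_{s,x} is absolutely continuous with respect to Lebesgue measure on ℝ^d with a density p(s,x,t,·), which can be chosen jointly continuous in (x,y), and this density satisfies C₀^{-1}·g_{λ₀^{-1}}(t−s, θ^{(1)}_{t,s}(x)−y) ≤ p(s,x,t,y) ≤ C₀·g_{λ₀}(t−s, θ^{(1)}_{t,s}(x)−y) for all y ∈ ℝ^d. -/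

import Mathlib

noncomputable section

open MeasureTheory Matrix Set

/-- The state space `ℝ^d`. -/
abbrev Vec (d : ℕ) := EuclideanSpace ℝ (Fin d)

/-- Hypothesis (H^b_β): `b` is measurable, bounded at the origin uniformly in time
and Hölder/Lipschitz in space uniformly in time. -/
def HolderDrift (d : ℕ) (b : ℝ → Vec d → Vec d) (κ₁ β : ℝ) : Prop :=
  Measurable (Function.uncurry b) ∧
  (∀ t : ℝ, 0 ≤ t → ‖b t 0‖ ≤ κ₁) ∧
  (∀ t : ℝ, 0 ≤ t → ∀ x y : Vec d, ‖b t x - b t y‖ ≤ κ₁ * max (‖x - y‖ ^ β) ‖x - y‖)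

/-- A smooth nonnegative mollifier supported in the closed unit ball with total mass one. -/
structure IsMollifier (d : ℕ) (ρ : Vec d → ℝ) : Prop where
  smooth : ContDiff ℝ (⊤ : ℕ∞) ρ
  nonneg : ∀ x, 0 ≤ ρ x
  support_subset : Function.support ρ ⊆ Metric.closedBall 0 1
  integral_eq_one : ∫ x, ρ x = 1

/-- The spatially mollified drift `b_ε(t,x) = ∫ b(t,y) ρ_ε(x-y) dy`. -/
def mollifiedDrift (d : ℕ) (ρ : Vec d → ℝ) (ε : ℝ) (b : ℝ → Vec d → Vec d)
    (t : ℝ) (x : Vec d) : Vec d :=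
  ∫ y : Vec d, (ε ^ (-(d : ℝ)) * ρ (ε⁻¹ • (x - y))) • b t y

/-- `θ` is the flow of the (time-dependent) vector field `f`:
`θ t s x = x + ∫_s^t f(r, θ r s x) dr` for all nonnegative times. -/
def IsFlow (d : ℕ) (f : ℝ → Vec d → Vec d) (θ : ℝ → ℝ → Vec d → Vec d) : Prop :=
  ∀ s t : ℝ, 0 ≤ s → 0 ≤ t → ∀ x : Vec d,
    θ t s x = x + ∫ r in s..t, f r (θ r s x)

/-- The Gaussian kernel `g_λ(t,x) = t^{-d/2} exp(-λ |x|²/t)`. -/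
def gaussk (d : ℕ) (l t : ℝ) (x : Vec d) : ℝ :=
  t ^ (-(d : ℝ) / 2) * Real.exp (-l * ‖x‖ ^ 2 / t)

/-- A drift which is measurable, bounded at the origin uniformly in time, and Lipschitz in
space with constant `κ` uniformly in time. -/
def LipschitzDrift (d : ℕ) (b : ℝ → Vec d → Vec d) (κ : ℝ) : Prop :=
  Measurable (Function.uncurry b) ∧
  (∃ M : ℝ, ∀ t : ℝ, 0 ≤ t → ‖b t 0‖ ≤ M) ∧
  (∀ t : ℝ, 0 ≤ t → ∀ x y : Vec d, ‖b t x - b t y‖ ≤ κ * ‖x - y‖)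

/-- The diffusion matrix `σσ*`. -/
def sqMat (d : ℕ) (σ : ℝ → Vec d → Matrix (Fin d) (Fin d) ℝ) (t : ℝ) (x : Vec d) :
    Matrix (Fin d) (Fin d) ℝ :=
  σ t x * (σ t x)ᵀ

/-- Hypothesis (H^σ_α): measurability, uniform ellipticity with constant `κ₀`
and spatial α-Hölder continuity with constant `κ₀`. -/
def EllipticHolder (d : ℕ) (σ : ℝ → Vec d → Matrix (Fin d) (Fin d) ℝ) (κ₀ α : ℝ) : Prop :=
  (∀ i j : Fin d, Measurable fun p : ℝ × Vec d => σ p.1 p.2 i j) ∧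
  (∀ t : ℝ, 0 ≤ t → ∀ x : Vec d, ∀ ξ : Fin d → ℝ,
    κ₀⁻¹ * (ξ ⬝ᵥ ξ) ≤ (sqMat d σ t x).mulVec ξ ⬝ᵥ ξ ∧
      (sqMat d σ t x).mulVec ξ ⬝ᵥ ξ ≤ κ₀ * (ξ ⬝ᵥ ξ)) ∧
  (∀ t : ℝ, 0 ≤ t → ∀ x y : Vec d, ∀ i j : Fin d,
    |σ t x i j - σ t y i j| ≤ κ₀ * ‖x - y‖ ^ α)

/-- `b` is smooth in the space variable, with spatial derivatives of every order
bounded uniformly in time and space. -/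
def SmoothVecBounded (d : ℕ) (b : ℝ → Vec d → Vec d) : Prop :=
  (∀ t : ℝ, ContDiff ℝ (⊤ : ℕ∞) (b t)) ∧
  ∀ n : ℕ, 1 ≤ n → ∃ M : ℝ, ∀ t : ℝ, 0 ≤ t → ∀ x : Vec d,
    ‖iteratedFDeriv ℝ n (b t) x‖ ≤ M

/-- `σ` is smooth in the space variable, with spatial derivatives of every order
bounded uniformly in time and space. -/
def SmoothMatBounded (d : ℕ) (σ : ℝ → Vec d → Matrix (Fin d) (Fin d) ℝ) : Prop :=
  (∀ t : ℝ, ∀ i j : Fin d, ContDiff ℝ (⊤ : ℕ∞) fun x => σ t x i j) ∧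
  ∀ n : ℕ, 1 ≤ n → ∃ M : ℝ, ∀ t : ℝ, 0 ≤ t → ∀ x : Vec d, ∀ i j : Fin d,
    ‖iteratedFDeriv ℝ n (fun z => σ t z i j) x‖ ≤ M

/-- The mean shift `ϑ^{(τ,ξ)}_{t,s} = ∫_s^t b(r, θ_{r,τ}(ξ)) dr` of the frozen process. -/
def freezeMean (d : ℕ) (b : ℝ → Vec d → Vec d) (θ : ℝ → ℝ → Vec d → Vec d)
    (τ : ℝ) (ξ : Vec d) (s t : ℝ) : Vec d :=
  ∫ r in s..t, b r (θ r τ ξ)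

/-- The covariance `𝒞^{(τ,ξ)}_{t,s} = ∫_s^t (σσ*)(r, θ_{r,τ}(ξ)) dr` of the frozen process. -/
def freezeCov (d : ℕ) (σ : ℝ → Vec d → Matrix (Fin d) (Fin d) ℝ)
    (θ : ℝ → ℝ → Vec d → Vec d) (τ : ℝ) (ξ : Vec d) (s t : ℝ) :
    Matrix (Fin d) (Fin d) ℝ :=
  Matrix.of fun i j => ∫ r in s..t, sqMat d σ r (θ r τ ξ) i j

/-- The frozen Gaussian density
`p̃^{(τ,ξ)}(s,x,t,y) = ((2π)^d det 𝒞)^{-1/2} exp(−½ ⟨𝒞⁻¹ m, m⟩)`, `m = ϑ + x − y`. -/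
def frozenDensity (d : ℕ) (b : ℝ → Vec d → Vec d)
    (σ : ℝ → Vec d → Matrix (Fin d) (Fin d) ℝ) (θ : ℝ → ℝ → Vec d → Vec d)
    (τ : ℝ) (ξ : Vec d) (s : ℝ) (x : Vec d) (t : ℝ) (y : Vec d) : ℝ :=
  (Real.sqrt ((2 * Real.pi) ^ d * (freezeCov d σ θ τ ξ s t).det))⁻¹ *
    Real.exp (-(1 / 2) *
      ((freezeCov d σ θ τ ξ s t)⁻¹.mulVec (fun i => (freezeMean d b θ τ ξ s t + x - y) i) ⬝ᵥ
        fun i => (freezeMean d b θ τ ξ s t + x - y) i))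

/-- The generator `L_{r} f(z) = ⟨b(r,z), ∇f(z)⟩ + ½ tr(σσ*(r,z) ∇²f(z))`. -/
def genApply (d : ℕ) (b : ℝ → Vec d → Vec d)
    (σ : ℝ → Vec d → Matrix (Fin d) (Fin d) ℝ) (r : ℝ) (f : Vec d → ℝ) (z : Vec d) : ℝ :=
  (∑ i, b r z i * fderiv ℝ f z (EuclideanSpace.single i (1 : ℝ))) +
    (1 / 2) * ∑ i, ∑ j, sqMat d σ r z i j *
      iteratedFDeriv ℝ 2 f z
        ![EuclideanSpace.single i (1 : ℝ), EuclideanSpace.single j (1 : ℝ)]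

/-- The natural σ-algebra of the process `X` on the time interval `[s,u]`. -/
def pathSigma (d : ℕ) {Ω : Type*} [MeasurableSpace Ω] (X : ℝ → Ω → Vec d)
    (s u : ℝ) : MeasurableSpace Ω :=
  ⨆ r ∈ Set.Icc s u, MeasurableSpace.comap (X r) inferInstance

/-- A solution of the martingale problem for `(b,σ)` started at `(s,x)`:
a probability measure `P` together with a process `X` with continuous paths on `[s,∞)`,
`X_s = x` a.s., such that for every `f ∈ C_c^∞(ℝ^d)` the process
`t ↦ f(X_t) − ∫_s^t (L_r f)(X_r) dr` is a martingale w.r.t. the natural filtration. -/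
structure MartingaleProblemSolution (d : ℕ) (b : ℝ → Vec d → Vec d)
    (σ : ℝ → Vec d → Matrix (Fin d) (Fin d) ℝ) (s : ℝ) (x : Vec d)
    {Ω : Type*} [MeasurableSpace Ω] (P : MeasureTheory.Measure Ω)
    (X : ℝ → Ω → Vec d) : Prop where
  isProb : MeasureTheory.IsProbabilityMeasure P
  measurable_X : ∀ t : ℝ, Measurable (X t)
  cont_paths : ∀ ω : Ω, ContinuousOn (fun t => X t ω) (Set.Ici s)
  start : ∀ᵐ ω ∂P, X s ω = x
  integrable : ∀ f : Vec d → ℝ, ContDiff ℝ (⊤ : ℕ∞) f → HasCompactSupport f →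
    ∀ t : ℝ, s ≤ t →
      MeasureTheory.Integrable
        (fun ω => f (X t ω) - ∫ r in s..t, genApply d b σ r f (X r ω)) P
  martingale : ∀ f : Vec d → ℝ, ContDiff ℝ (⊤ : ℕ∞) f → HasCompactSupport f →
    ∀ u v : ℝ, s ≤ u → u ≤ v → ∀ A : Set Ω, MeasurableSet[pathSigma d X s u] A →
      ∫ ω in A, (f (X v ω) - ∫ r in s..v, genApply d b σ r f (X r ω)) ∂P =
      ∫ ω in A, (f (X u ω) - ∫ r in s..u, genApply d b σ r f (X r ω)) ∂P

section Parametrix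

open scoped RealInnerProductSpace MatrixOrder ComplexOrder Topology ENNReal
open Filter

section

/-- Continuous linear endomorphisms of the state space. -/
abbrev Lin (d : ℕ) := Vec d →L[ℝ] Vec d

lemma det_toEuclideanCLM {d : ℕ} (B : Matrix (Fin d) (Fin d) ℝ) :
    (Matrix.toEuclideanCLM (𝕜 := ℝ) B).det = B.det := by
  rw [ContinuousLinearMap.det]
  have : ((Matrix.toEuclideanCLM (𝕜 := ℝ) B : Lin d) : Vec d →ₗ[ℝ] Vec d) =
      Matrix.toLin (EuclideanSpace.basisFun (Fin d) ℝ).toBasis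
        (EuclideanSpace.basisFun (Fin d) ℝ).toBasis B := by
    rw [← Matrix.toEuclideanLin_eq_toLin_orthonormal]; rfl
  rw [this, LinearMap.det_toLin]

lemma exists_gram {d : ℕ} {C : Lin d} (hs : ∀ v w, ⟪C v, w⟫ = ⟪v, C w⟫)
    (hp : ∀ v, 0 ≤ ⟪C v, v⟫) :
    ∃ S : Lin d, (∀ v, ⟪C v, v⟫ = ‖S v‖ ^ 2) ∧ C.det = S.det ^ 2 := by
  set m := (Matrix.toEuclideanCLM (𝕜 := ℝ) (n := Fin d)).symm C with hm
  have hC : C = Matrix.toEuclideanCLM (𝕜 := ℝ) m := by simp [hm]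
  have hpos : m.PosSemidef := by
    rw [Matrix.posSemidef_iff_dotProduct_mulVec]
    constructor
    · have hC' : star C = C := by
        rw [ContinuousLinearMap.star_eq_adjoint]
        refine ((ContinuousLinearMap.eq_adjoint_iff C C).2 fun v w => ?_).symm
        exact hs v w
      have h1 : Matrix.toEuclideanCLM (𝕜 := ℝ) (star m) = Matrix.toEuclideanCLM (𝕜 := ℝ) m := by
        rw [map_star, ← hC, hC']
      exact (Matrix.toEuclideanCLM (𝕜 := ℝ) (n := Fin d)).injective h1
    · intro x
      have h := hp (WithLp.toLp 2 x)
      rw [hC, real_inner_comm, Matrix.inner_toEuclideanCLM] at h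
      simpa using h
  obtain ⟨B, hB⟩ := CStarAlgebra.nonneg_iff_eq_star_mul_self.mp hpos.nonneg
  refine ⟨Matrix.toEuclideanCLM (𝕜 := ℝ) B, ?_, ?_⟩
  · intro v
    rw [hC, hB, map_mul, map_star, mul_apply_eq_comp, ContinuousLinearMap.star_eq_adjoint,
      ContinuousLinearMap.adjoint_inner_left, real_inner_self_eq_norm_sq]
  · rw [hC, det_toEuclideanCLM, det_toEuclideanCLM, hB, Matrix.det_mul,
      Matrix.star_eq_conjTranspose, Matrix.det_conjTranspose]
    simp [sq]

/-- Symmetric operators whose quadratic form is comparable to `δ` with ellipticity `κ`. -/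
structure Ell {d : ℕ} (κ δ : ℝ) (C : Lin d) : Prop where
  sym : ∀ v w, ⟪C v, w⟫ = ⟪v, C w⟫
  lb : ∀ v, κ⁻¹ * δ * ‖v‖ ^ 2 ≤ ⟪C v, v⟫
  ub : ‖C‖ ≤ κ * δ

/-- The inverse covariance. -/
abbrev linv {d : ℕ} (C : Lin d) : Lin d := Ring.inverse C

lemma abs_det_le {d : ℕ} (C : Lin d) : |C.det| ≤ ‖C‖ ^ d := by
  have h1 := Measure.addHaar_image_continuousLinearMap (volume : Measure (Vec d)) C
    (Metric.closedBall 0 1)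
  have h2 : C '' Metric.closedBall 0 1 ⊆ Metric.closedBall 0 ‖C‖ := by
    rintro _ ⟨v, hv, rfl⟩
    simp only [Metric.mem_closedBall, dist_zero_right] at hv ⊢
    calc ‖C v‖ ≤ ‖C‖ * ‖v‖ := C.le_opNorm v
      _ ≤ ‖C‖ * 1 := by gcongr
      _ = _ := mul_one _
  have h3 := (h1.symm.le.trans (measure_mono h2))
  rw [Measure.addHaar_closedBall' _ _ (norm_nonneg C), finrank_euclideanSpace_fin] at h3
  have h4 : (0 : ℝ≥0∞) < volume (Metric.closedBall (0 : Vec d) 1) :=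
    Metric.measure_closedBall_pos _ _ one_pos
  have h5 : volume (Metric.closedBall (0 : Vec d) 1) ≠ ∞ := measure_closedBall_lt_top.ne
  rw [ENNReal.mul_le_mul_iff_left h4.ne' h5] at h3
  exact (ENNReal.ofReal_le_ofReal_iff (by positivity)).1 h3

namespace Ell
variable {d : ℕ} {κ δ : ℝ} {C : Lin d}

lemma norm_lb (h : Ell κ δ C) (hκ : 0 < κ) (hδ : 0 < δ) (v : Vec d) : κ⁻¹ * δ * ‖v‖ ≤ ‖C v‖ := by
  rcases eq_or_ne v 0 with rfl | hv
  · simp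
  have hv' : 0 < ‖v‖ := norm_pos_iff.2 hv
  have h1 := (h.lb v).trans (real_inner_le_norm _ _)
  nlinarith

lemma isUnit (h : Ell κ δ C) (hκ : 0 < κ) (hδ : 0 < δ) : IsUnit C := by
  rw [ContinuousLinearMap.isUnit_iff_bijective]
  have hinj : Function.Injective C := by
    rw [injective_iff_map_eq_zero]
    intro v hv
    have h1 := h.norm_lb hκ hδ v
    rw [hv, norm_zero] at h1
    have h2 : 0 < κ⁻¹ * δ := by positivity
    have : ‖v‖ ≤ 0 := by
      by_contra hc
      push Not at hc
      nlinarith [mul_pos h2 hc]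
    simpa using this
  exact ⟨hinj, LinearMap.injective_iff_surjective (f := (C : Vec d →ₗ[ℝ] Vec d)).1 hinj⟩

lemma apply_inv (h : Ell κ δ C) (hκ : 0 < κ) (hδ : 0 < δ) (v : Vec d) : C (linv C v) = v := by
  have := Ring.mul_inverse_cancel C (h.isUnit hκ hδ)
  exact congrArg (fun L : Lin d => L v) this

lemma inv_apply (h : Ell κ δ C) (hκ : 0 < κ) (hδ : 0 < δ) (v : Vec d) : linv C (C v) = v := by
  have := Ring.inverse_mul_cancel C (h.isUnit hκ hδ)
  exact congrArg (fun L : Lin d => L v) this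

lemma inv_sym (h : Ell κ δ C) (hκ : 0 < κ) (hδ : 0 < δ) (v w : Vec d) :
    ⟪linv C v, w⟫ = ⟪v, linv C w⟫ := by
  conv_lhs => rw [← h.apply_inv hκ hδ w]
  rw [← h.sym, h.apply_inv hκ hδ]

lemma inv_norm_le (h : Ell κ δ C) (hκ : 0 < κ) (hδ : 0 < δ) : ‖linv C‖ ≤ κ / δ := by
  refine ContinuousLinearMap.opNorm_le_bound _ (by positivity) fun v => ?_
  have h1 := h.norm_lb hκ hδ (linv C v)
  rw [h.apply_inv hκ hδ] at h1
  calc ‖linv C v‖ = κ / δ * (κ⁻¹ * δ * ‖linv C v‖) := by field_simp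
    _ ≤ _ := by gcongr

lemma inv_lb (h : Ell κ δ C) (hκ : 0 < κ) (hδ : 0 < δ) (v : Vec d) :
    ‖v‖ ^ 2 / (κ ^ 3 * δ) ≤ ⟪linv C v, v⟫ := by
  have h1 := h.lb (linv C v)
  rw [h.apply_inv hκ hδ, real_inner_comm] at h1
  have h2 : ‖v‖ ≤ κ * δ * ‖linv C v‖ := by
    conv_lhs => rw [← h.apply_inv hκ hδ v]
    exact (C.le_opNorm _).trans (by gcongr; exact h.ub)
  calc ‖v‖ ^ 2 / (κ ^ 3 * δ) ≤ (κ * δ * ‖linv C v‖) ^ 2 / (κ ^ 3 * δ) := by gcongr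
    _ = κ⁻¹ * δ * ‖linv C v‖ ^ 2 := by field_simp
    _ ≤ _ := h1

lemma inv_ub (h : Ell κ δ C) (hκ : 0 < κ) (hδ : 0 < δ) (v : Vec d) :
    ⟪linv C v, v⟫ ≤ κ / δ * ‖v‖ ^ 2 := by
  calc ⟪linv C v, v⟫ ≤ ‖linv C v‖ * ‖v‖ := real_inner_le_norm _ _
    _ ≤ κ / δ * ‖v‖ * ‖v‖ := by
      gcongr
      exact ((linv C).le_opNorm v).trans (by gcongr; exact h.inv_norm_le hκ hδ)
    _ = _ := by ring

lemma det_mul_inv (h : Ell κ δ C) (hκ : 0 < κ) (hδ : 0 < δ) : C.det * (linv C).det = 1 := by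
  have h1 := Ring.mul_inverse_cancel C (h.isUnit hκ hδ)
  have h2 := congrArg ContinuousLinearMap.det h1
  rw [ContinuousLinearMap.det, ContinuousLinearMap.toLinearMap_mul, map_mul] at h2
  simpa [ContinuousLinearMap.det] using h2

lemma det_pos (h : Ell κ δ C) (hκ : 0 < κ) (hδ : 0 < δ) : 0 < C.det := by
  obtain ⟨S, -, hS⟩ := exists_gram h.sym fun v => le_trans (by positivity) (h.lb v)
  have h1 := h.det_mul_inv hκ hδ
  rcases (sq_nonneg S.det).lt_or_eq with h2 | h2
  · rwa [hS]
  · rw [hS, ← h2, zero_mul] at h1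
    exact absurd h1 zero_ne_one

lemma det_le (h : Ell κ δ C) : C.det ≤ (κ * δ) ^ d :=
  (le_abs_self _).trans ((abs_det_le C).trans (by gcongr; exact h.ub))

lemma det_ge (h : Ell κ δ C) (hκ : 0 < κ) (hδ : 0 < δ) : (δ / κ) ^ d ≤ C.det := by
  have h1 := h.det_mul_inv hκ hδ
  have h2 := h.det_pos hκ hδ
  have h3 : (linv C).det ≤ (κ / δ) ^ d :=
    (le_abs_self _).trans ((abs_det_le _).trans (by gcongr; exact h.inv_norm_le hκ hδ))
  have h4 : (δ / κ) ^ d * (κ / δ) ^ d = 1 := by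
    rw [← mul_pow]; field_simp; simp
  have h5 : 0 < (κ / δ) ^ d := by positivity
  nlinarith

end Ell

end

section

/-- Coordinate vectors of the state space. -/
abbrev ee {d : ℕ} (i : Fin d) : Vec d := EuclideanSpace.single i (1 : ℝ)

/-- The trace of an endomorphism of the state space. -/
def tr {d : ℕ} (M : Lin d) : ℝ := ∑ i, ⟪M (ee i), ee i⟫

lemma abs_tr_le {d : ℕ} (M : Lin d) : |tr M| ≤ d * ‖M‖ := by
  calc |tr M| ≤ ∑ i : Fin d, |⟪M (ee i), ee i⟫| := Finset.abs_sum_le_sum_abs _ _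
    _ ≤ ∑ i : Fin d, ‖M‖ := by
      refine Finset.sum_le_sum fun i _ => (abs_real_inner_le_norm _ _).trans ?_
      have := M.le_opNorm (ee i)
      simpa using this
    _ = _ := by simp

/-- The centred Gaussian density with covariance `C`. -/
def gauss {d : ℕ} (C : Lin d) (v : Vec d) : ℝ :=
  (Real.sqrt ((2 * Real.pi) ^ d * C.det))⁻¹ * Real.exp (-(1 / 2) * ⟪linv C v, v⟫)

/-- The action of a constant-coefficient generator on a Gaussian density. -/
def jf {d : ℕ} (C : Lin d) (β : Vec d) (M : Lin d) (v : Vec d) : ℝ :=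
  (-⟪linv C v, β⟫ + (1 / 2) * (⟪linv C v, M (linv C v)⟫ - tr (linv C * M))) * gauss C v

lemma gauss_nonneg {d : ℕ} (C : Lin d) (v : Vec d) : 0 ≤ gauss C v := by
  unfold gauss; positivity

lemma sqrt_pow_inv {x : ℝ} (hx : 0 < x) (d : ℕ) : (Real.sqrt (x ^ d))⁻¹ = x ^ (-(d : ℝ) / 2) := by
  rw [Real.sqrt_eq_rpow, ← Real.rpow_natCast, ← Real.rpow_mul hx.le, ← Real.rpow_neg hx.le]
  congr 1; ring

lemma gauss_le {d : ℕ} {κ δ : ℝ} {C : Lin d} (h : Ell κ δ C) (hκ : 0 < κ) (hδ : 0 < δ) (v : Vec d) :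
    gauss C v ≤ κ ^ ((d : ℝ) / 2) * (δ ^ (-(d : ℝ) / 2) * Real.exp (-(‖v‖ ^ 2 / (2 * κ ^ 3 * δ)))) := by
  have h1 : (Real.sqrt ((2 * Real.pi) ^ d * C.det))⁻¹ ≤ κ ^ ((d : ℝ) / 2) * δ ^ (-(d : ℝ) / 2) := by
    have h2 : (δ / κ) ^ d ≤ (2 * Real.pi) ^ d * C.det := by
      have h3 : 1 ≤ (2 * Real.pi) ^ d := one_le_pow₀ (by linarith [Real.pi_gt_three])
      have h4 := h.det_ge hκ hδ
      have h5 : (0:ℝ) < (δ / κ) ^ d := by positivity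
      nlinarith
    calc (Real.sqrt ((2 * Real.pi) ^ d * C.det))⁻¹ ≤ (Real.sqrt ((δ / κ) ^ d))⁻¹ := by gcongr
      _ = (δ / κ) ^ (-(d : ℝ) / 2) := sqrt_pow_inv (by positivity) d
      _ = _ := by
        rw [Real.div_rpow hδ.le hκ.le, neg_div, Real.rpow_neg hκ.le, div_inv_eq_mul, mul_comm]
  rw [gauss, ← mul_assoc]
  refine mul_le_mul h1 (Real.exp_le_exp.2 ?_) (Real.exp_pos _).le (by positivity)
  have := h.inv_lb hκ hδ v
  have h6 : ‖v‖ ^ 2 / (2 * κ ^ 3 * δ) = (1 / 2) * (‖v‖ ^ 2 / (κ ^ 3 * δ)) := by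
    field_simp
  rw [h6]; linarith

lemma gauss_ge {d : ℕ} {κ δ : ℝ} {C : Lin d} (h : Ell κ δ C) (hκ : 0 < κ) (hδ : 0 < δ) (v : Vec d) :
    (2 * Real.pi * κ) ^ (-(d : ℝ) / 2) * (δ ^ (-(d : ℝ) / 2) * Real.exp (-(κ / (2 * δ) * ‖v‖ ^ 2)))
      ≤ gauss C v := by
  have hp := Real.pi_pos
  have h1 : (2 * Real.pi * κ) ^ (-(d : ℝ) / 2) * δ ^ (-(d : ℝ) / 2)
      ≤ (Real.sqrt ((2 * Real.pi) ^ d * C.det))⁻¹ := by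
    have h2 : (2 * Real.pi) ^ d * C.det ≤ (2 * Real.pi * κ * δ) ^ d := by
      rw [mul_assoc (2 * Real.pi), mul_pow (2 * Real.pi)]
      exact mul_le_mul_of_nonneg_left h.det_le (by positivity)
    have h3 := h.det_pos hκ hδ
    calc _ = (Real.sqrt ((2 * Real.pi * κ * δ) ^ d))⁻¹ := by
          rw [sqrt_pow_inv (by positivity), Real.mul_rpow (by positivity) hδ.le]
      _ ≤ _ := by gcongr
  rw [gauss, ← mul_assoc]
  refine mul_le_mul h1 (Real.exp_le_exp.2 ?_) (Real.exp_pos _).le (by positivity)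
  have := h.inv_ub hκ hδ v
  have h6 : κ / (2 * δ) * ‖v‖ ^ 2 = (1 / 2) * (κ / δ * ‖v‖ ^ 2) := by
    field_simp
  rw [h6]; linarith

lemma abs_jf_le {d : ℕ} {κ δ : ℝ} {C : Lin d} (h : Ell κ δ C) (hκ : 0 < κ) (hδ : 0 < δ)
    (β : Vec d) (M : Lin d) (v : Vec d) :
    |jf C β M v| ≤ (κ / δ * ‖v‖ * ‖β‖ + (1 / 2) * (‖M‖ * ((κ / δ) ^ 2 * ‖v‖ ^ 2 + d * (κ / δ)))) *
      gauss C v := by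
  have hn := h.inv_norm_le hκ hδ
  have hk : 0 < κ / δ := by positivity
  have hA : ‖linv C v‖ ≤ κ / δ * ‖v‖ := ((linv C).le_opNorm v).trans (by gcongr)
  have h1 : |⟪linv C v, β⟫| ≤ κ / δ * ‖v‖ * ‖β‖ :=
    (abs_real_inner_le_norm _ _).trans (by gcongr)
  have h2 : |⟪linv C v, M (linv C v)⟫| ≤ ‖M‖ * ((κ / δ) ^ 2 * ‖v‖ ^ 2) := by
    calc _ ≤ ‖linv C v‖ * ‖M (linv C v)‖ := abs_real_inner_le_norm _ _
      _ ≤ ‖linv C v‖ * (‖M‖ * ‖linv C v‖) := by gcongr; exact M.le_opNorm _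
      _ ≤ (κ / δ * ‖v‖) * (‖M‖ * (κ / δ * ‖v‖)) := by gcongr
      _ = _ := by ring
  have h3 : |tr (linv C * M)| ≤ ‖M‖ * (d * (κ / δ)) := by
    calc _ ≤ d * ‖linv C * M‖ := abs_tr_le _
      _ ≤ d * (‖linv C‖ * ‖M‖) := by gcongr; exact norm_mul_le _ _
      _ ≤ d * (κ / δ * ‖M‖) := by gcongr
      _ = _ := by ring
  rw [jf, abs_mul, abs_of_nonneg (gauss_nonneg C v)]
  refine mul_le_mul_of_nonneg_right ?_ (gauss_nonneg C v)
  rw [abs_le] at h1 h2 h3 ⊢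
  constructor <;> nlinarith

lemma integral_gauss {d : ℕ} {κ δ : ℝ} {C : Lin d} (h : Ell κ δ C) (hκ : 0 < κ) (hδ : 0 < δ) :
    ∫ v, gauss C v = 1 := by
  obtain ⟨S, hS1, hS2⟩ := exists_gram (C := linv C) (h.inv_sym hκ hδ)
    (fun v => le_trans (by positivity) (h.inv_lb hκ hδ v))
  have hd := h.det_mul_inv hκ hδ
  have hdp := h.det_pos hκ hδ
  have hS0 : S.det ≠ 0 := by
    intro h0
    rw [hS2, h0] at hd
    simp at hd
  have hcd : C.det = (S.det ^ 2)⁻¹ := by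
    rw [← hS2]; exact eq_inv_of_mul_eq_one_left hd
  have h1 : ∀ v, gauss C v = (Real.sqrt ((2 * Real.pi) ^ d * C.det))⁻¹ *
      (fun w : Vec d => Real.exp (-(1 / 2) * ‖w‖ ^ 2)) (S v) := by
    intro v; simp only [gauss, hS1]
  simp_rw [h1]
  rw [integral_const_mul]
  have h2 := Measure.map_linearMap_addHaar_eq_smul_addHaar (volume : Measure (Vec d))
    (f := (S : Vec d →ₗ[ℝ] Vec d)) hS0
  have h3 : ∫ v, (fun w : Vec d => Real.exp (-(1 / 2) * ‖w‖ ^ 2)) (S v) =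
      |S.det|⁻¹ * (2 * Real.pi) ^ ((d : ℝ) / 2) := by
    have h5 := integral_map (μ := (volume : Measure (Vec d))) (φ := S) S.continuous.aemeasurable
      (f := fun w : Vec d => Real.exp (-(1 / 2) * ‖w‖ ^ 2))
      (Continuous.aestronglyMeasurable (by fun_prop))
    rw [← h5]
    have h4 : Measure.map S (volume : Measure (Vec d)) = ENNReal.ofReal |S.det⁻¹| • volume := h2
    rw [h4, integral_smul_measure, GaussianFourier.integral_rexp_neg_mul_sq_norm (by norm_num),
      finrank_euclideanSpace_fin, ENNReal.toReal_ofReal (abs_nonneg _), abs_inv, smul_eq_mul]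
    congr 2; ring
  rw [h3, hcd, Real.sqrt_mul (by positivity), mul_inv, sqrt_pow_inv (by positivity),
    Real.sqrt_inv, Real.sqrt_sq_eq_abs, inv_inv, neg_div, Real.rpow_neg (by positivity)]
  have : |S.det| ≠ 0 := abs_ne_zero.2 hS0
  have h5 : (2 * Real.pi) ^ ((d : ℝ) / 2) ≠ 0 := by positivity
  field_simp

end

section

lemma exists_pow_exp_le {c : ℝ} (hc : 0 < c) :
    ∃ B : ℝ, 0 < B ∧ ∀ s : ℝ, 0 ≤ s → (1 + s) ^ 4 * Real.exp (-(c * s ^ 2)) ≤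
      B * Real.exp (-(c / 2 * s ^ 2)) := by
  refine ⟨8 * (1 + 8 / c ^ 2), by positivity, fun s _ => ?_⟩
  have h1 : (1 + s) ^ 4 ≤ 8 * (1 + s ^ 4) := by
    nlinarith [sq_nonneg (s - 1), sq_nonneg (s ^ 2 - 1), sq_nonneg (s ^ 2 - s), sq_nonneg (s + 1),
      sq_nonneg s]
  have h2 := Real.pow_div_factorial_le_exp (c / 2 * s ^ 2) (by positivity) 2
  have h3 : s ^ 4 ≤ 8 / c ^ 2 * Real.exp (c / 2 * s ^ 2) := by
    calc s ^ 4 = 8 / c ^ 2 * ((c / 2 * s ^ 2) ^ 2 / (2 : ℕ).factorial) := by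
          simp [Nat.factorial]; field_simp; norm_num
      _ ≤ _ := by gcongr
  have h4 : 1 ≤ Real.exp (c / 2 * s ^ 2) := Real.one_le_exp (by positivity)
  have h5 : (1 + s) ^ 4 ≤ 8 * (1 + 8 / c ^ 2) * Real.exp (c / 2 * s ^ 2) := by
    nlinarith
  calc _ ≤ 8 * (1 + 8 / c ^ 2) * Real.exp (c / 2 * s ^ 2) * Real.exp (-(c * s ^ 2)) := by gcongr
    _ = 8 * (1 + 8 / c ^ 2) * Real.exp (-(c / 2 * s ^ 2)) := by
      rw [mul_assoc, ← Real.exp_add]; congr 2; ring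

lemma sum_inner_ee {d : ℕ} (w : Vec d) : ∑ i, ⟪w, ee i⟫ • ee i = w := by
  have := (EuclideanSpace.basisFun (Fin d) ℝ).sum_repr' w
  simp only [EuclideanSpace.basisFun_apply] at this
  conv_rhs => rw [← this]
  exact Finset.sum_congr rfl fun i _ => by rw [real_inner_comm]

lemma det_eq_matrix {d : ℕ} (C : Lin d) :
    C.det = (Matrix.of fun i j => ⟪ee i, C (ee j)⟫).det := by
  rw [← det_toEuclideanCLM]
  congr 1
  ext v i
  rw [Matrix.ofLp_toEuclideanCLM]
  simp only [Matrix.mulVec, dotProduct, Matrix.of_apply]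
  conv_lhs => rw [← sum_inner_ee v]
  simp only [map_sum, map_smul, WithLp.ofLp_sum, WithLp.ofLp_smul, Finset.sum_apply, Pi.smul_apply, smul_eq_mul]
  refine Finset.sum_congr rfl fun j _ => ?_
  rw [EuclideanSpace.inner_single_left, EuclideanSpace.inner_single_right]
  simp [mul_comm]

lemma contDiff_det {d : ℕ} {n : WithTop ℕ∞} : ContDiff ℝ n (fun C : Lin d => C.det) := by
  simp_rw [det_eq_matrix, Matrix.det_apply]
  refine ContDiff.sum fun σ _ => ContDiff.const_smul _ (contDiff_prod fun i _ => ?_)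
  simp only [Matrix.of_apply]
  exact contDiff_const.inner ℝ (contDiff_id.clm_apply contDiff_const)

lemma hasDerivAt_det_one_add {d : ℕ} (N : Lin d) :
    HasDerivAt (fun r : ℝ => ((1 : Lin d) + r • N).det) (tr N) 0 := by
  set m := Matrix.of fun i j => ⟪ee i, N (ee j)⟫ with hm
  have h1 : ∀ r : ℝ, ((1 : Lin d) + r • N).det = (1 + r • m).det := by
    intro r
    rw [det_eq_matrix]
    congr 1
    ext i j
    simp only [hm, Matrix.of_apply, _root_.add_apply, _root_.smul_apply, inner_add_right,
      inner_smul_right, Matrix.add_apply, Matrix.smul_apply, smul_eq_mul, one_apply_eq_self]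
    congr 1
    rw [EuclideanSpace.inner_single_left, Matrix.one_apply]
    simp
  have h2 : tr N = m.trace := by
    simp only [tr, hm, Matrix.trace, Matrix.diag, Matrix.of_apply]
    exact Finset.sum_congr rfl fun i _ => real_inner_comm _ _
  simp only [h1]
  have h6 := fun r : ℝ => Matrix.det_one_add_smul r m
  rw [funext h6]
  set p := (1 + (Polynomial.X : Polynomial ℝ) • m.map Polynomial.C).det.divX.divX
  have h3 := ((hasDerivAt_id (0:ℝ)).const_mul m.trace).const_add 1
  have h4 := (p.hasDerivAt 0).mul (hasDerivAt_pow 2 (0:ℝ))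
  have h5 := h3.add h4
  rw [h2]
  refine (h5.congr_deriv (by simp only [mul_one]; norm_num)).congr_of_eventuallyEq ?_
  exact Eventually.of_forall fun r => by simp only [Pi.add_apply, Pi.mul_apply, id]

lemma lin_zero_smul {d : ℕ} (M : Lin d) : (0 : ℝ) • M = 0 := zero_smul ℝ M

lemma lin_mul_smul {d : ℕ} (r : ℝ) (M N : Lin d) : M * (r • N) = r • (M * N) := by
  ext1 v; simp

lemma contDiffAt_gauss {d : ℕ} {n : WithTop ℕ∞} {κ δ : ℝ} {C : Lin d} (h : Ell κ δ C) (hκ : 0 < κ) (hδ : 0 < δ)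
    (v : Vec d) : ContDiffAt ℝ n (fun p : Lin d × Vec d => gauss p.1 p.2) (C, v) := by
  have hi : ContDiffAt ℝ n (fun p : Lin d × Vec d => linv p.1) (C, v) := by
    obtain ⟨U, hU⟩ := h.isUnit hκ hδ
    have := contDiffAt_ringInverse ℝ (n := n) U
    rw [hU] at this
    exact ContDiffAt.comp (C, v) this contDiffAt_fst
  have hd : ContDiffAt ℝ n (fun p : Lin d × Vec d => (2 * Real.pi) ^ d * p.1.det) (C, v) :=
    contDiffAt_const.mul (contDiff_det.contDiffAt.comp (C, v) contDiffAt_fst)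
  have hp : (2 * Real.pi) ^ d * C.det ≠ 0 := by
    have := h.det_pos hκ hδ
    positivity
  unfold gauss
  refine ContDiffAt.mul ((hd.sqrt hp).inv (by
    have := h.det_pos hκ hδ
    positivity)) (ContDiffAt.exp (contDiffAt_const.mul ?_))
  exact (hi.clm_apply contDiffAt_snd).inner ℝ contDiffAt_snd

lemma hasDerivAt_gauss_line {d : ℕ} {κ δ : ℝ} {C : Lin d} (h : Ell κ δ C) (hκ : 0 < κ) (hδ : 0 < δ)
    (v : Vec d) (M : Lin d) (η : Vec d) :
    HasDerivAt (fun r : ℝ => gauss (C + r • M) (v + r • η))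
      (-jf C η (-M) v - 2 * ⟪linv C v, η⟫ * gauss C v) 0 := by
  have hu := h.isUnit hκ hδ
  have hi : HasDerivAt (fun r : ℝ => linv (C + r • M)) (-(linv C * M * linv C)) 0 := by
    obtain ⟨U, hU⟩ := hu
    have h1 := hasFDerivAt_ringInverse (𝕜 := ℝ) U
    have h2 : HasDerivAt (fun r : ℝ => C + r • M) M 0 := by
      simpa using ((hasDerivAt_id (0:ℝ)).smul_const M).const_add C
    have h3 : C + (0:ℝ) • M = U := by rw [lin_zero_smul, add_zero, hU]
    rw [← h3] at h1
    have h4 := h1.comp_hasDerivAt 0 h2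
    refine h4.congr_deriv ?_
    simp [linv, ← hU]
  have hv : HasDerivAt (fun r : ℝ => v + r • η) η 0 := by
    simpa using ((hasDerivAt_id (0:ℝ)).smul_const η).const_add v
  have hdet : HasDerivAt (fun r : ℝ => (C + r • M).det) (C.det * tr (linv C * M)) 0 := by
    have h1 : ∀ r : ℝ, (C + r • M).det = C.det * ((1 : Lin d) + r • (linv C * M)).det := by
      intro r
      have : C + r • M = C * ((1 : Lin d) + r • (linv C * M)) := by
        rw [mul_add, mul_one, lin_mul_smul, ← mul_assoc, Ring.mul_inverse_cancel C hu, one_mul]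
      rw [this, ContinuousLinearMap.det, ContinuousLinearMap.toLinearMap_mul, map_mul]
    simp_rw [h1]
    exact (hasDerivAt_det_one_add _).const_mul _
  have hq : HasDerivAt (fun r : ℝ => ⟪linv (C + r • M) (v + r • η), v + r • η⟫)
      (2 * ⟪linv C v, η⟫ - ⟪linv C v, M (linv C v)⟫) 0 := by
    have := (hi.clm_apply hv).inner ℝ hv
    refine this.congr_deriv ?_
    simp only [lin_zero_smul, zero_smul, add_zero, _root_.neg_apply, inner_add_left, inner_neg_left,
      mul_apply_eq_comp]
    rw [h.inv_sym hκ hδ η v, h.inv_sym hκ hδ (M _) v, real_inner_comm η, real_inner_comm (M _)]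
    ring
  have hdp := h.det_pos hκ hδ
  have hp : 0 < (2 * Real.pi) ^ d * C.det := by positivity
  have hs := ((hdet.const_mul ((2 * Real.pi) ^ d)).sqrt (by simpa [lin_zero_smul] using hp.ne')).inv
    (by simpa [lin_zero_smul] using (Real.sqrt_pos.2 hp).ne')
  have := hs.mul (hq.const_mul (-(1 / 2) : ℝ)).exp
  refine this.congr_deriv ?_
  simp only [lin_zero_smul, zero_smul, add_zero, Pi.inv_apply]
  have hsq : Real.sqrt ((2 * Real.pi) ^ d * C.det) ^ 2 = (2 * Real.pi) ^ d * C.det := Real.sq_sqrt hp.le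
  have hsp := Real.sqrt_pos.2 hp
  rw [jf, gauss]
  set s := Real.sqrt ((2 * Real.pi) ^ d * C.det)
  rw [← mul_assoc ((2 * Real.pi) ^ d) C.det, ← hsq]
  have h6 : tr (linv C * -M) = - tr (linv C * M) := by simp [tr]
  rw [h6, _root_.neg_apply, inner_neg_right]
  field_simp
  ring

lemma hasFDerivAt_gauss {d : ℕ} {κ δ : ℝ} {C : Lin d} (h : Ell κ δ C) (hκ : 0 < κ) (hδ : 0 < δ)
    (v : Vec d) (M : Lin d) (η : Vec d) :
    fderiv ℝ (fun p : Lin d × Vec d => gauss p.1 p.2) (C, v) (M, η) =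
      -jf C η (-M) v - 2 * ⟪linv C v, η⟫ * gauss C v := by
  have h1 := ((contDiffAt_gauss (n := 1) h hκ hδ v).differentiableAt one_ne_zero).hasFDerivAt
  have h2 : HasDerivAt (fun r : ℝ => (C, v) + r • (M, η)) (M, η) 0 := by
    simpa using ((hasDerivAt_id (0:ℝ)).smul_const (M, η)).const_add (C, v)
  have h3 : (C, v) + (0:ℝ) • (M, η) = (C, v) := by simp [lin_zero_smul]
  rw [← h3] at h1
  have h4 := h1.comp_hasDerivAt 0 h2
  rw [h3] at h4
  exact h4.unique (hasDerivAt_gauss_line h hκ hδ v M η)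

lemma fderiv_gauss_neg {d : ℕ} {κ δ : ℝ} {C : Lin d} (h : Ell κ δ C) (hκ : 0 < κ) (hδ : 0 < δ)
    (v : Vec d) (M : Lin d) (η : Vec d) :
    fderiv ℝ (fun p : Lin d × Vec d => gauss p.1 p.2) (C, v) (-M, -η) = -jf C η M v := by
  rw [hasFDerivAt_gauss h hκ hδ, neg_neg, jf, jf]
  simp only [inner_neg_right]
  ring

/-- A second-order differential operator with frozen coefficients. -/
def gen {d : ℕ} (b : Vec d) (a : Lin d) (f : Vec d → ℝ) (z : Vec d) : ℝ :=
  fderiv ℝ f z b + (1 / 2) * ∑ j, fderiv ℝ (fderiv ℝ f) z (a (ee j)) (ee j)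

section spatial
variable {d : ℕ} {κ δ : ℝ} {C : Lin d}

lemma contDiff_gauss_sub {n : WithTop ℕ∞} (θ : Vec d) : ContDiff ℝ n (fun z => gauss C (z - θ)) := by
  unfold gauss
  have h1 : ContDiff ℝ n fun z : Vec d => z - θ := contDiff_id.sub contDiff_const
  exact contDiff_const.mul (contDiff_const.mul
    (((linv C).contDiff.comp h1).inner ℝ h1)).exp

lemma fderiv_gauss_sub (h : Ell κ δ C) (hκ : 0 < κ) (hδ : 0 < δ) (θ z e : Vec d) :
    fderiv ℝ (fun z => gauss C (z - θ)) z e = -⟪linv C (z - θ), e⟫ * gauss C (z - θ) := by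
  have h1 : HasFDerivAt (fun z : Vec d => z - θ) (ContinuousLinearMap.id ℝ (Vec d)) z :=
    (hasFDerivAt_id z).sub_const θ
  have h2 := ((((linv C).hasFDerivAt.comp z h1).inner ℝ h1).const_mul (-(1/2) : ℝ)).exp.const_mul
    (Real.sqrt ((2 * Real.pi) ^ d * C.det))⁻¹
  have h3 : (fun z => gauss C (z - θ)) = fun z => (Real.sqrt ((2 * Real.pi) ^ d * C.det))⁻¹ *
    Real.exp (-(1 / 2) * ⟪(linv C ∘ fun z => z - θ) z, z - θ⟫) := by
    ext z; simp [gauss]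
  rw [h3, h2.fderiv]
  simp [gauss, -map_sub]
  rw [h.inv_sym hκ hδ e (z - θ), real_inner_comm e]
  ring_nf

lemma fderiv2_gauss_sub (h : Ell κ δ C) (hκ : 0 < κ) (hδ : 0 < δ) (θ z e e' : Vec d) :
    fderiv ℝ (fderiv ℝ (fun z => gauss C (z - θ))) z e e' =
      (⟪linv C (z - θ), e⟫ * ⟪linv C (z - θ), e'⟫ - ⟪linv C e, e'⟫) * gauss C (z - θ) := by
  have hd : DifferentiableAt ℝ (fderiv ℝ (fun z => gauss C (z - θ))) z :=
    ((contDiff_gauss_sub (C := C) (n := 2) θ).fderiv_right (m := 1) (by norm_num)).differentiable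
      (by norm_num) z
  have h1 : fderiv ℝ (fderiv ℝ (fun z => gauss C (z - θ))) z e e' =
      fderiv ℝ (fun y => fderiv ℝ (fun z => gauss C (z - θ)) y e') z e := by
    rw [fderiv_clm_apply hd (differentiableAt_const _)]
    simp
  rw [h1]
  simp_rw [fderiv_gauss_sub h hκ hδ]
  have h2 : HasFDerivAt (fun z : Vec d => z - θ) (ContinuousLinearMap.id ℝ (Vec d)) z :=
    (hasFDerivAt_id z).sub_const θ
  have h3 := (((linv C).hasFDerivAt.comp z h2).inner ℝ (hasFDerivAt_const e' z)).neg
  have h4 := ((contDiff_gauss_sub (C := C) (n := 1) θ).differentiable (by norm_num) z).hasFDerivAt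
  have h5 := h3.mul h4
  have h6 := h5.fderiv
  have h7 := congrArg (fun L : Vec d →L[ℝ] ℝ => L e) h6
  refine Eq.trans ?_ (h7.trans ?_)
  · rfl
  simp [fderiv_gauss_sub h hκ hδ]
  ring

lemma gen_gauss_sub (h : Ell κ δ C) (hκ : 0 < κ) (hδ : 0 < δ) (b : Vec d) (a : Lin d) (θ z : Vec d) :
    gen b a (fun z => gauss C (z - θ)) z = jf C b a (z - θ) := by
  rw [gen, fderiv_gauss_sub h hκ hδ, jf, tr]
  simp_rw [fderiv2_gauss_sub h hκ hδ]
  have h1 : ⟪linv C (z - θ), a (linv C (z - θ))⟫ =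
      ∑ j, ⟪linv C (z - θ), a (ee j)⟫ * ⟪linv C (z - θ), ee j⟫ := by
    have h2 := congrArg (fun w => ⟪linv C (z - θ), a w⟫) (sum_inner_ee (linv C (z - θ)))
    rw [← h2, map_sum, inner_sum]
    refine Finset.sum_congr rfl fun i _ => ?_
    rw [map_smul, inner_smul_right, mul_comm]
  rw [h1, ← Finset.sum_mul, Finset.sum_sub_distrib]
  simp only [mul_apply_eq_comp]
  ring

lemma exists_gauss_poly_bound (h : Ell κ δ C) (hκ : 0 < κ) (hδ : 0 < δ) :
    ∃ B, 0 ≤ B ∧ ∀ v : Vec d, (1 + ‖v‖) ^ 4 * gauss C v ≤ B := by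
  obtain ⟨B, hB, h1⟩ := exists_pow_exp_le (c := (2 * κ ^ 3 * δ)⁻¹) (by positivity)
  refine ⟨B * (κ ^ ((d : ℝ) / 2) * δ ^ (-(d : ℝ) / 2)), by positivity, fun v => ?_⟩
  have h2 := h1 ‖v‖ (norm_nonneg _)
  have h3 := gauss_le h hκ hδ v
  have h4 : Real.exp (-((2 * κ ^ 3 * δ)⁻¹ / 2 * ‖v‖ ^ 2)) ≤ 1 :=
    Real.exp_le_one_iff.2 (neg_nonpos.2 (by positivity))
  calc _ ≤ (1 + ‖v‖) ^ 4 * (κ ^ ((d : ℝ) / 2) * (δ ^ (-(d : ℝ) / 2) *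
        Real.exp (-(‖v‖ ^ 2 / (2 * κ ^ 3 * δ))))) := by gcongr
    _ = ((1 + ‖v‖) ^ 4 * Real.exp (-((2 * κ ^ 3 * δ)⁻¹ * ‖v‖ ^ 2))) *
        (κ ^ ((d : ℝ) / 2) * δ ^ (-(d : ℝ) / 2)) := by
      rw [div_eq_inv_mul]; ring
    _ ≤ (B * 1) * (κ ^ ((d : ℝ) / 2) * δ ^ (-(d : ℝ) / 2)) := by
      refine mul_le_mul_of_nonneg_right ?_ (by positivity)
      exact h2.trans (by gcongr)
    _ = _ := by ring

end spatial

end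

section

/-- A flow of laws solving the Fokker–Planck equation, given through a continuous process. -/
structure FPFlow {d : ℕ} {Ω : Type} [MeasurableSpace Ω] (b : ℝ → Vec d → Vec d)
    (a : ℝ → Vec d → Lin d) (r S : ℝ) (P : Measure Ω) (X : ℝ → Ω → Vec d) : Prop where
  mass : P univ ≤ 1
  meas : ∀ t, Measurable (X t)
  cont : ∀ ω, Continuous fun t => X t ω
  eqn : ∀ f : Vec d → ℝ, ContDiff ℝ (⊤ : ℕ∞) f → HasCompactSupport f → ∀ u v : ℝ, r ≤ u → u ≤ v →
    v ≤ S → ∫ ω, f (X v ω) ∂P - ∫ ω, f (X u ω) ∂P =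
      ∫ ρ in u..v, ∫ ω, gen (b ρ (X ρ ω)) (a ρ (X ρ ω)) f (X ρ ω) ∂P

lemma FPFlow.finite {d : ℕ} {Ω : Type} [MeasurableSpace Ω] {b : ℝ → Vec d → Vec d}
    {a : ℝ → Vec d → Lin d} {r S : ℝ} {P : Measure Ω} {X : ℝ → Ω → Vec d}
    (h : FPFlow b a r S P X) : IsFiniteMeasure P :=
  ⟨h.mass.trans_lt ENNReal.one_lt_top⟩

lemma FPFlow.joint_meas {d : ℕ} {Ω : Type} [MeasurableSpace Ω] {b : ℝ → Vec d → Vec d}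
    {a : ℝ → Vec d → Lin d} {r S : ℝ} {P : Measure Ω} {X : ℝ → Ω → Vec d}
    (h : FPFlow b a r S P X) : Measurable fun p : ℝ × Ω => X p.1 p.2 :=
  measurable_uncurry_of_continuous_of_measurable (u := X) h.cont h.meas

lemma FPFlow.real_mass {d : ℕ} {Ω : Type} [MeasurableSpace Ω] {b : ℝ → Vec d → Vec d}
    {a : ℝ → Vec d → Lin d} {r S : ℝ} {P : Measure Ω} {X : ℝ → Ω → Vec d}
    (h : FPFlow b a r S P X) : P.real univ ≤ 1 :=
  ENNReal.toReal_le_of_le_ofReal zero_le_one (by simpa using h.mass)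

lemma abs_integral_le_of_mass {Ω : Type*} [MeasurableSpace Ω] {P : Measure Ω} [IsFiniteMeasure P]
    (hP : P.real univ ≤ 1) {f : Ω → ℝ} {B : ℝ} (hB : 0 ≤ B) (hf : ∀ ω, |f ω| ≤ B) :
    |∫ ω, f ω ∂P| ≤ B := by
  have := norm_integral_le_of_norm_le_const (μ := P) (f := f) (C := B) (Eventually.of_forall hf)
  exact this.trans (mul_le_of_le_one_right hB hP)

lemma abs_gen_le {d : ℕ} (b : Vec d) (a : Lin d) (f : Vec d → ℝ) (z : Vec d) :
    |gen b a f z| ≤ ‖fderiv ℝ f z‖ * ‖b‖ + d * (‖iteratedFDeriv ℝ 2 f z‖ * ‖a‖) := by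
  have h1 : |fderiv ℝ f z b| ≤ ‖fderiv ℝ f z‖ * ‖b‖ := (fderiv ℝ f z).le_opNorm b
  have h2 : ∀ j : Fin d, |fderiv ℝ (fderiv ℝ f) z (a (ee j)) (ee j)| ≤
      ‖iteratedFDeriv ℝ 2 f z‖ * ‖a‖ := by
    intro j
    have h3 := (iteratedFDeriv ℝ 2 f z).le_opNorm ![a (ee j), ee j]
    rw [iteratedFDeriv_two_apply] at h3
    simp only [Fin.prod_univ_two, Matrix.cons_val_zero, Matrix.cons_val_one, Real.norm_eq_abs] at h3
    refine h3.trans ?_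
    have h4 := a.le_opNorm (ee j)
    simp only [PiLp.norm_single, norm_one, mul_one] at h4 ⊢
    gcongr
  have h3 : |∑ j : Fin d, fderiv ℝ (fderiv ℝ f) z (a (ee j)) (ee j)| ≤
      d * (‖iteratedFDeriv ℝ 2 f z‖ * ‖a‖) := by
    refine (Finset.abs_sum_le_sum_abs _ _).trans ((Finset.sum_le_sum fun j _ => h2 j).trans ?_)
    simp
  have h4 : 0 ≤ d * (‖iteratedFDeriv ℝ 2 f z‖ * ‖a‖) := by positivity
  rw [gen]
  refine (abs_add_le _ _).trans (add_le_add h1 ?_)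
  rw [abs_mul, abs_of_pos (by norm_num : (0:ℝ) < 1 / 2)]
  linarith

lemma gen_congr {d : ℕ} (b : Vec d) (a : Lin d) {f g : Vec d → ℝ} {z : Vec d} (h : f =ᶠ[𝓝 z] g) :
    gen b a f z = gen b a g z := by
  rw [gen, gen, h.fderiv_eq, h.fderiv.fderiv_eq]

lemma measurable_gen {d : ℕ} {f : Vec d → ℝ} (hf : ContDiff ℝ 2 f) {γ : Type*} [MeasurableSpace γ]
    {b : γ → Vec d} {a : γ → Lin d} {z : γ → Vec d} (hb : Measurable b) (ha : Measurable a)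
    (hz : Measurable z) : Measurable fun p => gen (b p) (a p) f (z p) := by
  have h1 : Continuous (fun q : Vec d × Vec d => fderiv ℝ f q.1 q.2) :=
    ((hf.continuous_fderiv (by norm_num)).comp continuous_fst).clm_apply continuous_snd
  have h2 : Continuous (fderiv ℝ (fderiv ℝ f)) :=
    (hf.fderiv_right (m := 1) (by norm_num)).continuous_fderiv (by norm_num)
  have h3 : ∀ j : Fin d, Continuous (fun q : Vec d × Lin d =>
      fderiv ℝ (fderiv ℝ f) q.1 (q.2 (ee j)) (ee j)) := fun j =>
    (((h2.comp continuous_fst).clm_apply (continuous_snd.clm_apply continuous_const))).clm_apply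
      continuous_const
  unfold gen
  refine (h1.measurable.comp (hz.prodMk hb)).add (Measurable.const_mul ?_ _)
  exact Finset.measurable_sum _ fun j _ => (h3 j).measurable.comp (hz.prodMk ha)

lemma two_le_infty : (2 : WithTop ℕ∞) ≤ ((⊤ : ℕ∞) : WithTop ℕ∞) := by
  show ((2 : ℕ∞) : WithTop ℕ∞) ≤ ((⊤ : ℕ∞) : WithTop ℕ∞)
  exact WithTop.coe_le_coe.2 le_top

lemma exists_cutoff (d : ℕ) : ∃ (χ : ℕ → Vec d → ℝ) (M : ℝ), 0 ≤ M ∧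
    (∀ n, ContDiff ℝ (⊤ : ℕ∞) (χ n)) ∧ (∀ n, HasCompactSupport (χ n)) ∧
    (∀ n z, |χ n z| ≤ 1) ∧ (∀ n z, (1 + ‖z‖) * ‖fderiv ℝ (χ n) z‖ ≤ M) ∧
    (∀ n z, ‖iteratedFDeriv ℝ 2 (χ n) z‖ ≤ M) ∧
    ∀ z, ∀ᶠ n in atTop, χ n =ᶠ[𝓝 z] fun _ => 1 := by
  let χ : ContDiffBump (0 : Vec d) := ⟨1, 2, one_pos, one_lt_two⟩
  have hχ : ContDiff ℝ (⊤ : ℕ∞) χ := χ.contDiff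
  have hc : HasCompactSupport χ := χ.hasCompactSupport
  have c1 : Continuous fun z => (1 + ‖z‖) * ‖fderiv ℝ χ z‖ :=
    (continuous_const.add continuous_norm).mul (hχ.continuous_fderiv (by simp)).norm
  have c2 : Continuous fun z => ‖iteratedFDeriv ℝ 2 χ z‖ :=
    (hχ.continuous_iteratedFDeriv (m := 2) two_le_infty).norm
  obtain ⟨M1, hM1⟩ := c1.bounded_above_of_compact_support
    (HasCompactSupport.mul_left (hc.fderiv (𝕜 := ℝ)).norm)
  obtain ⟨M2, hM2⟩ := c2.bounded_above_of_compact_support (hc.iteratedFDeriv (𝕜 := ℝ) 2).norm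
  have hM10 : 0 ≤ M1 := (norm_nonneg _).trans (hM1 0)
  have hM20 : 0 ≤ M2 := (norm_nonneg _).trans (hM2 0)
  have hR : ∀ n : ℕ, (0:ℝ) < ((n:ℝ) + 1)⁻¹ := fun n => by positivity
  have hR1 : ∀ n : ℕ, ((n:ℝ) + 1)⁻¹ ≤ 1 := fun n => inv_le_one_of_one_le₀ (by linarith [n.cast_nonneg (α := ℝ)])
  refine ⟨fun n z => χ (((n:ℝ) + 1)⁻¹ • z), M1 + M2, by positivity, fun n => ?_, fun n => ?_,
    fun n z => ?_, fun n z => ?_, fun n z => ?_, fun z => ?_⟩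
  · exact hχ.comp (contDiff_const_smul _)
  · exact hc.comp_smul (hR n).ne'
  · rw [abs_of_nonneg χ.nonneg]; exact χ.le_one
  · have h1 := congrFun (iteratedFDeriv_comp_const_smul (i := 1) (f := χ) (((n:ℝ) + 1)⁻¹)
      (hχ.of_le (by exact_mod_cast le_top))) z
    rw [← norm_iteratedFDeriv_one, h1, norm_smul, norm_iteratedFDeriv_one, pow_one, Real.norm_eq_abs,
      abs_of_pos (hR n)]
    have h2 := hM1 (((n:ℝ) + 1)⁻¹ • z)
    rw [Real.norm_eq_abs, abs_of_nonneg (by positivity), norm_smul, Real.norm_eq_abs,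
      abs_of_pos (hR n)] at h2
    have h3 := norm_nonneg (fderiv ℝ χ (((n:ℝ) + 1)⁻¹ • z))
    calc _ = (((n:ℝ) + 1)⁻¹ + ((n:ℝ) + 1)⁻¹ * ‖z‖) * ‖fderiv ℝ χ (((n:ℝ) + 1)⁻¹ • z)‖ := by ring
      _ ≤ (1 + ((n:ℝ) + 1)⁻¹ * ‖z‖) * ‖fderiv ℝ χ (((n:ℝ) + 1)⁻¹ • z)‖ := by gcongr; exact hR1 n
      _ ≤ _ := by linarith
  · have h1 := congrFun (iteratedFDeriv_comp_const_smul (i := 2) (f := χ) (((n:ℝ) + 1)⁻¹)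
      (hχ.of_le two_le_infty)) z
    rw [h1, norm_smul, norm_pow, Real.norm_eq_abs, abs_of_pos (hR n)]
    have h2 := hM2 (((n:ℝ) + 1)⁻¹ • z)
    rw [norm_norm] at h2
    have h3 : (((n:ℝ) + 1)⁻¹) ^ 2 ≤ 1 := pow_le_one₀ (hR n).le (hR1 n)
    nlinarith [norm_nonneg (iteratedFDeriv ℝ 2 χ (((n:ℝ) + 1)⁻¹ • z))]
  · obtain ⟨N, hN⟩ := exists_nat_gt ‖z‖
    filter_upwards [eventually_ge_atTop N] with n hn
    have h1 : ‖z‖ < (n:ℝ) + 1 := hN.trans_le (by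
      have : (N:ℝ) ≤ n := by exact_mod_cast hn
      linarith)
    have h2 : Metric.ball (0 : Vec d) ((n:ℝ) + 1) ∈ 𝓝 z :=
      Metric.isOpen_ball.mem_nhds (by simpa using h1)
    filter_upwards [h2] with y hy
    refine χ.one_of_mem_closedBall ?_
    have hy' : ‖y‖ < (n:ℝ) + 1 := by simpa using hy
    rw [mem_closedBall_zero_iff, norm_smul, Real.norm_eq_abs, abs_of_pos (hR n)]
    change _ ≤ (1:ℝ)
    rw [inv_mul_le_iff₀ (by positivity)]
    linarith

lemma FPFlow.extend {d : ℕ} {Ω : Type} [MeasurableSpace Ω] {b : ℝ → Vec d → Vec d}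
    {a : ℝ → Vec d → Lin d} {r S : ℝ} {P : Measure Ω} {X : ℝ → Ω → Vec d}
    (h : FPFlow b a r S P X) {K : ℝ} (hK : 0 ≤ K)
    (hbm : Measurable (Function.uncurry b)) (ham : Measurable (Function.uncurry a))
    (hb : ∀ u z, ‖b u z‖ ≤ K * (1 + ‖z‖)) (ha : ∀ u z, ‖a u z‖ ≤ K)
    {f : Vec d → ℝ} (hf : ContDiff ℝ (⊤ : ℕ∞) f) {B : ℝ} (hf0 : ∀ z, |f z| ≤ B)
    (hf1 : ∀ z, (1 + ‖z‖) * ‖fderiv ℝ f z‖ ≤ B) (hf2 : ∀ z, ‖iteratedFDeriv ℝ 2 f z‖ ≤ B)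
    {u v : ℝ} (hru : r ≤ u) (huv : u ≤ v) (hvS : v ≤ S) :
    ∫ ω, f (X v ω) ∂P - ∫ ω, f (X u ω) ∂P =
      ∫ ρ in u..v, ∫ ω, gen (b ρ (X ρ ω)) (a ρ (X ρ ω)) f (X ρ ω) ∂P := by
  have := h.finite
  have hB : 0 ≤ B := (abs_nonneg _).trans (hf0 0)
  obtain ⟨χ, M, hM, hχ, hχc, hχ0, hχ1, hχ2, hχe⟩ := exists_cutoff d
  set g : ℕ → Vec d → ℝ := fun n z => χ n z * f z with hg
  have hgs : ∀ n, ContDiff ℝ (⊤ : ℕ∞) (g n) := fun n => (hχ n).mul hf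
  have hge : ∀ z, ∀ᶠ n in atTop, g n =ᶠ[𝓝 z] f := by
    intro z
    filter_upwards [hχe z] with n hn
    filter_upwards [hn] with y hy
    simp [hg, hy]
  have hg0 : ∀ n z, |g n z| ≤ B := by
    intro n z
    rw [hg, abs_mul]
    exact (mul_le_mul (hχ0 n z) (hf0 z) (abs_nonneg _) zero_le_one).trans (one_mul B).le
  have hg1 : ∀ n z, (1 + ‖z‖) * ‖fderiv ℝ (g n) z‖ ≤ B + B * M := by
    intro n z
    have e1 : fderiv ℝ (g n) z = χ n z • fderiv ℝ f z + f z • fderiv ℝ (χ n) z :=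
      fderiv_fun_mul ((hχ n).differentiable (by simp) z) (hf.differentiable (by simp) z)
    rw [e1]
    have e2 : ‖χ n z • fderiv ℝ f z + f z • fderiv ℝ (χ n) z‖ ≤
        1 * ‖fderiv ℝ f z‖ + B * ‖fderiv ℝ (χ n) z‖ := by
      refine (norm_add_le _ _).trans ?_
      rw [norm_smul, norm_smul]
      gcongr
      · exact hχ0 n z
      · exact hf0 z
    calc _ ≤ (1 + ‖z‖) * (1 * ‖fderiv ℝ f z‖ + B * ‖fderiv ℝ (χ n) z‖) := by gcongr
      _ = (1 + ‖z‖) * ‖fderiv ℝ f z‖ + B * ((1 + ‖z‖) * ‖fderiv ℝ (χ n) z‖) := by ring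
      _ ≤ _ := by gcongr; exacts [hf1 z, hχ1 n z]
  have hg2 : ∀ n z, ‖iteratedFDeriv ℝ 2 (g n) z‖ ≤ B + 2 * (M * B) + M * B := by
    intro n z
    have e1 := norm_iteratedFDeriv_mul_le (hχ n) hf z (n := 2) two_le_infty
    refine e1.trans ?_
    rw [Finset.sum_range_succ, Finset.sum_range_succ, Finset.sum_range_one]
    change ((Nat.choose 2 0 : ℕ) : ℝ) * ‖iteratedFDeriv ℝ 0 (χ n) z‖ * ‖iteratedFDeriv ℝ 2 f z‖ +
      ((Nat.choose 2 1 : ℕ) : ℝ) * ‖iteratedFDeriv ℝ 1 (χ n) z‖ * ‖iteratedFDeriv ℝ 1 f z‖ +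
      ((Nat.choose 2 2 : ℕ) : ℝ) * ‖iteratedFDeriv ℝ 2 (χ n) z‖ * ‖iteratedFDeriv ℝ 0 f z‖ ≤ _
    simp only [norm_iteratedFDeriv_zero, norm_iteratedFDeriv_one, Nat.choose_zero_right,
      Nat.choose_one_right, Nat.choose_self]
    have e2 : ‖fderiv ℝ (χ n) z‖ ≤ M := by
      nlinarith [hχ1 n z, norm_nonneg z, norm_nonneg (fderiv ℝ (χ n) z)]
    have e3 : ‖fderiv ℝ f z‖ ≤ B := by
      nlinarith [hf1 z, norm_nonneg z, norm_nonneg (fderiv ℝ f z)]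
    have e4 : ‖χ n z‖ ≤ 1 := hχ0 n z
    have e5 : ‖f z‖ ≤ B := hf0 z
    have e6 := mul_le_mul e4 (hf2 z) (norm_nonneg _) zero_le_one
    have e7 := mul_le_mul e2 e3 (norm_nonneg _) hM
    have e8 := mul_le_mul (hχ2 n z) e5 (norm_nonneg _) hM
    push_cast
    linarith
  set L := (B + B * M) * K + d * ((B + 2 * (M * B) + M * B) * K) with hL
  have hL0 : 0 ≤ L := by positivity
  have hgen : ∀ n ρ z, |gen (b ρ z) (a ρ z) (g n) z| ≤ L := by
    intro n ρ z
    refine (abs_gen_le _ _ _ _).trans (add_le_add ?_ ?_)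
    · calc _ ≤ ‖fderiv ℝ (g n) z‖ * (K * (1 + ‖z‖)) := by gcongr; exact hb ρ z
        _ = ((1 + ‖z‖) * ‖fderiv ℝ (g n) z‖) * K := by ring
        _ ≤ _ := by gcongr; exact hg1 n z
    · gcongr
      exacts [hg2 n z, ha ρ z]
  have hXm := h.joint_meas
  have hbX : Measurable fun p : ℝ × Ω => b p.1 (X p.1 p.2) := hbm.comp (measurable_fst.prodMk hXm)
  have haX : Measurable fun p : ℝ × Ω => a p.1 (X p.1 p.2) := ham.comp (measurable_fst.prodMk hXm)
  have hmg : ∀ {k : Vec d → ℝ}, ContDiff ℝ (⊤ : ℕ∞) k → Measurable fun p : ℝ × Ω =>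
      gen (b p.1 (X p.1 p.2)) (a p.1 (X p.1 p.2)) k (X p.1 p.2) := fun hk =>
    measurable_gen (hk.of_le two_le_infty) hbX haX hXm
  have lim1 : ∀ w, Tendsto (fun n => ∫ ω, g n (X w ω) ∂P) atTop (𝓝 (∫ ω, f (X w ω) ∂P)) := by
    intro w
    refine tendsto_integral_of_dominated_convergence (fun _ => B)
      (fun n => ((hgs n).continuous.measurable.comp (h.meas w)).aestronglyMeasurable)
      (integrable_const B) (fun n => Eventually.of_forall fun ω => hg0 n _)
      (Eventually.of_forall fun ω => ?_)
    refine tendsto_const_nhds.congr' ?_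
    filter_upwards [hge (X w ω)] with n hn using hn.eq_of_nhds.symm
  have lim2 : ∀ ρ, Tendsto (fun n => ∫ ω, gen (b ρ (X ρ ω)) (a ρ (X ρ ω)) (g n) (X ρ ω) ∂P) atTop
      (𝓝 (∫ ω, gen (b ρ (X ρ ω)) (a ρ (X ρ ω)) f (X ρ ω) ∂P)) := by
    intro ρ
    refine tendsto_integral_of_dominated_convergence (fun _ => L)
      (fun n => ((hmg (hgs n)).comp measurable_prodMk_left).aestronglyMeasurable)
      (integrable_const L) (fun n => Eventually.of_forall fun ω => hgen n ρ _)
      (Eventually.of_forall fun ω => ?_)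
    refine tendsto_const_nhds.congr' ?_
    filter_upwards [hge (X ρ ω)] with n hn using (gen_congr _ _ hn).symm
  have lim3 : Tendsto (fun n => ∫ ρ in u..v, ∫ ω, gen (b ρ (X ρ ω)) (a ρ (X ρ ω)) (g n) (X ρ ω) ∂P)
      atTop (𝓝 (∫ ρ in u..v, ∫ ω, gen (b ρ (X ρ ω)) (a ρ (X ρ ω)) f (X ρ ω) ∂P)) := by
    refine intervalIntegral.tendsto_integral_filter_of_dominated_convergence (fun _ => L)
      (Eventually.of_forall fun n => ?_) (Eventually.of_forall fun n => Eventually.of_forall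
        fun ρ _ => ?_) intervalIntegrable_const (Eventually.of_forall fun ρ _ => lim2 ρ)
    · exact ((hmg (hgs n)).stronglyMeasurable.integral_prod_right).aestronglyMeasurable
    · exact abs_integral_le_of_mass h.real_mass hL0 fun ω => hgen n ρ _
  have lim4 := (lim1 v).sub (lim1 u)
  refine tendsto_nhds_unique lim4 (lim3.congr fun n => ?_)
  exact (h.eqn (g n) (hgs n) ((hχc n).mul_right) u v hru huv hvS).symm

end

section

/-- Chain rule along an absolutely continuous curve with bounded speed. -/
lemma chain_integral {V : Type*} [NormedAddCommGroup V] [NormedSpace ℝ V] [CompleteSpace V]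
    {w g : ℝ → V} {Φ : V → ℝ} {s t M : ℝ} (hst : s ≤ t)
    (hgi : IntervalIntegrable g volume s t) (hgM : ∀ ρ ∈ Icc s t, ‖g ρ‖ ≤ M)
    (hw : ∀ u ∈ Icc s t, ∀ v ∈ Icc s t, w v - w u = ∫ ρ in u..v, g ρ)
    (hΦ : ∀ u ∈ Icc s t, ContDiffAt ℝ 1 Φ (w u)) :
    Φ (w t) - Φ (w s) = ∫ ρ in s..t, fderiv ℝ Φ (w ρ) (g ρ) := by
  have hM : 0 ≤ M := (norm_nonneg _).trans (hgM s ⟨le_rfl, hst⟩)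
  have hsub : ∀ u ∈ Icc s t, ∀ v ∈ Icc s t, IntervalIntegrable g volume u v := by
    intro u hu v hv
    refine hgi.mono_set ?_
    rw [uIcc_of_le hst]
    exact uIcc_subset_Icc hu hv
  have hwl : ∀ u ∈ Icc s t, ∀ v ∈ Icc s t, ‖w v - w u‖ ≤ M * |v - u| := by
    intro u hu v hv
    rw [hw u hu v hv]
    refine intervalIntegral.norm_integral_le_of_norm_le_const fun x hx => hgM x ?_
    exact uIcc_subset_Icc hu hv (uIoc_subset_uIcc hx)
  have hwc : ContinuousOn w (Icc s t) := by
    have : LipschitzOnWith (Real.toNNReal M) w (Icc s t) := by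
      refine LipschitzOnWith.of_dist_le_mul fun u hu v hv => ?_
      rw [Real.coe_toNNReal _ hM, dist_eq_norm, Real.dist_eq]
      exact hwl v hv u hu
    exact this.continuousOn
  have hDc : ContinuousOn (fun u => fderiv ℝ Φ (w u)) (Icc s t) := by
    intro u hu
    have h1 : ContinuousAt (fderiv ℝ Φ) (w u) :=
      ((hΦ u hu).fderiv_right (m := 0) (by norm_num)).continuousAt
    exact ContinuousAt.comp_continuousWithinAt h1 (hwc u hu)
  have hDi : IntervalIntegrable (fun ρ => fderiv ℝ Φ (w ρ) (g ρ)) volume s t := by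
    have hm : AEStronglyMeasurable (fun ρ => fderiv ℝ Φ (w ρ) (g ρ)) (volume.restrict (Ioc s t)) := by
      have h1 : AEStronglyMeasurable (fun u => fderiv ℝ Φ (w u)) (volume.restrict (Ioc s t)) :=
        (hDc.mono Ioc_subset_Icc_self).aestronglyMeasurable measurableSet_Ioc
      have h2 : AEStronglyMeasurable g (volume.restrict (Ioc s t)) :=
        ((intervalIntegrable_iff_integrableOn_Ioc_of_le hst).1 hgi).aestronglyMeasurable
      exact (isBoundedBilinearMap_apply.continuous).comp_aestronglyMeasurable (h1.prodMk h2)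
    obtain ⟨K, hK⟩ := isCompact_Icc.exists_bound_of_continuousOn hDc
    rw [intervalIntegrable_iff_integrableOn_Ioc_of_le hst]
    refine Integrable.of_bound hm (K * M) ?_
    refine (ae_restrict_mem measurableSet_Ioc).mono fun ρ hρ => ?_
    have hρ' := Ioc_subset_Icc_self hρ
    refine (ContinuousLinearMap.le_opNorm _ _).trans ?_
    exact mul_le_mul (hK ρ hρ') (hgM ρ hρ') (norm_nonneg _) ((norm_nonneg _).trans (hK ρ hρ'))
  have hDsub : ∀ u ∈ Icc s t, ∀ v ∈ Icc s t,
      IntervalIntegrable (fun ρ => fderiv ℝ Φ (w ρ) (g ρ)) volume u v := by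
    intro u hu v hv
    refine hDi.mono_set ?_
    rw [uIcc_of_le hst]
    exact uIcc_subset_Icc hu hv
  set D : ℝ → ℝ := fun v => Φ (w v) - ∫ ρ in s..v, fderiv ℝ Φ (w ρ) (g ρ) with hD
  have hsm : s ∈ Icc s t := ⟨le_rfl, hst⟩
  have hder : ∀ u ∈ Icc s t, HasDerivWithinAt D 0 (Icc s t) u := by
    intro u hu
    rw [hasDerivWithinAt_iff_isLittleO, Asymptotics.isLittleO_iff]
    intro c hc
    have hf := ((hΦ u hu).differentiableAt (by norm_num)).hasFDerivAt
    rw [hasFDerivAt_iff_isLittleO, Asymptotics.isLittleO_iff] at hf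
    set c' := c / (2 * (M + 1)) with hc'
    have hc'0 : 0 < c' := by positivity
    have e1 := (hwc u hu).tendsto.eventually (hf hc'0)
    have e2 := Metric.continuousWithinAt_iff.1 (hDc u hu) c' hc'0
    obtain ⟨δ, hδ, e2⟩ := e2
    have e3 : ∀ᶠ v in 𝓝[Icc s t] u, dist v u < δ :=
      mem_nhdsWithin_of_mem_nhds (Metric.ball_mem_nhds u hδ)
    filter_upwards [e1, e3, self_mem_nhdsWithin] with v h1 h3 hv
    have k1 : D v - D u - (v - u) • (0 : ℝ) =
        (Φ (w v) - Φ (w u) - fderiv ℝ Φ (w u) (w v - w u)) -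
          ∫ ρ in u..v, (fderiv ℝ Φ (w ρ) - fderiv ℝ Φ (w u)) (g ρ) := by
      have k2 : (∫ ρ in s..v, fderiv ℝ Φ (w ρ) (g ρ)) - ∫ ρ in s..u, fderiv ℝ Φ (w ρ) (g ρ) =
          ∫ ρ in u..v, fderiv ℝ Φ (w ρ) (g ρ) :=
        intervalIntegral.integral_interval_sub_left (hDsub s hsm v hv) (hDsub s hsm u hu)
      have k3 : fderiv ℝ Φ (w u) (w v - w u) = ∫ ρ in u..v, fderiv ℝ Φ (w u) (g ρ) := by
        rw [hw u hu v hv, ContinuousLinearMap.intervalIntegral_comp_comm _ (hsub u hu v hv)]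
      have k4 : ∫ ρ in u..v, (fderiv ℝ Φ (w ρ) - fderiv ℝ Φ (w u)) (g ρ) =
          (∫ ρ in u..v, fderiv ℝ Φ (w ρ) (g ρ)) - ∫ ρ in u..v, fderiv ℝ Φ (w u) (g ρ) := by
        rw [← intervalIntegral.integral_sub (hDsub u hu v hv)]
        · rfl
        · have := hsub u hu v hv
          exact ⟨(fderiv ℝ Φ (w u)).integrable_comp this.1, (fderiv ℝ Φ (w u)).integrable_comp this.2⟩
      rw [k4, ← k2, k3, hD]
      simp only [smul_zero]
      ring
    rw [k1]
    have k5 : ‖∫ ρ in u..v, (fderiv ℝ Φ (w ρ) - fderiv ℝ Φ (w u)) (g ρ)‖ ≤ c' * M * |v - u| := by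
      refine intervalIntegral.norm_integral_le_of_norm_le_const fun x hx => ?_
      have hx1 := uIoc_subset_uIcc hx
      have hx2 : x ∈ Icc s t := uIcc_subset_Icc hu hv hx1
      refine (ContinuousLinearMap.le_opNorm _ _).trans ?_
      have hx3 : dist x u < δ := by
        refine lt_of_le_of_lt ?_ h3
        rw [Real.dist_eq, Real.dist_eq]
        have := abs_sub_left_of_mem_uIcc hx1
        exact this
      have := e2 hx2 hx3
      rw [dist_eq_norm] at this
      exact mul_le_mul this.le (hgM x hx2) (norm_nonneg _) hc'0.le
    refine (norm_sub_le _ _).trans ?_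
    have k6 : c' * ‖w v - w u‖ ≤ c' * (M * |v - u|) :=
      mul_le_mul_of_nonneg_left (hwl u hu v hv) hc'0.le
    rw [Real.norm_eq_abs (v - u)]
    have k7 : c' * M + c' * M ≤ c := by
      have : c' * (2 * (M + 1)) = c := by rw [hc']; field_simp
      nlinarith
    have k8 := mul_le_mul_of_nonneg_right k7 (abs_nonneg (v - u))
    nlinarith
  have hconst : D t = D s := by
    refine constant_of_has_deriv_right_zero (a := s) (b := t) (fun u hu => (hder u hu).continuousWithinAt)
      (fun u hu => ?_) t ⟨hst, le_rfl⟩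
    refine ((hder u (Ico_subset_Icc_self hu)).mono_of_mem_nhdsWithin ?_)
    exact Icc_mem_nhdsGE_of_mem hu
  simp only [hD, intervalIntegral.integral_same, sub_zero] at hconst
  linarith

lemma two_param {K A B : ℝ → ℝ → ℝ} {s t M : ℝ} (hst : s ≤ t)
    (hA : ∀ v ∈ Icc s t, ∀ u ∈ Icc s t, ∀ u' ∈ Icc s t, u ≤ u' → K u' v - K u v = ∫ ρ in u..u', A ρ v)
    (hB : ∀ u ∈ Icc s t, ∀ v ∈ Icc s t, ∀ v' ∈ Icc s t, v ≤ v' → K u v' - K u v = ∫ ρ in v..v', B u ρ)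
    (hAm : Measurable (Function.uncurry A)) (hBm : Measurable (Function.uncurry B))
    (hAM : ∀ ρ ∈ Icc s t, ∀ v ∈ Icc s t, |A ρ v| ≤ M) (hBM : ∀ u ∈ Icc s t, ∀ ρ ∈ Icc s t, |B u ρ| ≤ M)
    (hAc : ∀ ρ ∈ Icc s t, ContinuousOn (fun v => A ρ v) (Icc s t))
    (hBc : ∀ ρ ∈ Icc s t, ContinuousOn (fun u => B u ρ) (Icc s t)) :
    K t t - K s s = ∫ ρ in s..t, (A ρ ρ + B ρ ρ) := by
  rcases hst.eq_or_lt with rfl | hlt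
  · simp
  set h : ℕ → ℝ := fun n => (t - s) / (n + 1) with hh
  have hh0 : ∀ n, 0 < h n := fun n => div_pos (sub_pos.2 hlt) (by positivity)
  have hht : Tendsto h atTop (𝓝 0) := tendsto_const_div_atTop_nhds_zero_nat (t - s) |>.comp
    (tendsto_add_atTop_nat 1) |>.congr fun n => by simp [hh]
  set cl : ℕ → ℝ → ℝ := fun n ρ => s + ⌈(ρ - s) / h n⌉ * h n with hcl
  have cl_lb : ∀ n ρ, ρ ≤ cl n ρ := by
    intro n ρ
    have := mul_le_mul_of_nonneg_right (Int.le_ceil ((ρ - s) / h n)) (hh0 n).le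
    rw [div_mul_cancel₀ _ (hh0 n).ne'] at this
    simp only [hcl]; linarith
  have cl_ub : ∀ n ρ, cl n ρ - h n ≤ ρ := by
    intro n ρ
    have := mul_le_mul_of_nonneg_right (Int.ceil_lt_add_one ((ρ - s) / h n)).le (hh0 n).le
    rw [add_mul, div_mul_cancel₀ _ (hh0 n).ne'] at this
    simp only [hcl]; linarith
  have hpt : ∀ n (i : ℕ), ∀ ρ ∈ Ioc (s + i * h n) (s + (i + 1 : ℕ) * h n),
      cl n ρ = s + (i + 1 : ℕ) * h n := by
    intro n i ρ hρ
    have : ⌈(ρ - s) / h n⌉ = ((i + 1 : ℕ) : ℤ) := by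
      rw [Int.ceil_eq_iff]
      push_cast at hρ ⊢
      constructor
      · rw [lt_div_iff₀ (hh0 n)]; linarith [hρ.1]
      · rw [div_le_iff₀ (hh0 n)]; linarith [hρ.2]
    simp only [hcl, this]
    push_cast; ring
  have hhn : ∀ n : ℕ, ((n + 1 : ℕ) : ℝ) * h n = t - s := by
    intro n; simp only [hh]; push_cast; field_simp
  have hmemi : ∀ n (i : ℕ), i ≤ n + 1 → s + i * h n ∈ Icc s t := by
    intro n i hi
    have h1 : (i : ℝ) * h n ≤ ((n + 1 : ℕ) : ℝ) * h n :=
      mul_le_mul_of_nonneg_right (by exact_mod_cast hi) (hh0 n).le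
    rw [hhn] at h1
    have h2 : 0 ≤ (i : ℝ) * h n := mul_nonneg (by positivity) (hh0 n).le
    constructor <;> linarith
  have hclmem : ∀ n, ∀ ρ ∈ Ioc s t, cl n ρ ∈ Icc s t ∧ cl n ρ - h n ∈ Icc s t := by
    intro n ρ hρ
    have h1 : (0 : ℤ) < ⌈(ρ - s) / h n⌉ := Int.ceil_pos.2 (div_pos (by linarith [hρ.1]) (hh0 n))
    have h2 : ⌈(ρ - s) / h n⌉ ≤ (n + 1 : ℕ) := by
      rw [Int.ceil_le, div_le_iff₀ (hh0 n)]
      have := hhn n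
      push_cast at this ⊢; rw [this]; linarith [hρ.2]
    obtain ⟨k, hk⟩ := Int.eq_ofNat_of_zero_le h1.le
    have hk1 : 1 ≤ k := by omega
    have hk2 : k ≤ n + 1 := by omega
    have h3 := hmemi n k hk2
    have h4 := hmemi n (k - 1) (by omega)
    simp only [hcl, hk]
    refine ⟨by simpa using h3, ?_⟩
    rw [Nat.cast_sub hk1] at h4
    have h5 : s + (Int.ofNat k : ℝ) * h n - h n = s + ((k : ℝ) - (1 : ℕ)) * h n := by
      push_cast; simp; ring
    convert h4 using 1
    simp
    ring
  have clm : ∀ n, Measurable (cl n) := by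
    intro n
    have : Measurable fun ρ : ℝ => ((⌈(ρ - s) / h n⌉ : ℤ) : ℝ) :=
      (measurable_from_top (f := fun k : ℤ => (k : ℝ))).comp (Int.measurable_ceil.comp (by fun_prop))
    simp only [hcl]
    fun_prop
  set G : ℕ → ℝ → ℝ := fun n ρ => A ρ (cl n ρ) + B (cl n ρ - h n) ρ with hG
  have hGm : ∀ n, Measurable (G n) := fun n =>
    (hAm.comp (measurable_id.prodMk (clm n))).add
      (hBm.comp (((clm n).sub_const _).prodMk measurable_id))
  have hGM : ∀ n, ∀ ρ ∈ Ioc s t, ‖G n ρ‖ ≤ M + M := by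
    intro n ρ hρ
    have := hclmem n ρ hρ
    exact (norm_add_le _ _).trans (add_le_add (hAM ρ (Ioc_subset_Icc_self hρ) _ this.1)
      (hBM _ this.2 ρ (Ioc_subset_Icc_self hρ)))
  have hGi : ∀ n, IntervalIntegrable (G n) volume s t := by
    intro n
    rw [intervalIntegrable_iff_integrableOn_Ioc_of_le hst]
    exact Measure.integrableOn_of_bounded (M := M + M) (by simp) (hGm n).aestronglyMeasurable
      ((ae_restrict_mem measurableSet_Ioc).mono (hGM n))
  have hsum : ∀ n, ∫ ρ in s..t, G n ρ = K t t - K s s := by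
    intro n
    have hpiece : ∀ i < n + 1, ∫ ρ in (s + i * h n)..(s + (i + 1 : ℕ) * h n), G n ρ =
        K (s + (i + 1 : ℕ) * h n) (s + (i + 1 : ℕ) * h n) - K (s + i * h n) (s + i * h n) := by
      intro i hi
      have m1 := hmemi n i hi.le
      have m2 := hmemi n (i + 1) hi
      have hle : s + i * h n ≤ s + (i + 1 : ℕ) * h n := by
        push_cast; nlinarith [hh0 n]
      have hAi : IntervalIntegrable (fun ρ => A ρ (s + (i + 1 : ℕ) * h n)) volume
          (s + i * h n) (s + (i + 1 : ℕ) * h n) := by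
        rw [intervalIntegrable_iff_integrableOn_Ioc_of_le hle]
        refine Measure.integrableOn_of_bounded (M := M) (by simp)
          (hAm.comp (measurable_id.prodMk measurable_const)).aestronglyMeasurable ?_
        refine (ae_restrict_mem measurableSet_Ioc).mono fun ρ hρ => hAM ρ ?_ _ m2
        exact ⟨m1.1.trans hρ.1.le, hρ.2.trans m2.2⟩
      have hBi : IntervalIntegrable (fun ρ => B (s + i * h n) ρ) volume
          (s + i * h n) (s + (i + 1 : ℕ) * h n) := by
        rw [intervalIntegrable_iff_integrableOn_Ioc_of_le hle]
        refine Measure.integrableOn_of_bounded (M := M) (by simp)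
          (hBm.comp (measurable_const.prodMk measurable_id)).aestronglyMeasurable ?_
        refine (ae_restrict_mem measurableSet_Ioc).mono fun ρ hρ => hBM _ m1 ρ ?_
        exact ⟨m1.1.trans hρ.1.le, hρ.2.trans m2.2⟩
      have e1 : ∫ ρ in (s + i * h n)..(s + (i + 1 : ℕ) * h n), G n ρ =
          ∫ ρ in (s + i * h n)..(s + (i + 1 : ℕ) * h n),
            (A ρ (s + (i + 1 : ℕ) * h n) + B (s + i * h n) ρ) := by
        refine intervalIntegral.integral_congr_ae (Eventually.of_forall fun ρ hρ => ?_)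
        rw [uIoc_of_le hle] at hρ
        simp only [hG, hpt n i ρ hρ]
        congr 2
        push_cast; ring
      rw [e1, intervalIntegral.integral_add hAi hBi, ← hA _ m2 _ m1 _ m2 hle, ← hB _ m1 _ m1 _ m2 hle]
      ring
    have e2 := intervalIntegral.sum_integral_adjacent_intervals (f := G n) (μ := volume)
      (a := fun i : ℕ => s + i * h n) (n := n + 1) (fun i hi => (hGi n).mono_set (by
        rw [uIcc_of_le hst]
        exact uIcc_subset_Icc (hmemi n i hi.le) (hmemi n (i + 1) hi)))
    have e3 : s + ((n + 1 : ℕ) : ℝ) * h n = t := by rw [hhn]; ring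
    simp only [e3] at e2
    simp only [Nat.cast_zero, zero_mul, add_zero] at e2
    rw [← e2, Finset.sum_congr rfl (fun i hi => hpiece i (Finset.mem_range.1 hi)),
      Finset.sum_range_sub (fun i : ℕ => K (s + i * h n) (s + i * h n)), e3]
    simp
  have hclt : ∀ ρ, Tendsto (fun n => cl n ρ) atTop (𝓝 ρ) := fun ρ => by
    refine tendsto_of_tendsto_of_tendsto_of_le_of_le (g := fun _ => ρ) (h := fun n => ρ + h n)
      tendsto_const_nhds ?_ (fun n => cl_lb n ρ) (fun n => by linarith [cl_ub n ρ])
    simpa using hht.const_add ρ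
  have hlim : Tendsto (fun n => ∫ ρ in s..t, G n ρ) atTop (𝓝 (∫ ρ in s..t, (A ρ ρ + B ρ ρ))) := by
    refine intervalIntegral.tendsto_integral_filter_of_dominated_convergence (fun _ => M + M)
      (Eventually.of_forall fun n => (hGm n).aestronglyMeasurable)
      (Eventually.of_forall fun n => Eventually.of_forall fun ρ hρ => hGM n ρ (by
        rwa [uIoc_of_le hst] at hρ)) intervalIntegrable_const
      (Eventually.of_forall fun ρ hρ => ?_)
    rw [uIoc_of_le hst] at hρ
    have hρ' := Ioc_subset_Icc_self hρ
    refine Tendsto.add ?_ ?_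
    · refine ((hAc ρ hρ') ρ hρ').tendsto.comp (tendsto_nhdsWithin_iff.2 ⟨hclt ρ, ?_⟩)
      exact Eventually.of_forall fun n => (hclmem n ρ hρ).1
    · refine ((hBc ρ hρ') ρ hρ').tendsto.comp (tendsto_nhdsWithin_iff.2 ⟨?_, ?_⟩)
      · simpa using (hclt ρ).sub hht
      · exact Eventually.of_forall fun n => (hclmem n ρ hρ).2
  simp only [hsum] at hlim
  exact tendsto_nhds_unique tendsto_const_nhds hlim

end

section

lemma measurable_linv {d : ℕ} : Measurable (fun C : Lin d => linv C) := by
  have hU : MeasurableSet {C : Lin d | IsUnit C} := (Units.isOpen (R := Lin d)).measurableSet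
  refine measurable_of_restrict_of_restrict_compl hU ?_ ?_
  · refine Continuous.measurable ?_
    rw [← continuousOn_iff_continuous_domRestrict]
    rintro C ⟨u, rfl⟩
    exact (NormedRing.inverse_continuousAt u).continuousWithinAt
  · have : ({C : Lin d | IsUnit C}ᶜ).domRestrict (fun C : Lin d => linv C) = fun _ => 0 := by
      ext1 ⟨C, hC⟩
      exact Ring.inverse_non_unit C hC
    rw [this]
    exact measurable_const

lemma continuous_lin_apply {d : ℕ} : Continuous fun p : Lin d × Vec d => p.1 p.2 :=
  isBoundedBilinearMap_apply.continuous

lemma measurable_lin_apply {d : ℕ} {γ : Type*} [MeasurableSpace γ] {M : γ → Lin d} {v : γ → Vec d}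
    (hM : Measurable M) (hv : Measurable v) : Measurable fun x => M x (v x) :=
  continuous_lin_apply.measurable.comp (hM.prodMk hv)

lemma tendsto_lin_apply {d : ℕ} {γ : Type*} {l : Filter γ} {M : γ → Lin d} {v : γ → Vec d}
    {M₀ : Lin d} {v₀ : Vec d} (hM : Tendsto M l (𝓝 M₀)) (hv : Tendsto v l (𝓝 v₀)) :
    Tendsto (fun x => M x (v x)) l (𝓝 (M₀ v₀)) :=
  (continuous_lin_apply.tendsto (M₀, v₀)).comp (hM.prodMk_nhds hv)

lemma measurable_gauss {d : ℕ} {γ : Type*} [MeasurableSpace γ] {C : γ → Lin d} {v : γ → Vec d}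
    (hC : Measurable C) (hv : Measurable v) : Measurable fun x => gauss (C x) (v x) := by
  have h1 : Measurable fun x => linv (C x) (v x) :=
    measurable_lin_apply (measurable_linv.comp hC) hv
  have h2 : Measurable fun x => (C x).det := (contDiff_det (n := 0)).continuous.measurable.comp hC
  unfold gauss
  fun_prop

lemma measurable_jf {d : ℕ} {γ : Type*} [MeasurableSpace γ] {C M : γ → Lin d} {v w : γ → Vec d}
    (hC : Measurable C) (hw : Measurable w) (hM : Measurable M) (hv : Measurable v) :
    Measurable fun x => jf (C x) (w x) (M x) (v x) := by
  have h0 : Measurable fun x => linv (C x) := measurable_linv.comp hC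
  have h1 : Measurable fun x => linv (C x) (v x) :=
    measurable_lin_apply h0 hv
  have h2 : Measurable fun x => M x (linv (C x) (v x)) :=
    measurable_lin_apply hM h1
  have h3 : Measurable fun x => tr (linv (C x) * M x) := by
    refine Finset.measurable_sum _ fun i _ => Measurable.inner ?_ measurable_const
    exact measurable_lin_apply (v := fun x => M x (ee i)) h0 (measurable_lin_apply hM measurable_const)
  have h4 : Measurable fun x => ⟪linv (C x) (v x), w x⟫ := h1.inner hw
  have h5 : Measurable fun x => ⟪linv (C x) (v x), M x (linv (C x) (v x))⟫ := h1.inner h2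
  exact ((h4.neg).add ((h5.sub h3).const_mul _)).mul (measurable_gauss hC hv)

lemma continuousAt_linv {d : ℕ} {κ δ : ℝ} {C : Lin d} (h : Ell κ δ C) (hκ : 0 < κ) (hδ : 0 < δ) :
    ContinuousAt (fun C : Lin d => linv C) C := by
  obtain ⟨u, rfl⟩ := h.isUnit hκ hδ
  exact NormedRing.inverse_continuousAt u

lemma tendsto_gauss {d : ℕ} {γ : Type*} {l : Filter γ} {C : γ → Lin d} {v : γ → Vec d} {κ δ : ℝ}
    {C₀ : Lin d} {v₀ : Vec d} (h : Ell κ δ C₀) (hκ : 0 < κ) (hδ : 0 < δ)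
    (hC : Tendsto C l (𝓝 C₀)) (hv : Tendsto v l (𝓝 v₀)) :
    Tendsto (fun x => gauss (C x) (v x)) l (𝓝 (gauss C₀ v₀)) :=
  ((contDiffAt_gauss (n := 0) h hκ hδ v₀).continuousAt.tendsto).comp (hC.prodMk_nhds hv)

lemma tendsto_jf {d : ℕ} {γ : Type*} {l : Filter γ} {C M : γ → Lin d} {v w : γ → Vec d} {κ δ : ℝ}
    {C₀ M₀ : Lin d} {v₀ w₀ : Vec d} (h : Ell κ δ C₀) (hκ : 0 < κ) (hδ : 0 < δ)
    (hC : Tendsto C l (𝓝 C₀)) (hw : Tendsto w l (𝓝 w₀)) (hM : Tendsto M l (𝓝 M₀))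
    (hv : Tendsto v l (𝓝 v₀)) :
    Tendsto (fun x => jf (C x) (w x) (M x) (v x)) l (𝓝 (jf C₀ w₀ M₀ v₀)) := by
  have h0 : Tendsto (fun x => linv (C x)) l (𝓝 (linv C₀)) := (continuousAt_linv h hκ hδ).tendsto.comp hC
  have h1 : Tendsto (fun x => linv (C x) (v x)) l (𝓝 (linv C₀ v₀)) :=
    tendsto_lin_apply h0 hv
  have h2 : Tendsto (fun x => M x (linv (C x) (v x))) l (𝓝 (M₀ (linv C₀ v₀))) :=
    tendsto_lin_apply hM h1
  have h3 : Tendsto (fun x => tr (linv (C x) * M x)) l (𝓝 (tr (linv C₀ * M₀))) := by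
    refine tendsto_finsetSum _ fun i _ => Tendsto.inner ?_ tendsto_const_nhds
    exact tendsto_lin_apply (v := fun x => M x (ee i)) (v₀ := M₀ (ee i)) h0 (tendsto_lin_apply hM tendsto_const_nhds)
  have h4 := tendsto_gauss h hκ hδ hC hv
  unfold jf
  exact (((h1.inner hw).neg).add (((h1.inner h2).sub h3).const_mul _)).mul h4

/-- Coefficients of a diffusion together with a regularised drift and its flow. -/
structure Coeffs (d : ℕ) where
  a : ℝ → Vec d → Lin d
  b : ℝ → Vec d → Vec d
  β : ℝ → Vec d → Vec d
  F : ℝ → Vec d → Vec d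
  E : ℝ → Vec d → Vec d

/-- Quantitative hypotheses on the coefficients, on the time interval `[s, S]`. -/
structure Coeffs.Good {d : ℕ} (D : Coeffs d) (κ α T s S : ℝ) : Prop where
  le : s ≤ S
  len : S - s ≤ T
  a_sym : ∀ u x v w, ⟪D.a u x v, w⟫ = ⟪v, D.a u x w⟫
  a_lb : ∀ u x v, κ⁻¹ * ‖v‖ ^ 2 ≤ ⟪D.a u x v, v⟫
  a_ub : ∀ u x, ‖D.a u x‖ ≤ κ
  a_hol : ∀ u x y, ‖D.a u x - D.a u y‖ ≤ κ * ‖x - y‖ ^ α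
  a_meas : Measurable (Function.uncurry D.a)
  b_meas : Measurable (Function.uncurry D.b)
  β_meas : Measurable (Function.uncurry D.β)
  b_sub : ∀ u x, ‖D.b u x - D.β u x‖ ≤ κ
  β_lip : ∀ u x y, ‖D.β u x - D.β u y‖ ≤ κ * ‖x - y‖
  β_zero : ∀ u, ‖D.β u 0‖ ≤ κ
  F_cont : Continuous (Function.uncurry D.F)
  E_cont : Continuous (Function.uncurry D.E)
  FE : ∀ u x, D.F u (D.E u x) = x
  EF : ∀ u x, D.E u (D.F u x) = x
  F_lip : ∀ u x y, ‖D.F u x - D.F u y‖ ≤ κ * ‖x - y‖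
  E_lip : ∀ u x y, ‖D.E u x - D.E u y‖ ≤ κ * ‖x - y‖
  F_int : ∀ u ∈ Icc s S, ∀ v ∈ Icc s S, ∀ x, D.F v x - D.F u x = ∫ ρ in u..v, D.β ρ (D.F ρ x)

namespace Coeffs

variable {d : ℕ} (D : Coeffs d)

/-- The flow from time `τ` back to time `u`. -/
def fl (u τ : ℝ) (y : Vec d) : Vec d := D.F u (D.E τ y)

/-- Covariance of the Gaussian process frozen along the flow line through `(τ, y)`. -/
def cov (u τ : ℝ) (y : Vec d) : Lin d := ∫ ρ in u..τ, D.a ρ (D.fl ρ τ y)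

/-- The frozen Gaussian transition density. -/
def q (u : ℝ) (z : Vec d) (τ : ℝ) (y : Vec d) : ℝ := gauss (D.cov u τ y) (z - D.fl u τ y)

/-- The parametrix error kernel. -/
def H (u : ℝ) (z : Vec d) (τ : ℝ) (y : Vec d) : ℝ :=
  jf (D.cov u τ y) (D.b u z - D.β u (D.fl u τ y)) (D.a u z - D.a u (D.fl u τ y)) (z - D.fl u τ y)

/-- A Gaussian kernel in flow coordinates. -/
def Γ (l : ℝ) (u : ℝ) (z : Vec d) (τ : ℝ) (y : Vec d) : ℝ :=
  gaussk d l (τ - u) (D.E u z - D.E τ y)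

variable {D} {κ α T s S : ℝ}

namespace Good

lemma continuous_fl (h : D.Good κ α T s S) :
    Continuous fun p : ℝ × ℝ × Vec d => D.fl p.1 p.2.1 p.2.2 :=
  h.F_cont.comp (continuous_fst.prodMk (h.E_cont.comp continuous_snd))

lemma continuous_a (h : D.Good κ α T s S) (hα : 0 < α) (u : ℝ) : Continuous (D.a u) := by
  rw [continuous_iff_continuousAt]
  intro x
  rw [ContinuousAt, tendsto_iff_norm_sub_tendsto_zero]
  refine squeeze_zero (fun _ => norm_nonneg _) (fun y => h.a_hol u y x) ?_
  have : Tendsto (fun y => ‖y - x‖) (𝓝 x) (𝓝 0) := tendsto_iff_norm_sub_tendsto_zero.1 tendsto_id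
  have h2 := (this.rpow_const (p := α) (Or.inr hα.le)).const_mul κ
  rwa [Real.zero_rpow hα.ne', mul_zero] at h2

lemma continuous_β (h : D.Good κ α T s S) (u : ℝ) : Continuous (D.β u) := by
  rw [continuous_iff_continuousAt]
  intro x
  rw [ContinuousAt, tendsto_iff_norm_sub_tendsto_zero]
  refine squeeze_zero (fun _ => norm_nonneg _) (fun y => h.β_lip u y x) ?_
  have : Tendsto (fun y => ‖y - x‖) (𝓝 x) (𝓝 0) := tendsto_iff_norm_sub_tendsto_zero.1 tendsto_id
  simpa using this.const_mul κ

lemma measurable_a_fl (h : D.Good κ α T s S) (τ : ℝ) (y : Vec d) :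
    Measurable fun ρ => D.a ρ (D.fl ρ τ y) := by
  have h1 : Continuous fun ρ : ℝ => D.fl ρ τ y :=
    h.continuous_fl.comp (continuous_id.prodMk (continuous_const (y := (τ, y))))
  exact h.a_meas.comp (measurable_id.prodMk h1.measurable)

lemma intervalIntegrable_a (h : D.Good κ α T s S) (τ : ℝ) (y : Vec d) (u v : ℝ) :
    IntervalIntegrable (fun ρ => D.a ρ (D.fl ρ τ y)) volume u v := by
  refine (intervalIntegrable_const (c := κ)).mono_fun' (h.measurable_a_fl τ y).aestronglyMeasurable ?_
  exact Eventually.of_forall fun ρ => h.a_ub ρ _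

lemma continuous_cov (h : D.Good κ α T s S) (hα : 0 < α) :
    Continuous fun p : ℝ × ℝ × Vec d => D.cov p.1 p.2.1 p.2.2 := by
  rw [continuous_iff_continuousAt]
  rintro ⟨u, τ, y⟩
  have h1 : Tendsto (fun p : ℝ × ℝ × Vec d => ∫ ρ in u..τ, D.a ρ (D.fl ρ p.2.1 p.2.2))
      (𝓝 (u, τ, y)) (𝓝 (D.cov u τ y)) := by
    refine intervalIntegral.tendsto_integral_filter_of_dominated_convergence (fun _ => κ)
      (Eventually.of_forall fun p => (h.measurable_a_fl _ _).aestronglyMeasurable)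
      (Eventually.of_forall fun p => Eventually.of_forall fun ρ _ => h.a_ub ρ _) intervalIntegrable_const
      (Eventually.of_forall fun ρ _ => ?_)
    have h2 : Continuous fun p : ℝ × ℝ × Vec d => D.a ρ (D.fl ρ p.2.1 p.2.2) :=
      (h.continuous_a hα ρ).comp (h.continuous_fl.comp (continuous_const.prodMk continuous_snd))
    exact h2.tendsto (u, τ, y)
  have key : ∀ p : ℝ × ℝ × Vec d, ‖D.cov p.1 p.2.1 p.2.2 - ∫ ρ in u..τ, D.a ρ (D.fl ρ p.2.1 p.2.2)‖ ≤
      κ * |p.2.1 - τ| + κ * |u - p.1| := by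
    intro p
    have e : D.cov p.1 p.2.1 p.2.2 - ∫ ρ in u..τ, D.a ρ (D.fl ρ p.2.1 p.2.2) =
        (∫ ρ in τ..p.2.1, D.a ρ (D.fl ρ p.2.1 p.2.2)) + ∫ ρ in p.1..u, D.a ρ (D.fl ρ p.2.1 p.2.2) := by
      have i := h.intervalIntegrable_a p.2.1 p.2.2
      unfold cov
      rw [← intervalIntegral.integral_add_adjacent_intervals (i p.1 u) (i u p.2.1),
        ← intervalIntegral.integral_add_adjacent_intervals (i u τ) (i τ p.2.1)]
      abel
    rw [e]
    refine (norm_add_le _ _).trans (add_le_add ?_ ?_) <;>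
    exact intervalIntegral.norm_integral_le_of_norm_le_const fun x _ => h.a_ub x _
  have h3 : Tendsto (fun p : ℝ × ℝ × Vec d => κ * |p.2.1 - τ| + κ * |u - p.1|) (𝓝 (u, τ, y)) (𝓝 0) := by
    have : Continuous fun p : ℝ × ℝ × Vec d => κ * |p.2.1 - τ| + κ * |u - p.1| := by fun_prop
    simpa using this.tendsto (u, τ, y)
  have h4 := (squeeze_zero_norm key h3).add h1
  simpa [ContinuousAt] using h4

lemma ell (h : D.Good κ α T s S) {u τ : ℝ} (hu : u ≤ τ) (y : Vec d) : Ell κ (τ - u) (D.cov u τ y) := by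
  have hi := h.intervalIntegrable_a τ y u τ
  have hap : ∀ v w : Vec d, ⟪D.cov u τ y v, w⟫ = ∫ ρ in u..τ, ⟪D.a ρ (D.fl ρ τ y) v, w⟫ := by
    intro v w
    have := ContinuousLinearMap.intervalIntegral_comp_comm
      ((innerSL ℝ w).comp (ContinuousLinearMap.apply ℝ (Vec d) v)) hi
    rw [real_inner_comm]
    simp only [ContinuousLinearMap.comp_apply, innerSL_apply_apply, ContinuousLinearMap.apply_apply] at this
    unfold cov
    rw [← this]
    exact intervalIntegral.integral_congr fun ρ _ => real_inner_comm _ _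
  have hi2 : ∀ v w : Vec d, IntervalIntegrable (fun ρ => ⟪D.a ρ (D.fl ρ τ y) v, w⟫) volume u τ := by
    intro v w
    have h1 := ((innerSL ℝ w).comp (ContinuousLinearMap.apply ℝ (Vec d) v)).integrable_comp hi.1
    have h2 := ((innerSL ℝ w).comp (ContinuousLinearMap.apply ℝ (Vec d) v)).integrable_comp hi.2
    refine IntervalIntegrable.congr (f := fun ρ => ⟪w, D.a ρ (D.fl ρ τ y) v⟫) ?_ ⟨h1, h2⟩
    exact fun ρ _ => real_inner_comm _ _
  refine ⟨fun v w => ?_, fun v => ?_, ?_⟩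
  · rw [hap, real_inner_comm, hap]
    refine intervalIntegral.integral_congr fun ρ _ => ?_
    rw [h.a_sym, real_inner_comm]
  · rw [hap]
    have := intervalIntegral.integral_mono_on hu intervalIntegrable_const (hi2 v v)
      (fun ρ _ => h.a_lb ρ (D.fl ρ τ y) v)
    simp only [intervalIntegral.integral_const, smul_eq_mul] at this
    linarith
  · have := intervalIntegral.norm_integral_le_of_norm_le_const (a := u) (b := τ)
      (f := fun ρ => D.a ρ (D.fl ρ τ y)) (C := κ) fun ρ _ => h.a_ub ρ _
    rwa [abs_of_nonneg (sub_nonneg.2 hu)] at this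

attribute [irreducible] cov

lemma measurable_cov (h : D.Good κ α T s S) (hα : 0 < α) {γ : Type*} [MeasurableSpace γ] {u τ : γ → ℝ}
    {y : γ → Vec d} (hu : Measurable u) (hτ : Measurable τ) (hy : Measurable y) :
    Measurable fun x => D.cov (u x) (τ x) (y x) :=
  (h.continuous_cov hα).measurable.comp (hu.prodMk (hτ.prodMk hy))

lemma tendsto_cov (h : D.Good κ α T s S) (hα : 0 < α) {γ : Type*} {l : Filter γ} {u τ : γ → ℝ}
    {y : γ → Vec d} {u₀ τ₀ : ℝ} {y₀ : Vec d} (hu : Tendsto u l (𝓝 u₀)) (hτ : Tendsto τ l (𝓝 τ₀))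
    (hy : Tendsto y l (𝓝 y₀)) : Tendsto (fun x => D.cov (u x) (τ x) (y x)) l (𝓝 (D.cov u₀ τ₀ y₀)) :=
  ((h.continuous_cov hα).tendsto (u₀, τ₀, y₀)).comp (hu.prodMk_nhds (hτ.prodMk_nhds hy))

lemma tendsto_fl (h : D.Good κ α T s S) {γ : Type*} {l : Filter γ} {u τ : γ → ℝ}
    {y : γ → Vec d} {u₀ τ₀ : ℝ} {y₀ : Vec d} (hu : Tendsto u l (𝓝 u₀)) (hτ : Tendsto τ l (𝓝 τ₀))
    (hy : Tendsto y l (𝓝 y₀)) : Tendsto (fun x => D.fl (u x) (τ x) (y x)) l (𝓝 (D.fl u₀ τ₀ y₀)) :=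
  (h.continuous_fl.tendsto (u₀, τ₀, y₀)).comp (hu.prodMk_nhds (hτ.prodMk_nhds hy))

lemma measurable_fl (h : D.Good κ α T s S) {γ : Type*} [MeasurableSpace γ] {u τ : γ → ℝ}
    {y : γ → Vec d} (hu : Measurable u) (hτ : Measurable τ) (hy : Measurable y) :
    Measurable fun x => D.fl (u x) (τ x) (y x) :=
  h.continuous_fl.measurable.comp (hu.prodMk (hτ.prodMk hy))

lemma measurable_q (h : D.Good κ α T s S) (hα : 0 < α) {γ : Type*} [MeasurableSpace γ] {u τ : γ → ℝ}
    {z y : γ → Vec d} (hu : Measurable u) (hz : Measurable z) (hτ : Measurable τ) (hy : Measurable y) :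
    Measurable fun x => D.q (u x) (z x) (τ x) (y x) :=
  measurable_gauss (h.measurable_cov hα hu hτ hy) (hz.sub (h.measurable_fl hu hτ hy))

lemma measurable_H (h : D.Good κ α T s S) (hα : 0 < α) {γ : Type*} [MeasurableSpace γ] {u τ : γ → ℝ}
    {z y : γ → Vec d} (hu : Measurable u) (hz : Measurable z) (hτ : Measurable τ) (hy : Measurable y) :
    Measurable fun x => D.H (u x) (z x) (τ x) (y x) := by
  have h1 := h.measurable_fl hu hτ hy
  have h3 : Measurable fun x => D.b (u x) (z x) := h.b_meas.comp (hu.prodMk hz)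
  have h4 : Measurable fun x => D.a (u x) (z x) := h.a_meas.comp (hu.prodMk hz)
  have h5 : Measurable fun x => D.β (u x) (D.fl (u x) (τ x) (y x)) := h.β_meas.comp (hu.prodMk h1)
  have h6 : Measurable fun x => D.a (u x) (D.fl (u x) (τ x) (y x)) := h.a_meas.comp (hu.prodMk h1)
  exact measurable_jf (h.measurable_cov hα hu hτ hy) (h3.sub h5) (h4.sub h6) (hz.sub h1)

lemma measurable_Γ (h : D.Good κ α T s S) (l : ℝ) {γ : Type*} [MeasurableSpace γ] {u τ : γ → ℝ}
    {z y : γ → Vec d} (hu : Measurable u) (hz : Measurable z) (hτ : Measurable τ) (hy : Measurable y) :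
    Measurable fun x => D.Γ l (u x) (z x) (τ x) (y x) := by
  have h1 : Measurable fun x => D.E (u x) (z x) := h.E_cont.measurable.comp (hu.prodMk hz)
  have h2 : Measurable fun x => D.E (τ x) (y x) := h.E_cont.measurable.comp (hτ.prodMk hy)
  unfold Γ gaussk
  fun_prop

lemma tendsto_q (h : D.Good κ α T s S) (hκ : 0 < κ) (hα : 0 < α) {γ : Type*} {l : Filter γ} {u τ : γ → ℝ}
    {z y : γ → Vec d} {u₀ τ₀ : ℝ} {z₀ y₀ : Vec d} (hlt : u₀ < τ₀) (hu : Tendsto u l (𝓝 u₀))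
    (hz : Tendsto z l (𝓝 z₀)) (hτ : Tendsto τ l (𝓝 τ₀)) (hy : Tendsto y l (𝓝 y₀)) :
    Tendsto (fun x => D.q (u x) (z x) (τ x) (y x)) l (𝓝 (D.q u₀ z₀ τ₀ y₀)) :=
  tendsto_gauss (h.ell hlt.le y₀) hκ (sub_pos.2 hlt) (h.tendsto_cov hα hu hτ hy)
    (hz.sub (h.tendsto_fl hu hτ hy))

lemma tendsto_H (h : D.Good κ α T s S) (hκ : 0 < κ) (hα : 0 < α) {γ : Type*} {l : Filter γ} {u τ : ℝ}
    {z : Vec d} {y : γ → Vec d} {y₀ : Vec d} (hlt : u < τ) (hy : Tendsto y l (𝓝 y₀)) :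
    Tendsto (fun x => D.H u z τ (y x)) l (𝓝 (D.H u z τ y₀)) := by
  have h1 := h.tendsto_cov hα (tendsto_const_nhds (x := u)) (tendsto_const_nhds (x := τ)) hy
  have h2 := h.tendsto_fl (tendsto_const_nhds (x := u)) (tendsto_const_nhds (x := τ)) hy
  have h3 : Tendsto (fun x => D.β u (D.fl u τ (y x))) l (𝓝 (D.β u (D.fl u τ y₀))) :=
    ((h.continuous_β u).tendsto _).comp h2
  have h4 : Tendsto (fun x => D.a u (D.fl u τ (y x))) l (𝓝 (D.a u (D.fl u τ y₀))) :=
    ((h.continuous_a hα u).tendsto _).comp h2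
  exact tendsto_jf (h.ell hlt.le y₀) hκ (sub_pos.2 hlt) h1 (tendsto_const_nhds.sub h3)
    (tendsto_const_nhds.sub h4) (tendsto_const_nhds.sub h2)

end Good

end Coeffs

end

section

lemma volume_image_le {d : ℕ} {κ : ℝ} (hκ : 0 ≤ κ) {f : Vec d → Vec d}
    (hf : ∀ x y, ‖f x - f y‖ ≤ κ * ‖x - y‖) (A : Set (Vec d)) :
    volume (f '' A) ≤ ENNReal.ofReal (κ ^ d) * volume A := by
  have h1 := Measure.isAddLeftInvariant_eq_smul (volume : Measure (Vec d)) (Measure.hausdorffMeasure (d : ℝ))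
  have hL : LipschitzWith (Real.toNNReal κ) f := by
    refine LipschitzWith.of_dist_le_mul fun x y => ?_
    rw [Real.coe_toNNReal _ hκ, dist_eq_norm, dist_eq_norm]
    exact hf x y
  have h2 := hL.hausdorffMeasure_image_le (d := d) (by positivity) A
  rw [ENNReal.rpow_natCast] at h2
  rw [h1, Measure.smul_apply, Measure.smul_apply, ENNReal.smul_def, ENNReal.smul_def, smul_eq_mul,
    smul_eq_mul, ENNReal.ofReal_pow hκ]
  rw [mul_left_comm]
  exact mul_le_mul_right h2 _

lemma lintegral_comp_le {d : ℕ} {κ : ℝ} (hκ : 0 ≤ κ) {F E : Vec d → Vec d}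
    (hF : ∀ x y, ‖F x - F y‖ ≤ κ * ‖x - y‖) (hE : Measurable E) (hFE : ∀ x, F (E x) = x)
    (hEF : ∀ x, E (F x) = x) {g : Vec d → ℝ≥0∞} (hg : Measurable g) :
    ∫⁻ y, g (E y) ≤ ENNReal.ofReal (κ ^ d) * ∫⁻ w, g w := by
  have h1 : Measure.map E volume ≤ ENNReal.ofReal (κ ^ d) • (volume : Measure (Vec d)) := by
    refine Measure.le_iff.2 fun A hA => ?_
    rw [Measure.map_apply hE hA, Measure.smul_apply, smul_eq_mul]
    have : E ⁻¹' A = F '' A := by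
      ext y
      constructor
      · exact fun hy => ⟨E y, hy, hFE y⟩
      · rintro ⟨x, hx, rfl⟩
        simpa [hEF] using hx
    rw [this]
    exact volume_image_le hκ hF A
  rw [← lintegral_map hg hE, ← smul_eq_mul, ← lintegral_smul_measure]
  exact lintegral_mono' h1 le_rfl

lemma gaussk_nonneg {d : ℕ} {l t : ℝ} (ht : 0 ≤ t) (x : Vec d) : 0 ≤ gaussk d l t x := by
  unfold gaussk; positivity

lemma lintegral_exp_sq {d : ℕ} {c : ℝ} (hc : 0 < c) (m : Vec d) :
    ∫⁻ w : Vec d, ENNReal.ofReal (Real.exp (-c * ‖w - m‖ ^ 2)) = ENNReal.ofReal ((Real.pi / c) ^ ((d : ℝ) / 2)) := by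
  have h0 := GaussianFourier.integral_rexp_neg_mul_sq_norm (V := Vec d) hc
  rw [finrank_euclideanSpace, Fintype.card_fin] at h0
  have hi : Integrable fun v : Vec d => Real.exp (-c * ‖v‖ ^ 2) := by
    refine not_not.1 fun hn => ?_
    rw [integral_undef hn] at h0
    have : 0 < (Real.pi / c) ^ ((d : ℝ) / 2) := by positivity
    linarith
  rw [lintegral_sub_right_eq_self (fun w : Vec d => ENNReal.ofReal (Real.exp (-c * ‖w‖ ^ 2))) m,
    ← ofReal_integral_eq_lintegral_ofReal hi (Eventually.of_forall fun v => (Real.exp_pos _).le), h0]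

lemma lintegral_gaussk {d : ℕ} {l t : ℝ} (hl : 0 < l) (ht : 0 < t) (x : Vec d) :
    ∫⁻ w : Vec d, ENNReal.ofReal (gaussk d l t (x - w)) = ENNReal.ofReal ((Real.pi / l) ^ ((d : ℝ) / 2)) := by
  have h1 : ∀ w : Vec d, ENNReal.ofReal (gaussk d l t (x - w)) =
      ENNReal.ofReal (t ^ (-(d : ℝ) / 2)) * ENNReal.ofReal (Real.exp (-(l / t) * ‖w - x‖ ^ 2)) := by
    intro w
    rw [gaussk, ENNReal.ofReal_mul (by positivity), norm_sub_rev]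
    congr 3
    ring
  simp_rw [h1]
  rw [lintegral_const_mul _ (by fun_prop), lintegral_exp_sq (div_pos hl ht), ← ENNReal.ofReal_mul (by positivity)]
  congr 1
  rw [div_div_eq_mul_div, mul_comm Real.pi t, mul_div_assoc, Real.mul_rpow ht.le (by positivity), ← mul_assoc,
    ← Real.rpow_add ht, neg_div, neg_add_cancel, Real.rpow_zero, one_mul]

lemma lintegral_gaussk_mul_gaussk {d : ℕ} {l a b : ℝ} (hl : 0 < l) (ha : 0 < a) (hb : 0 < b) (x y : Vec d) :
    ∫⁻ w : Vec d, ENNReal.ofReal (gaussk d l a (x - w)) * ENNReal.ofReal (gaussk d l b (w - y)) =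
      ENNReal.ofReal ((Real.pi / l) ^ ((d : ℝ) / 2)) * ENNReal.ofReal (gaussk d l (a + b) (x - y)) := by
  have hab : 0 < a + b := add_pos ha hb
  set m : Vec d := (b / (a + b)) • x + (a / (a + b)) • y with hm
  have hsq : ∀ w : Vec d, ‖x - w‖ ^ 2 / a + ‖w - y‖ ^ 2 / b =
      ‖x - y‖ ^ 2 / (a + b) + (a + b) / (a * b) * ‖w - m‖ ^ 2 := by
    intro w
    have e1 : x - w = (x - y) - (w - y) := by abel
    have e2 : w - m = (w - y) - (b / (a + b)) • (x - y) := by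
      rw [hm]
      have : a / (a + b) = 1 - b / (a + b) := by field_simp; ring
      rw [this]; module
    rw [e1, e2]
    generalize x - y = p
    generalize w - y = r
    rw [norm_sub_sq_real, norm_sub_sq_real, norm_smul, inner_smul_right, real_inner_comm r p,
      Real.norm_of_nonneg (by positivity)]
    field_simp
    ring
  have h1 : ∀ w : Vec d, ENNReal.ofReal (gaussk d l a (x - w)) * ENNReal.ofReal (gaussk d l b (w - y)) =
      ENNReal.ofReal (a ^ (-(d : ℝ) / 2) * b ^ (-(d : ℝ) / 2) * Real.exp (-l * ‖x - y‖ ^ 2 / (a + b))) *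
        ENNReal.ofReal (Real.exp (-(l * ((a + b) / (a * b))) * ‖w - m‖ ^ 2)) := by
    intro w
    rw [← ENNReal.ofReal_mul (gaussk_nonneg ha.le _), ← ENNReal.ofReal_mul (by positivity)]
    congr 1
    unfold gaussk
    have : Real.exp (-l * ‖x - w‖ ^ 2 / a) * Real.exp (-l * ‖w - y‖ ^ 2 / b) =
        Real.exp (-l * ‖x - y‖ ^ 2 / (a + b)) * Real.exp (-(l * ((a + b) / (a * b))) * ‖w - m‖ ^ 2) := by
      rw [← Real.exp_add, ← Real.exp_add]
      congr 1
      linear_combination -l * hsq w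
    linear_combination (a ^ (-(d : ℝ) / 2) * b ^ (-(d : ℝ) / 2)) * this
  simp_rw [h1]
  rw [lintegral_const_mul _ (by fun_prop), lintegral_exp_sq (by positivity), ← ENNReal.ofReal_mul (by positivity),
    ← ENNReal.ofReal_mul (by positivity)]
  congr 1
  unfold gaussk
  have h2 : (Real.pi / (l * ((a + b) / (a * b)))) = (Real.pi / l) * (a * b * (a + b)⁻¹) := by field_simp
  rw [h2, Real.mul_rpow (by positivity) (by positivity), Real.mul_rpow (by positivity) (by positivity),
    Real.mul_rpow ha.le hb.le, Real.inv_rpow hab.le, ← Real.rpow_neg hab.le, neg_div,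
    Real.rpow_neg ha.le, Real.rpow_neg hb.le]
  have := (Real.rpow_pos_of_pos ha ((d : ℝ) / 2)).ne'
  have := (Real.rpow_pos_of_pos hb ((d : ℝ) / 2)).ne'
  field_simp

lemma le_one_add_pow_four {R : ℝ} (hR : 0 ≤ R) :
    R ≤ (1 + R) ^ 4 ∧ R ^ 2 ≤ (1 + R) ^ 4 ∧ (1 + R) * R ^ 2 ≤ (1 + R) ^ 4 ∧ 1 + R ≤ (1 + R) ^ 4 := by
  have h2 := pow_nonneg hR 2
  have h3 := pow_nonneg hR 3
  have h4 := pow_nonneg hR 4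
  have e : (1 + R) ^ 4 = 1 + 4 * R + 6 * R ^ 2 + 4 * R ^ 3 + R ^ 4 := by ring
  refine ⟨by linarith, by linarith, ?_, by linarith⟩
  have : (1 + R) * R ^ 2 = R ^ 2 + R ^ 3 := by ring
  linarith

namespace Coeffs

variable {d : ℕ} {D : Coeffs d} {κ α T s S : ℝ}

namespace Good

lemma lintegral_Γ_le (h : D.Good κ α T s S) (hκ : 0 < κ) {l : ℝ} (hl : 0 < l) {u τ : ℝ} (hu : u < τ) (z : Vec d) :
    ∫⁻ y, ENNReal.ofReal (D.Γ l u z τ y) ≤ ENNReal.ofReal (κ ^ d * (Real.pi / l) ^ ((d : ℝ) / 2)) := by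
  have hm : Measurable fun w : Vec d => ENNReal.ofReal (gaussk d l (τ - u) (D.E u z - w)) := by
    unfold gaussk; fun_prop
  refine (lintegral_comp_le hκ.le (h.F_lip τ) (h.E_cont.measurable.comp measurable_prodMk_left)
    (h.FE τ) (h.EF τ) hm).trans ?_
  rw [lintegral_gaussk hl (sub_pos.2 hu), ENNReal.ofReal_mul (by positivity)]

lemma lintegral_Γ_mul_Γ_le (h : D.Good κ α T s S) (hκ : 0 < κ) {l : ℝ} (hl : 0 < l) {r u t : ℝ} (hr : r < u)
    (ht : u < t) (z y : Vec d) :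
    ∫⁻ w, ENNReal.ofReal (D.Γ l r z u w) * ENNReal.ofReal (D.Γ l u w t y) ≤
      ENNReal.ofReal (κ ^ d * (Real.pi / l) ^ ((d : ℝ) / 2)) * ENNReal.ofReal (D.Γ l r z t y) := by
  have hm : Measurable fun w : Vec d => ENNReal.ofReal (gaussk d l (u - r) (D.E r z - w)) *
      ENNReal.ofReal (gaussk d l (t - u) (w - D.E t y)) := by
    unfold gaussk; fun_prop
  refine (lintegral_comp_le hκ.le (h.F_lip u) (h.E_cont.measurable.comp measurable_prodMk_left)
    (h.FE u) (h.EF u) hm).trans ?_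
  rw [lintegral_gaussk_mul_gaussk hl (sub_pos.2 hr) (sub_pos.2 ht), ENNReal.ofReal_mul (by positivity), mul_assoc]
  refine le_of_eq ?_
  congr 4
  ring

lemma norm_fl_sub (h : D.Good κ α T s S) (u : ℝ) (z : Vec d) (τ : ℝ) (y : Vec d) :
    ‖D.E u z - D.E τ y‖ ≤ κ * ‖z - D.fl u τ y‖ := by
  have := h.E_lip u z (D.fl u τ y)
  rwa [fl, h.EF] at this

lemma norm_fl_sub' (h : D.Good κ α T s S) (u : ℝ) (z : Vec d) (τ : ℝ) (y : Vec d) :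
    ‖z - D.fl u τ y‖ ≤ κ * ‖D.E u z - D.E τ y‖ := by
  have := h.F_lip u (D.E u z) (D.E τ y)
  rwa [h.FE] at this

end Good

/-- The Gaussian exponent used in the upper bounds. -/
def lam (κ : ℝ) : ℝ := (4 * κ ^ 5)⁻¹

lemma lam_pos (hκ : 0 < κ) : 0 < lam κ := by unfold lam; positivity

lemma Good.exp_le_Γ (h : D.Good κ α T s S) (hκ : 0 < κ) {u τ : ℝ} (hu : u < τ) (z y : Vec d) :
    (τ - u) ^ (-(d : ℝ) / 2) * Real.exp (-(‖z - D.fl u τ y‖ ^ 2 / (4 * κ ^ 3 * (τ - u)))) ≤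
      D.Γ (lam κ) u z τ y := by
  have hδ : 0 < τ - u := sub_pos.2 hu
  have h1 := h.norm_fl_sub u z τ y
  have h2 : ‖D.E u z - D.E τ y‖ ^ 2 ≤ κ ^ 2 * ‖z - D.fl u τ y‖ ^ 2 := by
    rw [← mul_pow]; gcongr
  unfold Γ gaussk
  refine mul_le_mul_of_nonneg_left (Real.exp_le_exp.2 ?_) (by positivity)
  have h3 : -lam κ * ‖D.E u z - D.E τ y‖ ^ 2 / (τ - u) = -(‖D.E u z - D.E τ y‖ ^ 2 / (4 * κ ^ 5 * (τ - u))) := by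
    unfold lam; field_simp
  rw [h3, neg_le_neg_iff, div_le_div_iff₀ (by positivity) (by positivity)]
  calc _ ≤ κ ^ 2 * ‖z - D.fl u τ y‖ ^ 2 * (4 * κ ^ 3 * (τ - u)) := by gcongr
    _ = _ := by ring

lemma Good.q_le (h : D.Good κ α T s S) (hκ : 0 < κ) {u τ : ℝ} (hu : u < τ) (z y : Vec d) :
    D.q u z τ y ≤ κ ^ ((d : ℝ) / 2) * D.Γ (lam κ) u z τ y := by
  have hδ : 0 < τ - u := sub_pos.2 hu
  refine (gauss_le (h.ell hu.le y) hκ hδ _).trans ?_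
  refine mul_le_mul_of_nonneg_left ((mul_le_mul_of_nonneg_left (Real.exp_le_exp.2 ?_) ?_).trans
    (h.exp_le_Γ hκ hu z y)) (by positivity)
  · rw [neg_le_neg_iff]
    gcongr
    norm_num
  · positivity

lemma q_nonneg (D : Coeffs d) (u : ℝ) (z : Vec d) (τ : ℝ) (y : Vec d) : 0 ≤ D.q u z τ y := gauss_nonneg _ _

set_option maxHeartbeats 1000000 in
lemma exists_H_bound (d : ℕ) {κ α T : ℝ} (hκ : 1 ≤ κ) (hα : α ∈ Ioc (0 : ℝ) 1) (hT : 0 < T) :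
    ∃ C : ℝ, 0 < C ∧ ∀ (D : Coeffs d) (s S : ℝ), D.Good κ α T s S → ∀ u τ : ℝ, u < τ → τ - u ≤ T → ∀ z y : Vec d,
      |D.H u z τ y| ≤ C * ((τ - u) ^ (-1 + α / 2) * D.Γ (lam κ) u z τ y) := by
  have hκ0 : 0 < κ := by linarith
  obtain ⟨B, hB, hBs⟩ := exists_pow_exp_le (c := 1 / (2 * κ ^ 3)) (by positivity)
  set K : ℝ := κ ^ 2 * (T ^ ((1 - α) / 2) + T ^ (1 - α / 2)) + κ * (κ ^ 2 + d * κ) with hK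
  refine ⟨K * (κ ^ ((d : ℝ) / 2) * B), by positivity, fun D s S h u τ hu hτ z y => ?_⟩
  have hδ : 0 < τ - u := sub_pos.2 hu
  set δ := τ - u with hδd
  set v := z - D.fl u τ y with hv
  have hj := abs_jf_le (h.ell hu.le y) hκ0 hδ (D.b u z - D.β u (D.fl u τ y))
    (D.a u z - D.a u (D.fl u τ y)) v
  have hg := gauss_le (h.ell hu.le y) hκ0 hδ v
  have hb : ‖D.b u z - D.β u (D.fl u τ y)‖ ≤ κ + κ * ‖v‖ := by
    have : D.b u z - D.β u (D.fl u τ y) = (D.b u z - D.β u z) + (D.β u z - D.β u (D.fl u τ y)) := by abel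
    rw [this]
    exact (norm_add_le _ _).trans (add_le_add (h.b_sub u z) (h.β_lip u z _))
  have ha : ‖D.a u z - D.a u (D.fl u τ y)‖ ≤ κ * ‖v‖ ^ α := h.a_hol u z _
  set R := ‖v‖ / Real.sqrt δ with hR
  have hsq : 0 < Real.sqrt δ := Real.sqrt_pos.2 hδ
  have hR0 : 0 ≤ R := by positivity
  have hvR : ‖v‖ = R * Real.sqrt δ := by rw [hR]; field_simp
  have hsd : Real.sqrt δ ^ 2 = δ := Real.sq_sqrt hδ.le
  have hvR2 : ‖v‖ ^ 2 = R ^ 2 * δ := by rw [hvR, mul_pow, hsd]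
  have hRα : ‖v‖ ^ α ≤ (1 + R) * δ ^ (α / 2) := by
    rw [hvR, Real.mul_rpow hR0 hsq.le, Real.sqrt_eq_rpow, ← Real.rpow_mul hδ.le]
    rw [show 1 / 2 * α = α / 2 by ring]
    gcongr
    calc R ^ α ≤ (1 + R) ^ α := Real.rpow_le_rpow hR0 (by linarith) hα.1.le
      _ ≤ (1 + R) ^ (1 : ℝ) := Real.rpow_le_rpow_of_exponent_le (by linarith) hα.2
      _ = _ := Real.rpow_one _
  have hp1 : δ⁻¹ * δ ^ (α / 2) = δ ^ (-1 + α / 2) := by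
    rw [Real.rpow_add hδ, Real.rpow_neg_one]
  have hp2 : δ⁻¹ * Real.sqrt δ ≤ δ ^ (-1 + α / 2) * T ^ ((1 - α) / 2) := by
    have : δ⁻¹ * Real.sqrt δ = δ ^ (-1 + α / 2) * δ ^ ((1 - α) / 2) := by
      rw [← Real.rpow_neg_one, Real.sqrt_eq_rpow, ← Real.rpow_add hδ, ← Real.rpow_add hδ]
      congr 1; ring
    rw [this]
    have := hα.2
    gcongr
  have hp3 : 1 ≤ δ ^ (-1 + α / 2) * T ^ (1 - α / 2) := by
    have : (1 : ℝ) = δ ^ (-1 + α / 2) * δ ^ (1 - α / 2) := by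
      rw [← Real.rpow_add hδ]
      simp
    have h3 : δ ^ (1 - α / 2) ≤ T ^ (1 - α / 2) := Real.rpow_le_rpow hδ.le hτ (by linarith [hα.2])
    calc (1 : ℝ) = δ ^ (-1 + α / 2) * δ ^ (1 - α / 2) := this
      _ ≤ _ := by gcongr
  have hP0 : 0 < δ ^ (-1 + α / 2) := Real.rpow_pos_of_pos hδ _
  have t1 : κ / δ * ‖v‖ * ‖D.b u z - D.β u (D.fl u τ y)‖ ≤
      δ ^ (-1 + α / 2) * (κ ^ 2 * (T ^ ((1 - α) / 2) + T ^ (1 - α / 2))) * (1 + R) ^ 4 := by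
    calc _ ≤ κ / δ * ‖v‖ * (κ + κ * ‖v‖) := by gcongr
      _ = κ ^ 2 * (R * (δ⁻¹ * Real.sqrt δ) + R ^ 2 * 1) := by
        have : κ / δ * ‖v‖ * (κ + κ * ‖v‖) = κ ^ 2 * (δ⁻¹ * ‖v‖ + δ⁻¹ * ‖v‖ ^ 2) := by ring
        rw [this, hvR2, hvR]; field_simp
      _ ≤ κ ^ 2 * ((1 + R) ^ 4 * (δ ^ (-1 + α / 2) * T ^ ((1 - α) / 2)) +
          (1 + R) ^ 4 * (δ ^ (-1 + α / 2) * T ^ (1 - α / 2))) := by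
        obtain ⟨r1, r2, -, -⟩ := le_one_add_pow_four hR0
        gcongr
      _ = _ := by ring
  have t2 : (1 / 2) * (‖D.a u z - D.a u (D.fl u τ y)‖ * ((κ / δ) ^ 2 * ‖v‖ ^ 2 + d * (κ / δ))) ≤
      δ ^ (-1 + α / 2) * (κ * (κ ^ 2 + d * κ)) * (1 + R) ^ 4 := by
    calc _ ≤ 1 * ((κ * ((1 + R) * δ ^ (α / 2))) * ((κ / δ) ^ 2 * ‖v‖ ^ 2 + d * (κ / δ))) := by
          gcongr
          · norm_num
          · exact ha.trans (by gcongr)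
      _ = κ * (1 + R) * (δ⁻¹ * δ ^ (α / 2)) * (κ ^ 2 * R ^ 2 + d * κ) := by
        rw [hvR2]; field_simp
      _ = δ ^ (-1 + α / 2) * κ * (κ ^ 2 * ((1 + R) * R ^ 2) + d * κ * (1 + R)) := by rw [hp1]; ring
      _ ≤ δ ^ (-1 + α / 2) * κ * (κ ^ 2 * (1 + R) ^ 4 + d * κ * (1 + R) ^ 4) := by
        obtain ⟨-, -, r1, r2⟩ := le_one_add_pow_four hR0
        gcongr
      _ = _ := by ring
  have e1 : Real.exp (-(‖v‖ ^ 2 / (2 * κ ^ 3 * δ))) = Real.exp (-(1 / (2 * κ ^ 3) * R ^ 2)) := by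
    rw [hvR2]; congr 2; field_simp
  have e2 : Real.exp (-(‖v‖ ^ 2 / (4 * κ ^ 3 * δ))) = Real.exp (-(1 / (2 * κ ^ 3) / 2 * R ^ 2)) := by
    rw [hvR2]; congr 2; field_simp; norm_num
  have hΓ := h.exp_le_Γ hκ0 hu z y
  rw [← hv, ← hδd, e2] at hΓ
  rw [e1] at hg
  have := hBs R hR0
  unfold H
  calc _ ≤ _ := hj
    _ ≤ (δ ^ (-1 + α / 2) * K * (1 + R) ^ 4) * (κ ^ ((d : ℝ) / 2) * (δ ^ (-(d : ℝ) / 2) * Real.exp (-(1 / (2 * κ ^ 3) * R ^ 2)))) := by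
      refine mul_le_mul ?_ hg (gauss_nonneg _ _) (by positivity)
      rw [hK]; linarith
    _ = δ ^ (-1 + α / 2) * K * κ ^ ((d : ℝ) / 2) * (δ ^ (-(d : ℝ) / 2) * ((1 + R) ^ 4 * Real.exp (-(1 / (2 * κ ^ 3) * R ^ 2)))) := by ring
    _ ≤ δ ^ (-1 + α / 2) * K * κ ^ ((d : ℝ) / 2) * (δ ^ (-(d : ℝ) / 2) * (B * Real.exp (-(1 / (2 * κ ^ 3) / 2 * R ^ 2)))) := by gcongr
    _ = δ ^ (-1 + α / 2) * K * κ ^ ((d : ℝ) / 2) * B * (δ ^ (-(d : ℝ) / 2) * Real.exp (-(1 / (2 * κ ^ 3) / 2 * R ^ 2))) := by ring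
    _ ≤ δ ^ (-1 + α / 2) * K * κ ^ ((d : ℝ) / 2) * B * D.Γ (lam κ) u z τ y := by gcongr
    _ = _ := by ring

lemma Good.q_ge (h : D.Good κ α T s S) (hκ : 0 < κ) {u τ K : ℝ} (hu : u < τ) {z y : Vec d}
    (hz : ‖D.E u z - D.E τ y‖ ≤ K * Real.sqrt (τ - u)) :
    (2 * Real.pi * κ) ^ (-(d : ℝ) / 2) * Real.exp (-(κ ^ 3 * K ^ 2 / 2)) * (τ - u) ^ (-(d : ℝ) / 2) ≤
      D.q u z τ y := by
  have hδ : 0 < τ - u := sub_pos.2 hu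
  refine le_trans ?_ (gauss_ge (h.ell hu.le y) hκ hδ _)
  rw [mul_assoc, mul_comm (Real.exp _)]
  gcongr
  have h1 := (h.norm_fl_sub' u z τ y).trans (mul_le_mul_of_nonneg_left hz hκ.le)
  have h2 : ‖z - D.fl u τ y‖ ^ 2 ≤ (κ * (K * Real.sqrt (τ - u))) ^ 2 := by gcongr
  rw [mul_pow, mul_pow, Real.sq_sqrt hδ.le] at h2
  calc κ / (2 * (τ - u)) * ‖z - D.fl u τ y‖ ^ 2 ≤ κ / (2 * (τ - u)) * (κ ^ 2 * (K ^ 2 * (τ - u))) := by gcongr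
    _ = _ := by field_simp

end Coeffs

end

section

lemma exists_gauss_poly_bound_uniform (d : ℕ) {κ ε Δ : ℝ} (hκ : 0 < κ) (hε : 0 < ε) :
    ∃ B, 0 ≤ B ∧ ∀ (C : Lin d) (δ : ℝ), Ell κ δ C → ε ≤ δ → δ ≤ Δ →
      ∀ v : Vec d, (1 + ‖v‖) ^ 4 * gauss C v ≤ B := by
  by_cases hΔ : 0 < Δ
  swap
  · exact ⟨0, le_rfl, fun C δ _ h1 h2 => absurd (hε.trans_le (h1.trans h2)) hΔ⟩
  obtain ⟨B, hB, h1⟩ := exists_pow_exp_le (c := (2 * κ ^ 3 * Δ)⁻¹) (by positivity)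
  refine ⟨B * (κ ^ ((d : ℝ) / 2) * ε ^ (-(d : ℝ) / 2)), by positivity, fun C δ h hεδ hδΔ v => ?_⟩
  have hδ : 0 < δ := hε.trans_le hεδ
  have h2 := h1 ‖v‖ (norm_nonneg _)
  have h3 := gauss_le h hκ hδ v
  have h4 : Real.exp (-((2 * κ ^ 3 * Δ)⁻¹ / 2 * ‖v‖ ^ 2)) ≤ 1 :=
    Real.exp_le_one_iff.2 (neg_nonpos.2 (by positivity))
  have h5 : δ ^ (-(d : ℝ) / 2) ≤ ε ^ (-(d : ℝ) / 2) :=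
    Real.rpow_le_rpow_of_nonpos hε hεδ (by rw [neg_div]; exact neg_nonpos.2 (by positivity))
  have h6 : Real.exp (-(‖v‖ ^ 2 / (2 * κ ^ 3 * δ))) ≤ Real.exp (-((2 * κ ^ 3 * Δ)⁻¹ * ‖v‖ ^ 2)) := by
    rw [← div_eq_inv_mul]
    gcongr
  calc _ ≤ (1 + ‖v‖) ^ 4 * (κ ^ ((d : ℝ) / 2) * (ε ^ (-(d : ℝ) / 2) *
        Real.exp (-((2 * κ ^ 3 * Δ)⁻¹ * ‖v‖ ^ 2)))) := by
        refine mul_le_mul_of_nonneg_left (h3.trans ?_) (by positivity)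
        gcongr
    _ = ((1 + ‖v‖) ^ 4 * Real.exp (-((2 * κ ^ 3 * Δ)⁻¹ * ‖v‖ ^ 2))) *
        (κ ^ ((d : ℝ) / 2) * ε ^ (-(d : ℝ) / 2)) := by ring
    _ ≤ (B * 1) * (κ ^ ((d : ℝ) / 2) * ε ^ (-(d : ℝ) / 2)) := by
      refine mul_le_mul_of_nonneg_right ?_ (by positivity)
      exact h2.trans (by gcongr)
    _ = _ := by ring

lemma exists_jf_bound (d : ℕ) {κ ε Δ R K : ℝ} (hκ : 0 < κ) (hε : 0 < ε) (hR : 0 ≤ R) (hK : 0 ≤ K) :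
    ∃ M, 0 ≤ M ∧ ∀ (C : Lin d) (δ : ℝ), Ell κ δ C → ε ≤ δ → δ ≤ Δ →
      ∀ (β : Vec d) (N : Lin d) (z θ : Vec d), ‖θ‖ ≤ R → ‖β‖ ≤ K * (1 + ‖z‖) → ‖N‖ ≤ K →
        |jf C β N (z - θ)| ≤ M := by
  obtain ⟨B, hB, h1⟩ := exists_gauss_poly_bound_uniform d (Δ := Δ) hκ hε
  refine ⟨(κ / ε * (K * (1 + R)) + K * ((κ / ε) ^ 2 + d * (κ / ε))) * B, by positivity,
    fun C δ h hεδ hδΔ β N z θ hθ hβ hN => ?_⟩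
  have hδ : 0 < δ := hε.trans_le hεδ
  have h2 := h1 C δ h hεδ hδΔ (z - θ)
  refine (abs_jf_le h hκ hδ β N (z - θ)).trans ?_
  set v := z - θ with hv
  have hz : 1 + ‖z‖ ≤ (1 + R) * (1 + ‖v‖) := by
    have : ‖z‖ ≤ ‖v‖ + ‖θ‖ := by
      have := norm_add_le (z - θ) θ
      simpa [hv] using this
    nlinarith [mul_nonneg hR (norm_nonneg v)]
  have hkd : κ / δ ≤ κ / ε := by gcongr
  obtain ⟨r1, r2, r3, r4⟩ := le_one_add_pow_four (norm_nonneg v)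
  have r5 : ‖v‖ * (1 + ‖v‖) ≤ (1 + ‖v‖) ^ 4 := by
    have h2 := pow_nonneg (norm_nonneg v) 2
    have h3 := pow_nonneg (norm_nonneg v) 3
    have h4 := pow_nonneg (norm_nonneg v) 4
    have e : (1 + ‖v‖) ^ 4 = 1 + 4 * ‖v‖ + 6 * ‖v‖ ^ 2 + 4 * ‖v‖ ^ 3 + ‖v‖ ^ 4 := by ring
    have e2 : ‖v‖ * (1 + ‖v‖) = ‖v‖ + ‖v‖ ^ 2 := by ring
    linarith [norm_nonneg v]
  have r6 : 1 ≤ (1 + ‖v‖) ^ 4 := one_le_pow₀ (by linarith [norm_nonneg v])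
  have t1 : κ / δ * ‖v‖ * ‖β‖ ≤ κ / ε * (K * (1 + R)) * (1 + ‖v‖) ^ 4 := by
    calc κ / δ * ‖v‖ * ‖β‖ ≤ κ / ε * ‖v‖ * (K * ((1 + R) * (1 + ‖v‖))) := by
          gcongr
          exact hβ.trans (by gcongr)
      _ = κ / ε * (K * (1 + R)) * (‖v‖ * (1 + ‖v‖)) := by ring
      _ ≤ _ := by gcongr
  have t2 : (1 / 2) * (‖N‖ * ((κ / δ) ^ 2 * ‖v‖ ^ 2 + d * (κ / δ))) ≤
      K * ((κ / ε) ^ 2 + d * (κ / ε)) * (1 + ‖v‖) ^ 4 := by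
    calc (1 / 2) * (‖N‖ * ((κ / δ) ^ 2 * ‖v‖ ^ 2 + d * (κ / δ))) ≤
        1 * (K * ((κ / ε) ^ 2 * (1 + ‖v‖) ^ 4 + d * (κ / ε) * (1 + ‖v‖) ^ 4)) := by
          have : d * (κ / δ) ≤ d * (κ / ε) * (1 + ‖v‖) ^ 4 :=
            (mul_le_mul_of_nonneg_left hkd (by positivity)).trans
              (le_mul_of_one_le_right (by positivity) r6)
          gcongr
          norm_num
      _ = _ := by ring
  calc _ ≤ (κ / ε * (K * (1 + R)) * (1 + ‖v‖) ^ 4 + K * ((κ / ε) ^ 2 + d * (κ / ε)) * (1 + ‖v‖) ^ 4) *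
        gauss C v := mul_le_mul_of_nonneg_right (add_le_add t1 t2) (gauss_nonneg _ _)
    _ = (κ / ε * (K * (1 + R)) + K * ((κ / ε) ^ 2 + d * (κ / ε))) * ((1 + ‖v‖) ^ 4 * gauss C v) := by ring
    _ ≤ _ := by gcongr

/-- The Fokker–Planck equation tested against a Gaussian density. -/
lemma FPFlow.eqn_gauss {d : ℕ} {Ω : Type} [MeasurableSpace Ω] {b : ℝ → Vec d → Vec d}
    {a : ℝ → Vec d → Lin d} {r S : ℝ} {P : Measure Ω} {X : ℝ → Ω → Vec d}
    (h : FPFlow b a r S P X) {K : ℝ} (hK : 0 ≤ K)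
    (hbm : Measurable (Function.uncurry b)) (ham : Measurable (Function.uncurry a))
    (hb : ∀ u z, ‖b u z‖ ≤ K * (1 + ‖z‖)) (ha : ∀ u z, ‖a u z‖ ≤ K)
    {κ δ : ℝ} {C : Lin d} (hC : Ell κ δ C) (hκ : 0 < κ) (hδ : 0 < δ) (θ : Vec d)
    {u v : ℝ} (hru : r ≤ u) (huv : u ≤ v) (hvS : v ≤ S) :
    ∫ ω, gauss C (X v ω - θ) ∂P - ∫ ω, gauss C (X u ω - θ) ∂P =
      ∫ ρ in u..v, ∫ ω, jf C (b ρ (X ρ ω)) (a ρ (X ρ ω)) (X ρ ω - θ) ∂P := by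
  obtain ⟨B, hB, hBs⟩ := exists_gauss_poly_bound hC hκ hδ
  have hn := hC.inv_norm_le hκ hδ
  set k := κ / δ with hk
  have hk0 : 0 < k := by positivity
  have hlin : ∀ w e : Vec d, |⟪linv C w, e⟫| ≤ k * ‖w‖ * ‖e‖ := fun w e =>
    (abs_real_inner_le_norm _ _).trans (mul_le_mul_of_nonneg_right
      (((linv C).le_opNorm w).trans (mul_le_mul_of_nonneg_right hn (norm_nonneg _))) (norm_nonneg _))
  have hmain := h.extend hK hbm ham hb ha (f := fun z => gauss C (z - θ)) (contDiff_gauss_sub θ)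
    (B := (1 + (k * (1 + ‖θ‖)) + (k ^ 2 + k)) * B) ?_ ?_ ?_ hru huv hvS
  · simp_rw [gen_gauss_sub hC hκ hδ] at hmain
    exact hmain
  all_goals intro z
  all_goals
    have hz := hBs (z - θ)
    have hg := gauss_nonneg C (z - θ)
    obtain ⟨r1, r2, r3, r4⟩ := le_one_add_pow_four (norm_nonneg (z - θ))
    have r6 : 1 ≤ (1 + ‖z - θ‖) ^ 4 := one_le_pow₀ (by linarith [norm_nonneg (z - θ)])
  · rw [abs_of_nonneg hg]
    calc gauss C (z - θ) ≤ (1 + ‖z - θ‖) ^ 4 * gauss C (z - θ) := le_mul_of_one_le_left hg r6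
      _ ≤ 1 * B := by linarith
      _ ≤ _ := by
        gcongr
        have : 0 ≤ (k * (1 + ‖θ‖)) + (k ^ 2 + k) := by positivity
        linarith
  · have h1 : ‖fderiv ℝ (fun z => gauss C (z - θ)) z‖ ≤ k * ‖z - θ‖ * gauss C (z - θ) := by
      refine ContinuousLinearMap.opNorm_le_bound _ (by positivity) fun e => ?_
      rw [fderiv_gauss_sub hC hκ hδ, norm_mul, norm_neg, Real.norm_eq_abs, Real.norm_of_nonneg hg]
      calc _ ≤ k * ‖z - θ‖ * ‖e‖ * gauss C (z - θ) := by gcongr; exact hlin _ _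
        _ = _ := by ring
    have h2 : 1 + ‖z‖ ≤ (1 + ‖θ‖) * (1 + ‖z - θ‖) := by
      have : ‖z‖ ≤ ‖z - θ‖ + ‖θ‖ := by simpa using norm_add_le (z - θ) θ
      nlinarith [mul_nonneg (norm_nonneg θ) (norm_nonneg (z - θ))]
    have r5 : ‖z - θ‖ * (1 + ‖z - θ‖) ≤ (1 + ‖z - θ‖) ^ 4 := by
      have e2 : ‖z - θ‖ * (1 + ‖z - θ‖) ≤ (1 + ‖z - θ‖) ^ 2 := by nlinarith [norm_nonneg (z - θ)]
      exact e2.trans (pow_le_pow_right₀ (by linarith [norm_nonneg (z - θ)]) (by norm_num))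
    calc _ ≤ (1 + ‖θ‖) * (1 + ‖z - θ‖) * (k * ‖z - θ‖ * gauss C (z - θ)) := by gcongr
      _ = (k * (1 + ‖θ‖)) * ((‖z - θ‖ * (1 + ‖z - θ‖)) * gauss C (z - θ)) := by ring
      _ ≤ (k * (1 + ‖θ‖)) * B := by
        refine mul_le_mul_of_nonneg_left (le_trans ?_ hz) (by positivity)
        gcongr
      _ ≤ _ := by
        gcongr
        have : 0 ≤ 1 + (k ^ 2 + k) := by positivity
        linarith
  · have h1 : ‖iteratedFDeriv ℝ 2 (fun z => gauss C (z - θ)) z‖ ≤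
        (k ^ 2 * ‖z - θ‖ ^ 2 + k) * gauss C (z - θ) := by
      refine ContinuousMultilinearMap.opNorm_le_bound (by positivity) fun m => ?_
      rw [iteratedFDeriv_two_apply, fderiv2_gauss_sub hC hκ hδ, norm_mul, Real.norm_of_nonneg hg, Fin.prod_univ_two]
      have a1 := hlin (z - θ) (m 0)
      have a2 := hlin (z - θ) (m 1)
      have a3 : |⟪linv C (m 0), m 1⟫| ≤ k * ‖m 0‖ * ‖m 1‖ := hlin _ _
      have a4 : ‖⟪linv C (z - θ), m 0⟫ * ⟪linv C (z - θ), m 1⟫ - ⟪linv C (m 0), m 1⟫‖ ≤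
          (k * ‖z - θ‖ * ‖m 0‖) * (k * ‖z - θ‖ * ‖m 1‖) + k * ‖m 0‖ * ‖m 1‖ := by
        refine (norm_sub_le _ _).trans (add_le_add ?_ a3)
        rw [norm_mul]
        exact mul_le_mul a1 a2 (norm_nonneg _) (by positivity)
      calc _ ≤ ((k * ‖z - θ‖ * ‖m 0‖) * (k * ‖z - θ‖ * ‖m 1‖) + k * ‖m 0‖ * ‖m 1‖) * gauss C (z - θ) := by gcongr
        _ = _ := by ring
    refine h1.trans ?_
    calc _ ≤ (k ^ 2 * (1 + ‖z - θ‖) ^ 4 + k * (1 + ‖z - θ‖) ^ 4) * gauss C (z - θ) := by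
          gcongr
          exact le_mul_of_one_le_right hk0.le r6
      _ = (k ^ 2 + k) * ((1 + ‖z - θ‖) ^ 4 * gauss C (z - θ)) := by ring
      _ ≤ (k ^ 2 + k) * B := by gcongr
      _ ≤ _ := by
        refine mul_le_mul_of_nonneg_right ?_ hB
        have : 0 ≤ 1 + (k * (1 + ‖θ‖)) := by positivity
        linarith

namespace Coeffs

variable {d : ℕ} {D : Coeffs d} {κ α T s S : ℝ}

namespace Good

lemma b_growth (h : D.Good κ α T s S) (hκ : 0 < κ) (u : ℝ) (z : Vec d) : ‖D.b u z‖ ≤ (3 * κ) * (1 + ‖z‖) := by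
  have h1 := h.b_sub u z
  have h2 := h.β_lip u z 0
  have h3 := h.β_zero u
  rw [sub_zero] at h2
  have : D.b u z = (D.b u z - D.β u z) + ((D.β u z - D.β u 0) + D.β u 0) := by abel
  have h4 : ‖D.b u z‖ ≤ κ + (κ * ‖z‖ + κ) := by
    rw [this]
    exact (norm_add_le _ _).trans (add_le_add h1 ((norm_add_le _ _).trans (add_le_add h2 h3)))
  nlinarith [mul_nonneg hκ.le (norm_nonneg z)]

lemma β_growth (h : D.Good κ α T s S) (hκ : 0 < κ) (u : ℝ) (z : Vec d) : ‖D.β u z‖ ≤ (3 * κ) * (1 + ‖z‖) := by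
  have h2 := h.β_lip u z 0
  have h3 := h.β_zero u
  rw [sub_zero] at h2
  have : D.β u z = ((D.β u z - D.β u 0) + D.β u 0) := by abel
  have h4 : ‖D.β u z‖ ≤ (κ * ‖z‖ + κ) := by
    rw [this]
    exact ((norm_add_le _ _).trans (add_le_add h2 h3))
  nlinarith [mul_nonneg hκ.le (norm_nonneg z)]

lemma intervalIntegrable_β (h : D.Good κ α T s S) (hκ : 0 < κ) (τ : ℝ) (y : Vec d) (u v : ℝ) :
    IntervalIntegrable (fun ρ => D.β ρ (D.fl ρ τ y)) volume u v := by
  have hc : Continuous fun ρ : ℝ => D.fl ρ τ y :=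
    h.continuous_fl.comp (continuous_id.prodMk (continuous_const (y := (τ, y))))
  have hc2 : Continuous fun ρ : ℝ => (3 * κ) * (1 + ‖D.fl ρ τ y‖) := by fun_prop
  refine (hc2.intervalIntegrable u v).mono_fun' ?_ ?_
  · exact (h.β_meas.comp (measurable_id.prodMk hc.measurable)).aestronglyMeasurable
  · exact Eventually.of_forall fun ρ => h.β_growth hκ ρ _

lemma exists_fl_bound (h : D.Good κ α T s S) (τ : ℝ) (y : Vec d) (u v : ℝ) :
    ∃ R, 0 ≤ R ∧ ∀ ρ ∈ Icc u v, ‖D.fl ρ τ y‖ ≤ R := by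
  have hc : Continuous fun ρ : ℝ => D.fl ρ τ y :=
    h.continuous_fl.comp (continuous_id.prodMk (continuous_const (y := (τ, y))))
  obtain ⟨R, hR⟩ := (isCompact_Icc (a := u) (b := v)).exists_bound_of_continuousOn hc.continuousOn
  exact ⟨max R 0, le_max_right _ _, fun ρ hρ => (hR ρ hρ).trans (le_max_left _ _)⟩

lemma cov_sub (h : D.Good κ α T s S) (τ : ℝ) (y : Vec d) (u v : ℝ) :
    D.cov v τ y - D.cov u τ y = ∫ ρ in u..v, -D.a ρ (D.fl ρ τ y) := by
  have i := h.intervalIntegrable_a τ y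
  unfold cov
  rw [intervalIntegral.integral_neg, ← intervalIntegral.integral_add_adjacent_intervals (i u v) (i v τ)]
  abel

/-- Motion of the frozen density in its backward time variable. -/
lemma q_sub (h : D.Good κ α T s S) (hκ : 0 < κ) {u v τ : ℝ} (hsu : s ≤ u) (huv : u ≤ v)
    (hvτ : v < τ) (hτ : τ ≤ S) (z y : Vec d) :
    D.q v z τ y - D.q u z τ y =
      ∫ ρ in u..v, -jf (D.cov ρ τ y) (D.β ρ (D.fl ρ τ y)) (D.a ρ (D.fl ρ τ y)) (z - D.fl ρ τ y) := by
  have ia := h.intervalIntegrable_a τ y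
  have ib := h.intervalIntegrable_β hκ τ y
  obtain ⟨R, hR, hRb⟩ := h.exists_fl_bound τ y u v
  set g : ℝ → Lin d × Vec d := fun ρ => (-D.a ρ (D.fl ρ τ y), -D.β ρ (D.fl ρ τ y)) with hg
  have hgi : ∀ u v, IntervalIntegrable g volume u v := fun u v =>
    ⟨(ia u v).neg.1.prodMk (ib u v).neg.1, (ia u v).neg.2.prodMk (ib u v).neg.2⟩
  have hmain := chain_integral (V := Lin d × Vec d) (w := fun ρ => (D.cov ρ τ y, z - D.fl ρ τ y)) (g := g)
    (Φ := fun p => gauss p.1 p.2) (s := u) (t := v) (M := 3 * κ * (1 + R)) huv (hgi u v) ?_ ?_ ?_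
  · refine hmain.trans (intervalIntegral.integral_congr fun ρ hρ => ?_)
    rw [uIcc_of_le huv] at hρ
    exact fderiv_gauss_neg (h.ell (hρ.2.trans hvτ.le) y) hκ (sub_pos.2 (hρ.2.trans_lt hvτ)) _ _ _
  · intro ρ hρ
    rw [hg, Prod.norm_mk, norm_neg, norm_neg]
    refine max_le ((h.a_ub ρ _).trans ?_) ((h.β_growth hκ ρ _).trans ?_)
    · nlinarith [mul_nonneg hκ.le hR]
    · have := hRb ρ hρ
      gcongr
  · intro u' hu' v' hv'
    have hfl : (z - D.fl v' τ y) - (z - D.fl u' τ y) = ∫ ρ in u'..v', -D.β ρ (D.fl ρ τ y) := by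
      rw [intervalIntegral.integral_neg]
      have hm : ∀ w ∈ Icc u v, w ∈ Icc s S := fun w hw => ⟨hsu.trans hw.1, hw.2.trans (hvτ.le.trans hτ)⟩
      have := h.F_int u' (hm _ hu') v' (hm _ hv') (D.E τ y)
      unfold fl
      rw [← this]
      abel
    have h1 := (ContinuousLinearMap.fst ℝ (Lin d) (Vec d)).intervalIntegral_comp_comm (hgi u' v')
    have h2 := (ContinuousLinearMap.snd ℝ (Lin d) (Vec d)).intervalIntegral_comp_comm (hgi u' v')
    refine Prod.ext ?_ ?_
    · exact (h.cov_sub τ y u' v').trans h1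
    · exact hfl.trans h2
  · intro ρ hρ
    exact contDiffAt_gauss (h.ell (hρ.2.trans hvτ.le) y) hκ (sub_pos.2 (hρ.2.trans_lt hvτ)) _

end Good

end Coeffs

end

section

namespace Coeffs.Good

variable {d : ℕ} {D : Coeffs d} {κ α T s S : ℝ}

/-- Duhamel's formula, before the terminal time is reached. -/
lemma duhamel (h : D.Good κ α T s S) (hκ : 0 < κ) (hα : 0 < α) {Ω : Type} [MeasurableSpace Ω]
    {r : ℝ} {P : Measure Ω} {X : ℝ → Ω → Vec d} (hP : FPFlow D.b D.a r S P X) (hsr : s ≤ r)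
    {v τ : ℝ} (hrv : r ≤ v) (hvτ : v < τ) (hτ : τ ≤ S) (y : Vec d) :
    ∫ ω, D.q v (X v ω) τ y ∂P - ∫ ω, D.q r (X r ω) τ y ∂P =
      ∫ ρ in r..v, ∫ ω, D.H ρ (X ρ ω) τ y ∂P := by
  have := hP.finite
  obtain ⟨R, hR, hRb⟩ := h.exists_fl_bound τ y r v
  obtain ⟨M, hM, hMb⟩ := exists_jf_bound d (κ := κ) (ε := τ - v) (Δ := τ - r) (R := R) (K := 3 * κ * (1 + R))
    hκ (sub_pos.2 hvτ) hR (by positivity)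
  have hell : ∀ w ∈ Icc r v, Ell κ (τ - w) (D.cov w τ y) := fun w hw => h.ell (hw.2.trans hvτ.le) y
  have hpos : ∀ w ∈ Icc r v, 0 < τ - w := fun w hw => sub_pos.2 (hw.2.trans_lt hvτ)
  have hXm := hP.joint_meas
  have hK : 3 * κ ≤ 3 * κ * (1 + R) := le_mul_of_one_le_right (by positivity) (by linarith)
  have hκK : κ ≤ 3 * κ * (1 + R) := le_trans (by linarith) hK
  set A : ℝ → ℝ → Ω → ℝ := fun ρ w ω =>
    jf (D.cov w τ y) (D.b ρ (X ρ ω)) (D.a ρ (X ρ ω)) (X ρ ω - D.fl w τ y) with hA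
  set B : ℝ → ℝ → Ω → ℝ := fun u ρ ω =>
    -jf (D.cov ρ τ y) (D.β ρ (D.fl ρ τ y)) (D.a ρ (D.fl ρ τ y)) (X u ω - D.fl ρ τ y) with hB
  have hAb : ∀ ρ, ∀ w ∈ Icc r v, ∀ ω, |A ρ w ω| ≤ M := fun ρ w hw ω =>
    hMb _ _ (hell w hw) (by linarith [hw.2]) (by linarith [hw.1]) _ _ _ _ (hRb w hw)
      ((h.b_growth hκ _ _).trans (mul_le_mul_of_nonneg_right hK (by positivity))) ((h.a_ub _ _).trans hκK)
  have hBb : ∀ u, ∀ ρ ∈ Icc r v, ∀ ω, |B u ρ ω| ≤ M := by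
    intro u ρ hρ ω
    rw [hB, abs_neg]
    refine hMb _ _ (hell ρ hρ) (by linarith [hρ.2]) (by linarith [hρ.1]) _ _ _ _ (hRb ρ hρ)
      ((h.β_growth hκ _ _).trans ?_) ((h.a_ub _ _).trans hκK)
    have h1 := hRb ρ hρ
    calc 3 * κ * (1 + ‖D.fl ρ τ y‖) ≤ 3 * κ * (1 + R) * 1 := by rw [mul_one]; gcongr
      _ ≤ _ := by gcongr; linarith [norm_nonneg (X u ω)]
  have hAm : Measurable fun p : (ℝ × ℝ) × Ω => A p.1.1 p.1.2 p.2 := by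
    have hx : Measurable fun p : (ℝ × ℝ) × Ω => X p.1.1 p.2 :=
      hXm.comp (measurable_fst.fst.prodMk measurable_snd)
    have hw : Measurable fun p : (ℝ × ℝ) × Ω => p.1.2 := measurable_fst.snd
    have hρ : Measurable fun p : (ℝ × ℝ) × Ω => p.1.1 := measurable_fst.fst
    exact measurable_jf (h.measurable_cov hα hw measurable_const measurable_const)
      (h.b_meas.comp (hρ.prodMk hx)) (h.a_meas.comp (hρ.prodMk hx))
      (hx.sub (h.measurable_fl hw measurable_const measurable_const))
  have hBm : Measurable fun p : (ℝ × ℝ) × Ω => B p.1.1 p.1.2 p.2 := by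
    have hx : Measurable fun p : (ℝ × ℝ) × Ω => X p.1.1 p.2 :=
      hXm.comp (measurable_fst.fst.prodMk measurable_snd)
    have hw : Measurable fun p : (ℝ × ℝ) × Ω => p.1.2 := measurable_fst.snd
    have hf := h.measurable_fl hw (measurable_const (a := τ)) (measurable_const (a := y))
    exact (measurable_jf (h.measurable_cov hα hw measurable_const measurable_const)
      (h.β_meas.comp (hw.prodMk hf)) (h.a_meas.comp (hw.prodMk hf)) (hx.sub hf)).neg
  have hAi : ∀ ρ, ∀ w ∈ Icc r v, Integrable (A ρ w) P := fun ρ w hw =>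
    Integrable.of_bound (hAm.comp (measurable_prodMk_left (x := (ρ, w)))).aestronglyMeasurable M
      (Eventually.of_forall fun ω => hAb ρ w hw ω)
  have hBi : ∀ u, ∀ ρ ∈ Icc r v, Integrable (B u ρ) P := fun u ρ hρ =>
    Integrable.of_bound (hBm.comp (measurable_prodMk_left (x := (u, ρ)))).aestronglyMeasurable M
      (Eventually.of_forall fun ω => hBb u ρ hρ ω)
  have hqi : ∀ u, ∀ w ∈ Icc r v, Integrable (fun ω => D.q w (X u ω) τ y) P := by
    intro u w hw
    obtain ⟨B', hB', hb⟩ := exists_gauss_poly_bound (hell w hw) hκ (hpos w hw)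
    refine Integrable.of_bound (h.measurable_q hα measurable_const (hP.meas u) measurable_const
      measurable_const).aestronglyMeasurable B' (Eventually.of_forall fun ω => ?_)
    have hg := gauss_nonneg (D.cov w τ y) (X u ω - D.fl w τ y)
    unfold q
    rw [Real.norm_of_nonneg hg]
    exact (le_mul_of_one_le_left hg (one_le_pow₀ (by linarith [norm_nonneg (X u ω - D.fl w τ y)]))).trans (hb _)
  have key := two_param (K := fun u w => ∫ ω, D.q w (X u ω) τ y ∂P)
    (A := fun ρ w => ∫ ω, A ρ w ω ∂P) (B := fun u ρ => ∫ ω, B u ρ ω ∂P) (M := M) hrv ?_ ?_ ?_ ?_ ?_ ?_ ?_ ?_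
  · refine key.trans (intervalIntegral.integral_congr fun ρ hρ => ?_)
    rw [uIcc_of_le hrv] at hρ
    rw [← integral_add (hAi ρ ρ hρ) (hBi ρ ρ hρ)]
    refine integral_congr_ae (Eventually.of_forall fun ω => ?_)
    simp only [hA, hB, H, jf, inner_sub_right, _root_.sub_apply, mul_sub, tr, inner_sub_left,
      Finset.sum_sub_distrib]
    ring
  · intro w hw u hu u' hu' huu
    exact hP.eqn_gauss (K := 3 * κ) (by positivity) h.b_meas h.a_meas (h.b_growth hκ)
      (fun u z => (h.a_ub u z).trans (by linarith)) (hell w hw) hκ (hpos w hw) _ hu.1 huu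
      (hu'.2.trans (hvτ.le.trans hτ))
  · intro u hu w hw w' hw' hww
    rw [← integral_sub (hqi u w' hw') (hqi u w hw), intervalIntegral_integral_swap]
    · refine integral_congr_ae (Eventually.of_forall fun ω => ?_)
      exact h.q_sub hκ (hsr.trans hw.1) hww (hw'.2.trans_lt hvτ) hτ _ _
    · have hsub : Ioc w w' ⊆ Icc r v := fun x hx => ⟨hw.1.trans hx.1.le, hx.2.trans hw'.2⟩
      rw [uIoc_of_le hww]
      refine Integrable.of_bound ?_ M ?_
      · exact (hBm.comp ((measurable_const.prodMk measurable_fst).prodMk measurable_snd)).aestronglyMeasurable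
      · have : ∀ᵐ p ∂((volume.restrict (Ioc w w')).prod P), p.1 ∈ Ioc w w' :=
          Measure.quasiMeasurePreserving_fst.ae (ae_restrict_mem measurableSet_Ioc)
        filter_upwards [this] with p hp
        exact hBb u p.1 (hsub hp) p.2
  · exact (hAm.stronglyMeasurable.integral_prod_right).measurable
  · exact (hBm.stronglyMeasurable.integral_prod_right).measurable
  · exact fun ρ _ w hw => abs_integral_le_of_mass hP.real_mass hM (hAb ρ w hw)
  · exact fun u _ ρ hρ => abs_integral_le_of_mass hP.real_mass hM (hBb u ρ hρ)
  · intro ρ hρ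
    refine continuousOn_of_dominated (bound := fun _ => M)
      (fun w hw => (hAi ρ w hw).aestronglyMeasurable)
      (fun w hw => Eventually.of_forall fun ω => hAb ρ w hw ω) (integrable_const _)
      (Eventually.of_forall fun ω w hw => ?_)
    have hid : Tendsto (fun x : ℝ => x) (𝓝[Icc r v] w) (𝓝 w) := tendsto_id.mono_left nhdsWithin_le_nhds
    exact tendsto_jf (hell w hw) hκ (hpos w hw) (h.tendsto_cov hα hid tendsto_const_nhds tendsto_const_nhds)
      tendsto_const_nhds tendsto_const_nhds
      (tendsto_const_nhds.sub (h.tendsto_fl hid tendsto_const_nhds tendsto_const_nhds))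
  · intro ρ hρ
    refine continuousOn_of_dominated (bound := fun _ => M)
      (fun u hu => (hBi u ρ hρ).aestronglyMeasurable)
      (fun u hu => Eventually.of_forall fun ω => hBb u ρ hρ ω) (integrable_const _)
      (Eventually.of_forall fun ω u hu => ?_)
    have hid : Tendsto (fun x : ℝ => X x ω) (𝓝[Icc r v] u) (𝓝 (X u ω)) :=
      ((hP.cont ω).tendsto u).mono_left nhdsWithin_le_nhds
    exact (tendsto_jf (hell ρ hρ) hκ (hpos ρ hρ) tendsto_const_nhds
      tendsto_const_nhds tendsto_const_nhds (hid.sub tendsto_const_nhds)).neg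

end Coeffs.Good

end

section

lemma Ell.smul {d : ℕ} {κ δ c : ℝ} {C : Lin d} (h : Ell κ δ C) (hc : 0 < c) : Ell κ (c * δ) (c • C) := by
  refine ⟨fun v w => ?_, fun v => ?_, ?_⟩
  · rw [_root_.smul_apply, _root_.smul_apply, inner_smul_left, inner_smul_right, h.sym]
    simp
  · rw [_root_.smul_apply, inner_smul_left]
    have := mul_le_mul_of_nonneg_left (h.lb v) hc.le
    simp only [conj_trivial]
    linarith
  · rw [norm_smul, Real.norm_of_nonneg hc.le]
    have := mul_le_mul_of_nonneg_left h.ub hc.le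
    linarith

lemma Ell.of_tendsto {d : ℕ} {κ δ : ℝ} {C : ℕ → Lin d} {C₀ : Lin d} (h : ∀ n, Ell κ δ (C n))
    (hC : Tendsto C atTop (𝓝 C₀)) : Ell κ δ C₀ := by
  have hv : ∀ v, Tendsto (fun n => C n v) atTop (𝓝 (C₀ v)) := fun v =>
    tendsto_lin_apply hC tendsto_const_nhds
  refine ⟨fun v w => ?_, fun v => ?_, ?_⟩
  · exact tendsto_nhds_unique ((hv v).inner tendsto_const_nhds)
      ((tendsto_const_nhds.inner (hv w)).congr fun n => ((h n).sym v w).symm)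
  · exact ge_of_tendsto' ((hv v).inner tendsto_const_nhds) fun n => (h n).lb v
  · exact le_of_tendsto' hC.norm fun n => (h n).ub

lemma lin_smul_sub {d : ℕ} (c : ℝ) (A B : Lin d) : c • A - c • B = c • (A - B) := by
  ext1 v
  rw [_root_.sub_apply, _root_.smul_apply, _root_.smul_apply, _root_.smul_apply, _root_.sub_apply, smul_sub]

lemma gauss_scale {d : ℕ} {κ δ r : ℝ} {C : Lin d} (h : Ell κ δ C) (hκ : 0 < κ) (hδ : 0 < δ) (hr : 0 < r)
    (v : Vec d) : r ^ d * gauss C v = gauss ((r ^ 2)⁻¹ • C) (r⁻¹ • v) := by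
  have hc : 0 < (r ^ 2)⁻¹ := by positivity
  have h1 := h.smul hc
  have hl : linv ((r ^ 2)⁻¹ • C) (r⁻¹ • v) = r • linv C v := by
    have h2 := h1.inv_apply hκ (mul_pos hc hδ) (r • linv C v)
    have h3 : ((r ^ 2)⁻¹ • C) (r • linv C v) = r⁻¹ • v := by
      rw [_root_.smul_apply, C.map_smul, h.apply_inv hκ hδ, smul_smul]
      congr 1
      field_simp
    rwa [h3] at h2
  have hd : ((r ^ 2)⁻¹ • C).det = ((r ^ d) ^ 2)⁻¹ * C.det := by
    have := LinearMap.det_smul ((r ^ 2)⁻¹) (C : Vec d →ₗ[ℝ] Vec d)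
    rw [finrank_euclideanSpace, Fintype.card_fin, inv_pow, ← pow_mul, mul_comm 2 d, pow_mul] at this
    exact this
  unfold gauss
  rw [hl, hd, inner_smul_left, inner_smul_right]
  have h3 : (2 * Real.pi) ^ d * (((r ^ d) ^ 2)⁻¹ * C.det) = ((r ^ d)⁻¹) ^ 2 * ((2 * Real.pi) ^ d * C.det) := by
    rw [inv_pow]; ring
  rw [h3, Real.sqrt_mul (sq_nonneg ((r ^ d)⁻¹)), Real.sqrt_sq (by positivity), mul_inv, inv_inv, mul_assoc]
  congr 3
  simp only [conj_trivial]
  field_simp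

namespace Coeffs.Good

variable {d : ℕ} {D : Coeffs d} {κ α T s S : ℝ}

lemma fl_lip (h : D.Good κ α T s S) (hκ : 0 < κ) (u τ : ℝ) (x y : Vec d) :
    ‖D.fl u τ x - D.fl u τ y‖ ≤ κ ^ 2 * ‖x - y‖ := by
  refine (h.F_lip u _ _).trans ?_
  have := mul_le_mul_of_nonneg_left (h.E_lip τ x y) hκ.le
  linarith

lemma fl_fl (h : D.Good κ α T s S) (u v τ : ℝ) (x : Vec d) : D.fl u v (D.fl v τ x) = D.fl u τ x := by
  unfold fl; rw [h.EF]

lemma fl_self (h : D.Good κ α T s S) (u : ℝ) (x : Vec d) : D.fl u u x = x := h.FE u x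

lemma fl_int (h : D.Good κ α T s S) {u τ : ℝ} (hu : u ∈ Icc s S) (hτ : τ ∈ Icc s S) (x : Vec d) :
    x - D.fl u τ x = ∫ ρ in u..τ, D.β ρ (D.fl ρ τ x) := by
  have := h.F_int u hu τ hτ (D.E τ x)
  rwa [h.FE] at this

lemma fl_sub_id_lip (h : D.Good κ α T s S) (hκ : 0 < κ) {u τ : ℝ} (hu : u ∈ Icc s S) (hτ : τ ∈ Icc s S)
    (hle : u ≤ τ) (x y : Vec d) :
    ‖(x - y) - (D.fl u τ x - D.fl u τ y)‖ ≤ κ ^ 3 * (τ - u) * ‖x - y‖ := by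
  have h1 : (x - y) - (D.fl u τ x - D.fl u τ y) =
      ∫ ρ in u..τ, (D.β ρ (D.fl ρ τ x) - D.β ρ (D.fl ρ τ y)) := by
    rw [intervalIntegral.integral_sub (h.intervalIntegrable_β hκ _ _ _ _) (h.intervalIntegrable_β hκ _ _ _ _),
      ← h.fl_int hu hτ, ← h.fl_int hu hτ]
    abel
  rw [h1]
  refine (intervalIntegral.norm_integral_le_of_norm_le_const (C := κ * (κ ^ 2 * ‖x - y‖)) fun ρ _ => ?_).trans ?_
  · exact (h.β_lip ρ _ _).trans (mul_le_mul_of_nonneg_left (h.fl_lip hκ _ _ _ _) hκ.le)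
  · rw [abs_of_nonneg (sub_nonneg.2 hle)]
    exact le_of_eq (by ring)

lemma cov_hol (h : D.Good κ α T s S) (hκ : 0 < κ) (hα : 0 < α) {u τ : ℝ}
    (hle : u ≤ τ) (x y : Vec d) :
    ‖D.cov u τ x - D.cov u τ y‖ ≤ κ * (κ ^ 2 * ‖x - y‖) ^ α * (τ - u) := by
  have h1 : D.cov u τ x - D.cov u τ y = ∫ ρ in u..τ, (D.a ρ (D.fl ρ τ x) - D.a ρ (D.fl ρ τ y)) := by
    unfold cov
    rw [intervalIntegral.integral_sub (h.intervalIntegrable_a _ _ _ _) (h.intervalIntegrable_a _ _ _ _)]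
  rw [h1]
  refine (intervalIntegral.norm_integral_le_of_norm_le_const (C := κ * (κ ^ 2 * ‖x - y‖) ^ α) fun ρ _ => ?_).trans ?_
  · refine (h.a_hol ρ _ _).trans (mul_le_mul_of_nonneg_left ?_ hκ.le)
    exact Real.rpow_le_rpow (norm_nonneg _) (h.fl_lip hκ _ _ _ _) hα.le
  · rw [abs_of_nonneg (sub_nonneg.2 hle)]

set_option maxHeartbeats 1000000 in
lemma tendsto_integral_q_aux (h : D.Good κ α T s S) (hκ : 0 < κ) (hα : 0 < α) {τ : ℝ} (hτ : τ ≤ S) {v : ℕ → ℝ}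
    {z : ℕ → Vec d} {z₀ : Vec d} (hv : Tendsto v atTop (𝓝 τ)) (hsv : ∀ n, s ≤ v n) (hvτ : ∀ n, v n < τ)
    (hz : Tendsto z atTop (𝓝 z₀)) {g : Vec d → ℝ} (hg : Continuous g) {M : ℝ} (hM : ∀ y, |g y| ≤ M)
    {C₀ : Lin d} (hC : Tendsto (fun n => (τ - v n)⁻¹ • D.cov (v n) τ z₀) atTop (𝓝 C₀)) :
    Tendsto (fun n => ∫ y, g y * D.q (v n) (z n) τ y) atTop (𝓝 (g z₀)) := by
  have hM0 : 0 ≤ M := (abs_nonneg _).trans (hM 0)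
  have hδ : ∀ n, 0 < τ - v n := fun n => sub_pos.2 (hvτ n)
  set r : ℕ → ℝ := fun n => Real.sqrt (τ - v n) with hr
  have hr0 : ∀ n, 0 < r n := fun n => Real.sqrt_pos.2 (hδ n)
  have hr2 : ∀ n, r n ^ 2 = τ - v n := fun n => Real.sq_sqrt (hδ n).le
  have hδt : Tendsto (fun n => τ - v n) atTop (𝓝 0) := by
    have := (tendsto_const_nhds (x := τ)).sub hv
    rwa [sub_self] at this
  have hrt : Tendsto r atTop (𝓝 0) := by
    have := (Real.continuous_sqrt.tendsto 0).comp hδt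
    rwa [Real.sqrt_zero] at this
  set m : ℕ → Vec d := fun n => D.fl τ (v n) (z n) with hm
  have hmt : Tendsto m atTop (𝓝 z₀) := by
    have := h.tendsto_fl (tendsto_const_nhds (x := τ)) hv hz
    rwa [h.fl_self] at this
  have hmz : ∀ n, D.fl (v n) τ (m n) = z n := fun n => by rw [hm, h.fl_fl, h.fl_self]
  set Y : ℕ → Vec d → Vec d := fun n w => m n + r n • w with hY
  set u : ℕ → Vec d → Vec d := fun n w => (r n)⁻¹ • (z n - D.fl (v n) τ (Y n w)) with hu
  set Cn : ℕ → Vec d → Lin d := fun n w => (r n ^ 2)⁻¹ • D.cov (v n) τ (Y n w) with hCn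
  have hYt : ∀ w, Tendsto (fun n => Y n w) atTop (𝓝 z₀) := by
    intro w
    simpa using hmt.add (hrt.smul_const w)
  have hell : ∀ n y, Ell κ (τ - v n) (D.cov (v n) τ y) := fun n y => h.ell (hvτ n).le y
  have hell1 : ∀ n y, Ell κ 1 ((r n ^ 2)⁻¹ • D.cov (v n) τ y) := by
    intro n y
    have := (hell n y).smul (c := (r n ^ 2)⁻¹) (by have := hr0 n; positivity)
    rwa [hr2, inv_mul_cancel₀ (hδ n).ne', ← hr2] at this
  have hE0 : Ell κ 1 C₀ := Ell.of_tendsto (fun n => by have := hell1 n z₀; rwa [hr2] at this) hC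
  have h_intg : ∀ n, ∫ y, g y * D.q (v n) (z n) τ y = ∫ w, g (Y n w) * gauss (Cn n w) (u n w) := by
    intro n
    have h1 := Measure.integral_comp_smul (volume : Measure (Vec d))
      (fun y => g (m n + y) * D.q (v n) (z n) τ (m n + y)) (r n)
    rw [integral_add_left_eq_self (fun y => g y * D.q (v n) (z n) τ y) (m n), finrank_euclideanSpace,
      Fintype.card_fin, smul_eq_mul, abs_of_pos (by have := hr0 n; positivity),
      eq_inv_mul_iff_mul_eq₀ (pow_ne_zero _ (hr0 n).ne'), ← integral_const_mul] at h1
    rw [← h1]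
    refine integral_congr_ae (Eventually.of_forall fun w => ?_)
    have h2 := gauss_scale (hell n (Y n w)) hκ (hδ n) (hr0 n) (z n - D.fl (v n) τ (Y n w))
    simp only [q]
    rw [mul_left_comm, h2]
  have hulow : ∀ n w, (κ ^ 2)⁻¹ * ‖w‖ ≤ ‖u n w‖ := by
    intro n w
    have h1 := h.fl_lip hκ τ (v n) (z n) (D.fl (v n) τ (Y n w))
    rw [h.fl_fl, h.fl_self] at h1
    have h2 : D.fl τ (v n) (z n) - Y n w = -(r n • w) := by simp [hY, hm]
    rw [h2, norm_neg, norm_smul, Real.norm_of_nonneg (hr0 n).le] at h1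
    rw [hu, norm_smul, norm_inv, Real.norm_of_nonneg (hr0 n).le, inv_mul_le_iff₀ (by positivity),
      mul_left_comm, ← div_eq_inv_mul, le_div_iff₀ (hr0 n)]
    linarith
  have hut : ∀ w, Tendsto (fun n => u n w) atTop (𝓝 (-w)) := by
    intro w
    rw [tendsto_iff_norm_sub_tendsto_zero]
    refine squeeze_zero (fun _ => norm_nonneg _) (g := fun n => κ ^ 3 * (τ - v n) * ‖w‖) (fun n => ?_) ?_
    · have h1 := h.fl_sub_id_lip hκ (u := v n) (τ := τ) ⟨hsv n, (hvτ n).le.trans hτ⟩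
        ⟨(hsv n).trans (hvτ n).le, hτ⟩ (hvτ n).le (Y n w) (m n)
      rw [hmz] at h1
      have h2 : Y n w - m n = r n • w := by simp [hY]
      have h3 : u n w - -w = (r n)⁻¹ • ((Y n w - m n) - (D.fl (v n) τ (Y n w) - z n)) := by
        show (r n)⁻¹ • (z n - D.fl (v n) τ (Y n w)) - -w = _
        rw [h2, smul_sub (r n)⁻¹ (r n • w), inv_smul_smul₀ (hr0 n).ne', smul_sub, smul_sub]
        abel
      rw [h3, norm_smul, norm_inv, Real.norm_of_nonneg (hr0 n).le, inv_mul_le_iff₀ (hr0 n)]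
      refine h1.trans ?_
      rw [h2, norm_smul, Real.norm_of_nonneg (hr0 n).le]
      exact le_of_eq (by ring)
    · simpa using (hδt.const_mul (κ ^ 3)).mul_const ‖w‖
  have hCt : ∀ w, Tendsto (fun n => Cn n w) atTop (𝓝 C₀) := by
    intro w
    have h1 : Tendsto (fun n => Cn n w - (τ - v n)⁻¹ • D.cov (v n) τ z₀) atTop (𝓝 0) := by
      refine squeeze_zero_norm (a := fun n => κ * (κ ^ 2 * ‖Y n w - z₀‖) ^ α) (fun n => ?_) ?_
      · show ‖(r n ^ 2)⁻¹ • D.cov (v n) τ (Y n w) - (τ - v n)⁻¹ • D.cov (v n) τ z₀‖ ≤ _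
        rw [hr2, lin_smul_sub, norm_smul, norm_inv, Real.norm_of_nonneg (hδ n).le,
          inv_mul_le_iff₀ (hδ n)]
        refine (h.cov_hol hκ hα (hvτ n).le _ _).trans (le_of_eq (by ring))
      · have h2 : Tendsto (fun n => ‖Y n w - z₀‖) atTop (𝓝 0) := tendsto_iff_norm_sub_tendsto_zero.1 (hYt w)
        have h3 := ((h2.const_mul (κ ^ 2)).rpow_const (p := α) (Or.inr hα.le)).const_mul κ
        rwa [mul_zero, Real.zero_rpow hα.ne', mul_zero] at h3
    simpa using h1.add hC
  simp_rw [h_intg]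
  have hlim : ∫ w : Vec d, g z₀ * gauss C₀ (-w) = g z₀ := by
    rw [integral_const_mul, integral_neg_eq_self (fun w => gauss C₀ w) volume,
      integral_gauss hE0 hκ one_pos, mul_one]
  rw [← hlim]
  refine tendsto_integral_of_dominated_convergence
    (fun w => M * (κ ^ ((d : ℝ) / 2) * Real.exp (-(2 * κ ^ 7)⁻¹ * ‖w‖ ^ 2))) (fun n => ?_) ?_ (fun n => ?_) ?_
  · have hYm : Measurable (Y n) := by fun_prop
    have h1 := h.measurable_q hα (measurable_const (a := v n)) (measurable_const (a := z n))
      (measurable_const (a := τ)) hYm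
    have h2 : (fun w => gauss (Cn n w) (u n w)) = fun w => r n ^ d * D.q (v n) (z n) τ (Y n w) :=
      funext fun w => (gauss_scale (hell n (Y n w)) hκ (hδ n) (hr0 n) (z n - D.fl (v n) τ (Y n w))).symm
    have h3 : Measurable fun w => gauss (Cn n w) (u n w) := h2 ▸ h1.const_mul _
    exact ((hg.measurable.comp hYm).mul h3).aestronglyMeasurable
  · have := lintegral_exp_sq (d := d) (c := (2 * κ ^ 7)⁻¹) (by positivity) 0
    simp only [sub_zero] at this
    refine (Integrable.const_mul ⟨by fun_prop, ?_⟩ _).const_mul _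
    rw [hasFiniteIntegral_iff_norm]
    simp only [Real.norm_of_nonneg (Real.exp_pos _).le]
    rw [this]
    exact ENNReal.ofReal_lt_top
  · refine Eventually.of_forall fun w => ?_
    rw [norm_mul]
    refine mul_le_mul (hM _) ?_ (norm_nonneg _) hM0
    rw [Real.norm_of_nonneg (gauss_nonneg _ _)]
    refine (gauss_le (hell1 n (Y n w)) hκ one_pos _).trans ?_
    rw [Real.one_rpow, one_mul, mul_one]
    have h1 : ((κ ^ 2)⁻¹ * ‖w‖) ^ 2 ≤ ‖u n w‖ ^ 2 := by
      have := hulow n w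
      gcongr
    refine mul_le_mul_of_nonneg_left (Real.exp_le_exp.2 ?_) (by positivity)
    rw [neg_mul, neg_le_neg_iff, le_div_iff₀ (by positivity)]
    refine le_trans (le_of_eq ?_) h1
    field_simp
  · refine Eventually.of_forall fun w => ?_
    exact ((hg.tendsto z₀).comp (hYt w)).mul (tendsto_gauss hE0 hκ one_pos (hCt w) (hut w))

/-- The frozen densities are an approximate identity. -/
lemma tendsto_integral_q (h : D.Good κ α T s S) (hκ : 0 < κ) (hα : 0 < α) {τ : ℝ} (hτ : τ ≤ S) {v : ℕ → ℝ}
    {z : ℕ → Vec d} {z₀ : Vec d} (hv : Tendsto v atTop (𝓝 τ)) (hsv : ∀ n, s ≤ v n) (hvτ : ∀ n, v n < τ)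
    (hz : Tendsto z atTop (𝓝 z₀)) {g : Vec d → ℝ} (hg : Continuous g) {M : ℝ} (hM : ∀ y, |g y| ≤ M) :
    Tendsto (fun n => ∫ y, g y * D.q (v n) (z n) τ y) atTop (𝓝 (g z₀)) := by
  have : ProperSpace (Lin d) := FiniteDimensional.proper ℝ _
  refine tendsto_of_subseq_tendsto fun ns hns => ?_
  have hb : ∀ n, (τ - v (ns n))⁻¹ • D.cov (v (ns n)) τ z₀ ∈ Metric.closedBall (0 : Lin d) κ := by
    intro n
    have hδ := sub_pos.2 (hvτ (ns n))
    have := (h.ell (hvτ (ns n)).le z₀).ub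
    rw [mem_closedBall_zero_iff, norm_smul, norm_inv, Real.norm_of_nonneg hδ.le, inv_mul_le_iff₀ hδ]
    linarith
  obtain ⟨C₀, -, φ, hφ, hC⟩ := tendsto_subseq_of_bounded Metric.isBounded_closedBall hb
  have hns' := hns.comp hφ.tendsto_atTop
  exact ⟨φ, h.tendsto_integral_q_aux hκ hα hτ (hv.comp hns') (fun n => hsv _) (fun n => hvτ _)
    (hz.comp hns') hg hM hC⟩

end Coeffs.Good

end

section

lemma lintegral_rpow_sub_lt_top {e : ℝ} (he : 0 < e) (r τ : ℝ) :
    ∫⁻ u in Ioo r τ, ENNReal.ofReal ((τ - u) ^ (-1 + e)) < ∞ := by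
  rcases le_or_gt τ r with hr | hr
  · simp [Ioo_eq_empty (not_lt.2 hr)]
  have h1 : IntervalIntegrable (fun u : ℝ => (τ - u) ^ (-1 + e)) volume r τ := by
    have := (intervalIntegral.intervalIntegrable_rpow' (a := 0) (b := τ - r) (r := -1 + e)
      (by linarith)).comp_sub_left τ
    simpa using this.symm
  rw [intervalIntegrable_iff_integrableOn_Ioo_of_le hr.le] at h1
  have h2 := h1.lintegral_lt_top
  exact h2

/-- The candidate density of `X τ` provided by Duhamel's formula. -/
def Coeffs.hk {d : ℕ} (D : Coeffs d) {Ω : Type} [MeasurableSpace Ω] (P : Measure Ω) (X : ℝ → Ω → Vec d)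
    (r τ : ℝ) (y : Vec d) : ℝ :=
  ∫ ω, D.q r (X r ω) τ y ∂P + ∫ u in r..τ, ∫ ω, D.H u (X u ω) τ y ∂P

namespace Coeffs.Good

variable {d : ℕ} {D : Coeffs d} {κ α T s S : ℝ}

lemma lintegral_q_le (h : D.Good κ α T s S) (hκ : 0 < κ) {u τ : ℝ} (hu : u < τ) (z : Vec d) :
    ∫⁻ y, ENNReal.ofReal (D.q u z τ y) ≤
      ENNReal.ofReal (κ ^ ((d : ℝ) / 2) * (κ ^ d * (Real.pi / lam κ) ^ ((d : ℝ) / 2))) := by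
  rw [ENNReal.ofReal_mul (by positivity)]
  refine le_trans ?_ (mul_le_mul_right (h.lintegral_Γ_le hκ (lam_pos hκ) hu z) _)
  rw [← lintegral_const_mul']
  · refine lintegral_mono fun y => ?_
    rw [← ENNReal.ofReal_mul (by positivity)]
    exact ENNReal.ofReal_le_ofReal (h.q_le hκ hu z y)
  · exact ENNReal.ofReal_ne_top

lemma integrable_q (h : D.Good κ α T s S) (hκ : 0 < κ) (hα : 0 < α) {u τ : ℝ} (hu : u < τ) (z : Vec d) :
    Integrable fun y => D.q u z τ y := by
  refine ⟨(h.measurable_q hα measurable_const measurable_const measurable_const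
    measurable_id).aestronglyMeasurable, ?_⟩
  rw [hasFiniteIntegral_iff_ofReal (Eventually.of_forall fun y => D.q_nonneg _ _ _ _)]
  exact (h.lintegral_q_le hκ hu z).trans_lt ENNReal.ofReal_lt_top

section flow

variable {Ω : Type} [MeasurableSpace Ω] {r : ℝ} {P : Measure Ω} {X : ℝ → Ω → Vec d}

lemma integrable_q_prod (h : D.Good κ α T s S) (hκ : 0 < κ) (hα : 0 < α) (hP : FPFlow D.b D.a r S P X)
    {u τ : ℝ} (hu : u < τ) : Integrable (fun p : Ω × Vec d => D.q u (X u p.1) τ p.2) (P.prod volume) := by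
  have := hP.finite
  have hm : Measurable fun p : Ω × Vec d => D.q u (X u p.1) τ p.2 :=
    h.measurable_q hα measurable_const ((hP.meas u).comp measurable_fst) measurable_const measurable_snd
  refine ⟨hm.aestronglyMeasurable, ?_⟩
  rw [hasFiniteIntegral_iff_ofReal (Eventually.of_forall fun y => D.q_nonneg _ _ _ _),
    lintegral_prod _ hm.ennreal_ofReal.aemeasurable]
  refine (lintegral_mono fun ω => h.lintegral_q_le hκ hu _).trans_lt ?_
  rw [lintegral_const]
  exact ENNReal.mul_lt_top ENNReal.ofReal_lt_top (measure_lt_top _ _)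

lemma measurable_HX (h : D.Good κ α T s S) (hα : 0 < α) (hP : FPFlow D.b D.a r S P X) (τ : ℝ) :
    Measurable fun p : (ℝ × Vec d) × Ω => D.H p.1.1 (X p.1.1 p.2) τ p.1.2 :=
  h.measurable_H hα measurable_fst.fst
    (hP.joint_meas.comp (measurable_fst.fst.prodMk measurable_snd)) measurable_const measurable_fst.snd

lemma integrable_HX (h : D.Good κ α T s S) (hκ : 1 ≤ κ) (hα : α ∈ Ioc (0 : ℝ) 1)
    (hP : FPFlow D.b D.a r S P X) (hsr : s ≤ r) {τ : ℝ} (hrτ : r < τ) (hτ : τ ≤ S) :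
    Integrable (fun p : (ℝ × Vec d) × Ω => D.H p.1.1 (X p.1.1 p.2) τ p.1.2)
      (((volume.restrict (Ioo r τ)).prod volume).prod P) := by
  have := hP.finite
  have hκ0 : 0 < κ := by linarith
  have hT : 0 < T := by linarith [h.len]
  obtain ⟨C, hC, hCb⟩ := exists_H_bound d hκ hα hT
  have hm := h.measurable_HX hα.1 hP τ
  refine ⟨hm.aestronglyMeasurable, ?_⟩
  rw [hasFiniteIntegral_iff_norm, lintegral_prod _ hm.norm.ennreal_ofReal.aemeasurable,
    lintegral_prod _ (hm.norm.ennreal_ofReal.lintegral_prod_right').aemeasurable]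
  set G := κ ^ d * (Real.pi / lam κ) ^ ((d : ℝ) / 2) with hG
  have hl := lam_pos hκ0
  have key : ∀ u ∈ Ioo r τ, ∫⁻ y, ∫⁻ ω, ENNReal.ofReal ‖D.H u (X u ω) τ y‖ ∂P ≤
      ENNReal.ofReal (C * G) * ENNReal.ofReal ((τ - u) ^ (-1 + α / 2)) := by
    intro u hu
    have hδ : 0 < τ - u := sub_pos.2 hu.2
    rw [lintegral_lintegral_swap]
    · have h1 : ∀ ω, ∫⁻ y, ENNReal.ofReal ‖D.H u (X u ω) τ y‖ ≤
          ENNReal.ofReal (C * G) * ENNReal.ofReal ((τ - u) ^ (-1 + α / 2)) := by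
        intro ω
        have h2 : ∀ y, ENNReal.ofReal ‖D.H u (X u ω) τ y‖ ≤
            ENNReal.ofReal (C * (τ - u) ^ (-1 + α / 2)) * ENNReal.ofReal (D.Γ (lam κ) u (X u ω) τ y) := by
          intro y
          rw [← ENNReal.ofReal_mul (by positivity), mul_assoc]
          exact ENNReal.ofReal_le_ofReal (hCb D s S h u τ hu.2 (by linarith [hu.1, h.len]) _ _)
        refine (lintegral_mono h2).trans ?_
        rw [lintegral_const_mul' _ _ ENNReal.ofReal_ne_top]
        refine (mul_le_mul_right (h.lintegral_Γ_le hκ0 hl hu.2 _) _).trans (le_of_eq ?_)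
        rw [← ENNReal.ofReal_mul (by positivity), ← ENNReal.ofReal_mul (by positivity)]
        congr 1
        ring
      refine (lintegral_mono h1).trans ?_
      rw [lintegral_const]
      exact mul_le_of_le_one_right' hP.mass
    · exact (hm.comp ((measurable_const.prodMk measurable_fst).prodMk
        measurable_snd)).norm.ennreal_ofReal.aemeasurable
  refine (setLIntegral_mono' measurableSet_Ioo key).trans_lt ?_
  rw [lintegral_const_mul' _ _ ENNReal.ofReal_ne_top]
  exact ENNReal.mul_lt_top ENNReal.ofReal_lt_top (lintegral_rpow_sub_lt_top (by linarith [hα.1]) _ _)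

/-- The law of `X τ` has the density given by Duhamel's formula. -/
theorem law_eq (h : D.Good κ α T s S) (hκ : 1 ≤ κ) (hα : α ∈ Ioc (0 : ℝ) 1)
    (hP : FPFlow D.b D.a r S P X) (hsr : s ≤ r) {τ : ℝ} (hrτ : r < τ) (hτ : τ ≤ S) :
    Integrable (D.hk P X r τ) ∧ (∀ᵐ y, 0 ≤ D.hk P X r τ y) ∧
      Measure.map (X τ) P = volume.withDensity fun y => ENNReal.ofReal (D.hk P X r τ y) := by
  have := hP.finite
  have hκ0 : 0 < κ := by linarith
  set G0 : Vec d → ℝ := fun y => ∫ ω, D.q r (X r ω) τ y ∂P with hG0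
  set J : ℝ → Vec d → ℝ := fun u y => ∫ ω, D.H u (X u ω) τ y ∂P with hJ
  have hJi : Integrable (fun p : ℝ × Vec d => J p.1 p.2) ((volume.restrict (Ioo r τ)).prod volume) :=
    (h.integrable_HX hκ hα hP hsr hrτ hτ).integral_prod_left
  have hG0i : Integrable G0 := (h.integrable_q_prod hκ0 hα.1 hP hrτ).integral_prod_right
  have hae : ∀ᵐ y, IntegrableOn (fun u => J u y) (Ioo r τ) := hJi.prod_left_ae
  have h_intg : ∀ y, ∫ u in r..τ, J u y = ∫ u in Ioo r τ, J u y := fun y => by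
    rw [intervalIntegral.integral_of_le hrτ.le, integral_Ioc_eq_integral_Ioo]
  have hki : Integrable (D.hk P X r τ) := by
    have h1 : Integrable fun y => ∫ u in Ioo r τ, J u y := hJi.integral_prod_right
    refine (hG0i.add h1).congr (Eventually.of_forall fun y => ?_)
    show _ = G0 y + ∫ u in r..τ, J u y
    rw [h_intg, Pi.add_apply]
  set N : Vec d → ℝ := fun y => G0 y + ∫ u in Ioo r τ, |J u y| with hN
  have hNi : Integrable N := hG0i.add hJi.norm.integral_prod_right
  set v : ℕ → ℝ := fun n => τ - (τ - r) / (n + 1) with hv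
  have hvt : Tendsto v atTop (𝓝 τ) := by
    have h1 := (tendsto_const_div_atTop_nhds_zero_nat (τ - r)).comp (tendsto_add_atTop_nat 1)
    have h2 := (tendsto_const_nhds (x := τ)).sub h1
    rw [sub_zero] at h2
    refine h2.congr fun n => ?_
    simp [hv]
  have hvτ : ∀ n, v n < τ := fun n => by
    have : 0 < (τ - r) / (n + 1) := div_pos (sub_pos.2 hrτ) (by positivity)
    simp only [hv]; linarith
  have hrv : ∀ n, r ≤ v n := fun n => by
    have : (τ - r) / (n + 1) ≤ τ - r := div_le_self (sub_pos.2 hrτ).le (by linarith [n.cast_nonneg (α := ℝ)])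
    simp only [hv]; linarith
  set K : ℕ → Vec d → ℝ := fun n y => ∫ ω, D.q (v n) (X (v n) ω) τ y ∂P with hK
  have hKeq : ∀ n y, K n y = G0 y + ∫ u in r..v n, J u y := fun n y => by
    have := h.duhamel hκ0 hα.1 hP hsr (hrv n) (hvτ n) hτ y
    simp only [hK, hG0, hJ]; linarith
  have hK0 : ∀ n y, 0 ≤ K n y := fun n y => integral_nonneg fun ω => D.q_nonneg _ _ _ _
  have hKN : ∀ᵐ y, ∀ n, |K n y| ≤ N y := by
    filter_upwards [hae] with y hy n
    have h1 : |∫ u in r..v n, J u y| ≤ ∫ u in Ioo r τ, |J u y| := by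
      rw [intervalIntegral.integral_of_le (hrv n)]
      refine (abs_integral_le_integral_abs).trans ?_
      exact setIntegral_mono_set hy.abs (Eventually.of_forall fun u => abs_nonneg _)
        (LE.le.eventuallyLE fun u hu => ⟨hu.1, hu.2.trans_lt (hvτ n)⟩)
    have h2 : 0 ≤ G0 y := integral_nonneg fun ω => D.q_nonneg _ _ _ _
    rw [hKeq]
    refine (abs_add_le _ _).trans ?_
    rw [abs_of_nonneg h2]
    exact add_le_add_right h1 _
  have hKt : ∀ᵐ y, Tendsto (fun n => K n y) atTop (𝓝 (D.hk P X r τ y)) := by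
    filter_upwards [hae] with y hy
    have h1 : IntegrableOn (fun u => J u y) (uIcc r τ) := by
      rwa [uIcc_of_le hrτ.le, integrableOn_Icc_iff_integrableOn_Ioo]
    have h2 := intervalIntegral.continuousOn_primitive_interval h1 τ right_mem_uIcc
    have h3 : Tendsto v atTop (𝓝[uIcc r τ] τ) := tendsto_nhdsWithin_iff.2 ⟨hvt, Eventually.of_forall fun n => by
      rw [uIcc_of_le hrτ.le]; exact ⟨hrv n, (hvτ n).le⟩⟩
    exact ((h2.tendsto.comp h3).const_add (G0 y)).congr fun n => (hKeq n y).symm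
  have hnn : ∀ᵐ y, 0 ≤ D.hk P X r τ y := by
    filter_upwards [hKt] with y hy using ge_of_tendsto' hy fun n => hK0 n y
  refine ⟨hki, hnn, ?_⟩
  have hfin : IsFiniteMeasure (volume.withDensity fun y => ENNReal.ofReal (D.hk P X r τ y)) :=
    isFiniteMeasure_withDensity_ofReal hki.2
  refine ext_of_forall_integral_eq_of_IsFiniteMeasure fun g => ?_
  have hgb : ∀ y, |g y| ≤ ‖g‖ := fun y => g.norm_coe_le_norm y
  have hgm : Measurable g := g.continuous.measurable
  rw [integral_map (hP.meas τ).aemeasurable g.continuous.aestronglyMeasurable]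
  rw [integral_withDensity_eq_integral_toReal_smul₀ hki.1.aemeasurable.ennreal_ofReal
    (Eventually.of_forall fun _ => ENNReal.ofReal_lt_top)]
  have e1 : ∫ y, (ENNReal.ofReal (D.hk P X r τ y)).toReal • g y = ∫ y, g y * D.hk P X r τ y := by
    refine integral_congr_ae ?_
    filter_upwards [hnn] with y hy
    rw [ENNReal.toReal_ofReal hy, smul_eq_mul, mul_comm]
  rw [e1]
  have hKm : ∀ n, AEStronglyMeasurable (K n) volume := fun n =>
    ((h.integrable_q_prod hκ0 hα.1 hP (hvτ n)).integral_prod_right).aestronglyMeasurable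
  have l1 : Tendsto (fun n => ∫ y, g y * K n y) atTop (𝓝 (∫ y, g y * D.hk P X r τ y)) := by
    refine tendsto_integral_of_dominated_convergence (fun y => ‖g‖ * N y)
      (fun n => hgm.aestronglyMeasurable.mul (hKm n)) (hNi.const_mul _) (fun n => ?_) ?_
    · filter_upwards [hKN] with y hy
      rw [norm_mul]
      exact mul_le_mul (hgb y) (hy n) (norm_nonneg _) (norm_nonneg _)
    · filter_upwards [hKt] with y hy using hy.const_mul _
  set Cq := κ ^ ((d : ℝ) / 2) * (κ ^ d * (Real.pi / lam κ) ^ ((d : ℝ) / 2)) with hCq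
  have hl := lam_pos hκ0
  have l2 : Tendsto (fun n => ∫ ω, (∫ y, g y * D.q (v n) (X (v n) ω) τ y) ∂P) atTop (𝓝 (∫ ω, g (X τ ω) ∂P)) := by
    refine tendsto_integral_of_dominated_convergence (fun _ => ‖g‖ * Cq) (fun n => ?_)
      (integrable_const _) (fun n => Eventually.of_forall fun ω => ?_) (Eventually.of_forall fun ω => ?_)
    · have hm : Measurable fun p : Ω × Vec d => g p.2 * D.q (v n) (X (v n) p.1) τ p.2 :=
        (hgm.comp measurable_snd).mul (h.measurable_q hα.1 measurable_const
          ((hP.meas _).comp measurable_fst) measurable_const measurable_snd)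
      exact hm.stronglyMeasurable.integral_prod_right'.aestronglyMeasurable
    · have hqi := h.integrable_q hκ0 hα.1 (hvτ n) (X (v n) ω)
      have h1 : ∫ y, D.q (v n) (X (v n) ω) τ y ≤ Cq := by
        rw [integral_eq_lintegral_of_nonneg_ae (Eventually.of_forall fun y => D.q_nonneg _ _ _ _) hqi.1]
        exact ENNReal.toReal_le_of_le_ofReal (by positivity) (h.lintegral_q_le hκ0 (hvτ n) _)
      refine (norm_integral_le_of_norm_le (hqi.const_mul ‖g‖) (Eventually.of_forall fun y => ?_)).trans ?_
      · rw [norm_mul, Real.norm_of_nonneg (D.q_nonneg _ _ _ _)]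
        exact mul_le_mul_of_nonneg_right (hgb y) (D.q_nonneg _ _ _ _)
      · rw [integral_const_mul]
        exact mul_le_mul_of_nonneg_left h1 (norm_nonneg _)
    · exact h.tendsto_integral_q hκ0 hα.1 hτ hvt (fun n => hsr.trans (hrv n)) hvτ
        (((hP.cont ω).tendsto τ).comp hvt) g.continuous hgb
  refine tendsto_nhds_unique l2 (l1.congr fun n => ?_)
  have hgi : Integrable (fun p : Ω × Vec d => g p.2 * D.q (v n) (X (v n) p.1) τ p.2) (P.prod volume) :=
    (h.integrable_q_prod hκ0 hα.1 hP (hvτ n)).bdd_mul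
      (hgm.comp measurable_snd).aestronglyMeasurable (Eventually.of_forall fun p => hgb p.2)
  rw [integral_integral_swap hgi]
  simp only [hK, integral_const_mul]

end flow

end Coeffs.Good

end

section

lemma lintegral_rpow_exp_Ioi {e μ : ℝ} (he : 0 < e) (hμ : 0 < μ) :
    ∫⁻ t in Ioi (0 : ℝ), ENNReal.ofReal (t ^ (-1 + e) * Real.exp (-(μ * t))) =
      ENNReal.ofReal ((1 / μ) ^ e * Real.Gamma e) := by
  have h0 := Real.integral_rpow_mul_exp_neg_mul_Ioi he hμ
  have hG := Real.Gamma_pos_of_pos he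
  have hi : IntegrableOn (fun t : ℝ => t ^ (e - 1) * Real.exp (-(μ * t))) (Ioi 0) := by
    refine not_not.1 fun hn => ?_
    rw [integral_undef hn] at h0
    have : 0 < (1 / μ) ^ e * Real.Gamma e := by positivity
    linarith
  rw [← h0, ofReal_integral_eq_lintegral_ofReal hi]
  · simp_rw [sub_eq_neg_add]
  · filter_upwards [ae_restrict_mem measurableSet_Ioi] with t ht
    have : 0 < t := ht
    positivity

lemma exists_exp_weight {e C : ℝ} (he : 0 < e) (hC : 0 < C) : ∃ μ : ℝ, 0 < μ ∧ ∀ r τ : ℝ,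
    ENNReal.ofReal C * ∫⁻ u in Ioo r τ, ENNReal.ofReal ((τ - u) ^ (-1 + e)) *
      ENNReal.ofReal (Real.exp (μ * (u - r))) ≤ 2⁻¹ * ENNReal.ofReal (Real.exp (μ * (τ - r))) := by
  have hG := Real.Gamma_pos_of_pos he
  set ν : ℝ := (1 / (2 * C * Real.Gamma e)) ^ (1 / e) with hν
  have hν0 : 0 < ν := by positivity
  have hνe : ν ^ e = 1 / (2 * C * Real.Gamma e) := by
    rw [hν, ← Real.rpow_mul (by positivity), one_div_mul_cancel he.ne', Real.rpow_one]
  refine ⟨1 / ν, by positivity, fun r τ => ?_⟩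
  set μ := 1 / ν with hμ
  have hμ0 : 0 < μ := by positivity
  have h1 : ∀ u ∈ Ioo r τ, ENNReal.ofReal ((τ - u) ^ (-1 + e)) * ENNReal.ofReal (Real.exp (μ * (u - r))) ≤
      ENNReal.ofReal (Real.exp (μ * (τ - r))) *
        (Ioi (0 : ℝ)).indicator (fun t => ENNReal.ofReal (t ^ (-1 + e) * Real.exp (-(μ * t)))) (τ - u) := by
    intro u hu
    have hu' : 0 < τ - u := sub_pos.2 hu.2
    rw [indicator_of_mem (by exact hu'), ← ENNReal.ofReal_mul (by positivity), ← ENNReal.ofReal_mul (by positivity)]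
    refine le_of_eq (congrArg _ ?_)
    rw [mul_left_comm, ← Real.exp_add]
    ring_nf
  have h2 : ∫⁻ u in Ioo r τ, ENNReal.ofReal ((τ - u) ^ (-1 + e)) * ENNReal.ofReal (Real.exp (μ * (u - r))) ≤
      ENNReal.ofReal (Real.exp (μ * (τ - r))) * ENNReal.ofReal ((1 / μ) ^ e * Real.Gamma e) := by
    refine (setLIntegral_mono' measurableSet_Ioo h1).trans ((setLIntegral_le_lintegral _ _).trans ?_)
    rw [lintegral_const_mul' _ _ ENNReal.ofReal_ne_top,
      lintegral_sub_left_eq_self ((Ioi (0 : ℝ)).indicator fun t =>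
        ENNReal.ofReal (t ^ (-1 + e) * Real.exp (-(μ * t)))) τ,
      lintegral_indicator measurableSet_Ioi, lintegral_rpow_exp_Ioi he hμ0]
  refine (mul_le_mul_right h2 _).trans (le_of_eq ?_)
  have h3 : (1 / μ) ^ e = 1 / (2 * C * Real.Gamma e) := by rw [hμ, one_div_one_div, hνe]
  have h4 : (2⁻¹ : ℝ≥0∞) = ENNReal.ofReal 2⁻¹ := by
    rw [ENNReal.ofReal_inv_of_pos two_pos]; simp
  rw [h3, h4, ← ENNReal.ofReal_mul (by positivity), ← ENNReal.ofReal_mul (by positivity),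
    ← ENNReal.ofReal_mul (by positivity)]
  congr 1
  field_simp

/-- A singular Gronwall lemma. -/
lemma singular_gronwall {e C r S : ℝ} (he : 0 < e) (hC : 0 < C) {φ : ℝ → ℝ≥0∞} {B : ℝ≥0∞} (hB : B ≠ ∞)
    (hφB : ∀ τ ∈ Ioc r S, φ τ ≤ B)
    (hφ : ∀ τ ∈ Ioc r S, φ τ ≤ ENNReal.ofReal C * ∫⁻ u in Ioo r τ, ENNReal.ofReal ((τ - u) ^ (-1 + e)) * φ u) :
    ∀ τ ∈ Ioc r S, φ τ = 0 := by
  obtain ⟨μ, hμ, hw⟩ := exists_exp_weight he hC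
  have key : ∀ n : ℕ, ∀ τ ∈ Ioc r S, φ τ ≤ 2⁻¹ ^ n * B * ENNReal.ofReal (Real.exp (μ * (τ - r))) := by
    intro n
    induction n with
    | zero =>
      intro τ hτ
      rw [pow_zero, one_mul]
      refine (hφB τ hτ).trans (le_mul_of_one_le_right' ?_)
      rw [← ENNReal.ofReal_one]
      exact ENNReal.ofReal_le_ofReal (Real.one_le_exp (mul_nonneg hμ.le (sub_nonneg.2 hτ.1.le)))
    | succ n ih =>
      intro τ hτ
      have h1 : ∫⁻ u in Ioo r τ, ENNReal.ofReal ((τ - u) ^ (-1 + e)) * φ u ≤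
          ∫⁻ u in Ioo r τ, 2⁻¹ ^ n * B * (ENNReal.ofReal ((τ - u) ^ (-1 + e)) *
            ENNReal.ofReal (Real.exp (μ * (u - r)))) := by
        refine setLIntegral_mono' measurableSet_Ioo fun u hu => ?_
        rw [mul_left_comm]
        exact mul_le_mul_right (ih u ⟨hu.1, hu.2.le.trans hτ.2⟩) _
      have hne : 2⁻¹ ^ n * B ≠ ∞ := ENNReal.mul_ne_top (ENNReal.pow_ne_top (by simp)) hB
      rw [lintegral_const_mul' _ _ hne] at h1
      refine (hφ τ hτ).trans ((mul_le_mul_right h1 _).trans ?_)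
      rw [mul_left_comm]
      refine (mul_le_mul_right (hw r τ) _).trans (le_of_eq ?_)
      rw [pow_succ]; ring
  intro τ hτ
  have ht : Tendsto (fun n : ℕ => (2⁻¹ : ℝ≥0∞) ^ n * (B * ENNReal.ofReal (Real.exp (μ * (τ - r))))) atTop (𝓝 0) := by
    have h1 : Tendsto (fun n : ℕ => (2⁻¹ : ℝ≥0∞) ^ n) atTop (𝓝 0) :=
      ENNReal.tendsto_pow_atTop_nhds_zero_of_lt_one (by norm_num)
    have h2 := ENNReal.Tendsto.mul_const (b := B * ENNReal.ofReal (Real.exp (μ * (τ - r)))) h1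
      (Or.inr (ENNReal.mul_ne_top hB ENNReal.ofReal_ne_top))
    rwa [zero_mul] at h2
  exact le_antisymm (ge_of_tendsto' ht fun n => by rw [← mul_assoc]; exact key n τ hτ) bot_le

/-- The average of the Gaussian kernel over the law of `X r`. -/
def Coeffs.EΓ {d : ℕ} (D : Coeffs d) {Ω : Type} [MeasurableSpace Ω] (P : Measure Ω) (X : ℝ → Ω → Vec d)
    (l r τ : ℝ) (y : Vec d) : ℝ≥0∞ :=
  ∫⁻ ω, ENNReal.ofReal (D.Γ l r (X r ω) τ y) ∂P

namespace Coeffs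

variable {d : ℕ} {D : Coeffs d} {κ α T s S : ℝ}

section flow

variable {Ω : Type} [MeasurableSpace Ω] {r : ℝ} {P : Measure Ω} {X : ℝ → Ω → Vec d}

lemma Good.measurable_ofReal_Γ (h : D.Good κ α T s S) {γ : Type*} [MeasurableSpace γ] (l : ℝ) {u τ : γ → ℝ}
    {z y : γ → Vec d} (hu : Measurable u) (hz : Measurable z) (hτ : Measurable τ) (hy : Measurable y) :
    Measurable fun x => ENNReal.ofReal (D.Γ l (u x) (z x) (τ x) (y x)) :=
  (h.measurable_Γ l hu hz hτ hy).ennreal_ofReal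

lemma Good.lintegral_law (h : D.Good κ α T s S) (hκ : 1 ≤ κ) (hα : α ∈ Ioc (0 : ℝ) 1)
    (hP : FPFlow D.b D.a r S P X) (hsr : s ≤ r) {u : ℝ} (hru : r < u) (hu : u ≤ S) {g : Vec d → ℝ≥0∞}
    (hg : Measurable g) : ∫⁻ ω, g (X u ω) ∂P = ∫⁻ w, g w * ENNReal.ofReal (D.hk P X r u w) := by
  obtain ⟨h1, -, h3⟩ := h.law_eq hκ hα hP hsr hru hu
  rw [← lintegral_map hg (hP.meas u), h3,
    lintegral_withDensity_eq_lintegral_mul₀ h1.1.aemeasurable.ennreal_ofReal hg.aemeasurable]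
  simp only [Pi.mul_apply, mul_comm]

lemma Good.lintegral_hk_le (h : D.Good κ α T s S) (hκ : 1 ≤ κ) (hα : α ∈ Ioc (0 : ℝ) 1)
    (hP : FPFlow D.b D.a r S P X) (hsr : s ≤ r) {u : ℝ} (hru : r < u) (hu : u ≤ S) :
    ∫⁻ w, ENNReal.ofReal (D.hk P X r u w) ≤ 1 := by
  have := h.lintegral_law hκ hα hP hsr hru hu (g := fun _ => 1) measurable_const
  simp only [one_mul, lintegral_one] at this
  rw [← this]
  exact hP.mass

lemma enorm_integral_H_le {C u τ : ℝ} (hC : 0 < C) (hu : u < τ)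
    (hCb : ∀ z y : Vec d, |D.H u z τ y| ≤ C * ((τ - u) ^ (-1 + α / 2) * D.Γ (lam κ) u z τ y)) (y : Vec d) :
    ‖∫ ω, D.H u (X u ω) τ y ∂P‖ₑ ≤
      ENNReal.ofReal C * (ENNReal.ofReal ((τ - u) ^ (-1 + α / 2)) * D.EΓ P X (lam κ) u τ y) := by
  have hδ : 0 < τ - u := sub_pos.2 hu
  refine (enorm_integral_le_lintegral_enorm _).trans ?_
  unfold EΓ
  rw [← lintegral_const_mul' _ _ ENNReal.ofReal_ne_top, ← lintegral_const_mul' _ _ ENNReal.ofReal_ne_top]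
  refine lintegral_mono fun ω => ?_
  rw [← ENNReal.ofReal_mul (by positivity), ← ENNReal.ofReal_mul (by positivity), Real.enorm_eq_ofReal_abs]
  exact ENNReal.ofReal_le_ofReal (hCb _ _)

lemma Good.ofReal_hk_le (h : D.Good κ α T s S) (hκ : 1 ≤ κ) {C τ : ℝ} (hC : 0 < C) (hrτ : r < τ)
    (hCb : ∀ u ∈ Ioo r τ, ∀ z y : Vec d, |D.H u z τ y| ≤ C * ((τ - u) ^ (-1 + α / 2) * D.Γ (lam κ) u z τ y))
    (y : Vec d) : ENNReal.ofReal (D.hk P X r τ y) ≤ ENNReal.ofReal (κ ^ ((d : ℝ) / 2)) * D.EΓ P X (lam κ) r τ y +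
      ENNReal.ofReal C * ∫⁻ u in Ioo r τ, ENNReal.ofReal ((τ - u) ^ (-1 + α / 2)) * D.EΓ P X (lam κ) u τ y := by
  have hκ0 : 0 < κ := by linarith
  refine (ENNReal.ofReal_add_le).trans (add_le_add ?_ ?_)
  · rw [EΓ, ← lintegral_const_mul' _ _ ENNReal.ofReal_ne_top]
    refine (ENNReal.ofReal_le_ofReal (le_abs_self _)).trans ?_
    rw [← Real.enorm_eq_ofReal_abs]
    refine (enorm_integral_le_lintegral_enorm _).trans (lintegral_mono fun ω => ?_)
    rw [Real.enorm_eq_ofReal (D.q_nonneg _ _ _ _), ← ENNReal.ofReal_mul (by positivity)]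
    exact ENNReal.ofReal_le_ofReal (h.q_le hκ0 hrτ _ _)
  · refine (ENNReal.ofReal_le_ofReal (le_abs_self _)).trans ?_
    rw [← Real.enorm_eq_ofReal_abs, intervalIntegral.integral_of_le hrτ.le, integral_Ioc_eq_integral_Ioo,
      ← lintegral_const_mul' _ _ ENNReal.ofReal_ne_top]
    exact (enorm_integral_le_lintegral_enorm _).trans (setLIntegral_mono' measurableSet_Ioo fun u hu =>
      enorm_integral_H_le hC hu.2 (hCb u hu) y)

/-- Averaging the kernel composition inequality over the law of `X r`. -/
lemma Good.lintegral_Γ_mul_EΓ_le (h : D.Good κ α T s S) (hκ : 1 ≤ κ) (hP : FPFlow D.b D.a r S P X) {u τ : ℝ}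
    (hru : r < u) (huτ : u < τ) (y : Vec d) :
    ∫⁻ w, ENNReal.ofReal (D.Γ (lam κ) u w τ y) * D.EΓ P X (lam κ) r u w ≤
      ENNReal.ofReal (κ ^ d * (Real.pi / lam κ) ^ ((d : ℝ) / 2)) * D.EΓ P X (lam κ) r τ y := by
  have := hP.finite
  have hκ0 : 0 < κ := by linarith
  unfold EΓ
  have h1 : ∀ w, ENNReal.ofReal (D.Γ (lam κ) u w τ y) * ∫⁻ ω, ENNReal.ofReal (D.Γ (lam κ) r (X r ω) u w) ∂P =
      ∫⁻ ω, ENNReal.ofReal (D.Γ (lam κ) r (X r ω) u w) * ENNReal.ofReal (D.Γ (lam κ) u w τ y) ∂P := by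
    intro w
    rw [lintegral_mul_const' _ _ ENNReal.ofReal_ne_top, mul_comm]
  simp_rw [h1]
  rw [lintegral_lintegral_swap, ← lintegral_const_mul' _ _ ENNReal.ofReal_ne_top]
  · exact lintegral_mono fun ω => h.lintegral_Γ_mul_Γ_le hκ0 (lam_pos hκ0) hru huτ _ _
  · exact ((h.measurable_ofReal_Γ _ measurable_const ((hP.meas r).comp measurable_snd) measurable_const
      measurable_fst).mul (h.measurable_ofReal_Γ _ measurable_const measurable_fst measurable_const
      measurable_const)).aemeasurable

end flow

end Coeffs

end

section

namespace Coeffs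

variable {d : ℕ} {D : Coeffs d} {κ α T s S : ℝ}

section flow

variable {Ω : Type} [MeasurableSpace Ω] {r : ℝ} {P : Measure Ω} {X : ℝ → Ω → Vec d}

lemma Good.measurable_J (h : D.Good κ α T s S) (hα : 0 < α) (hP : FPFlow D.b D.a r S P X) :
    Measurable fun p : (ℝ × Vec d) × ℝ => ∫ ω, D.H p.2 (X p.2 ω) p.1.1 p.1.2 ∂P := by
  have := hP.finite
  have h1 : Measurable fun p : ((ℝ × Vec d) × ℝ) × Ω => D.H p.1.2 (X p.1.2 p.2) p.1.1.1 p.1.1.2 :=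
    h.measurable_H hα measurable_fst.snd
      (hP.joint_meas.comp (measurable_fst.snd.prodMk measurable_snd)) measurable_fst.fst.fst measurable_fst.fst.snd
  exact h1.stronglyMeasurable.integral_prod_right'.measurable

lemma Good.measurable_hk (h : D.Good κ α T s S) (hα : 0 < α) (hP : FPFlow D.b D.a r S P X) :
    Measurable fun p : ℝ × Vec d => D.hk P X r p.1 p.2 := by
  have := hP.finite
  have h0 : Measurable fun p : ℝ × Vec d => ∫ ω, D.q r (X r ω) p.1 p.2 ∂P := by
    have h1 : Measurable fun p : (ℝ × Vec d) × Ω => D.q r (X r p.2) p.1.1 p.1.2 :=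
      h.measurable_q hα measurable_const ((hP.meas r).comp measurable_snd) measurable_fst.fst measurable_fst.snd
    exact h1.stronglyMeasurable.integral_prod_right'.measurable
  have hJ := h.measurable_J hα hP
  have hI : ∀ A : Set ((ℝ × Vec d) × ℝ), MeasurableSet A → Measurable fun p : ℝ × Vec d =>
      ∫ u, A.indicator (fun p : (ℝ × Vec d) × ℝ => ∫ ω, D.H p.2 (X p.2 ω) p.1.1 p.1.2 ∂P) (p, u) := fun A hA =>
    (hJ.indicator hA).stronglyMeasurable.integral_prod_right'.measurable
  have hA1 : MeasurableSet {p : (ℝ × Vec d) × ℝ | r < p.2 ∧ p.2 ≤ p.1.1} :=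
    (measurableSet_lt measurable_const measurable_snd).inter (measurableSet_le measurable_snd measurable_fst.fst)
  have hA2 : MeasurableSet {p : (ℝ × Vec d) × ℝ | p.1.1 < p.2 ∧ p.2 ≤ r} :=
    (measurableSet_lt measurable_fst.fst measurable_snd).inter (measurableSet_le measurable_snd measurable_const)
  refine h0.add ?_
  have h3 := (hI _ hA1).sub (hI _ hA2)
  refine (congrArg Measurable ?_).mp h3
  funext p
  rw [intervalIntegral, ← integral_indicator measurableSet_Ioc, ← integral_indicator measurableSet_Ioc]
  rfl

lemma Good.measurable_EΓ (h : D.Good κ α T s S) (hP : FPFlow D.b D.a r S P X) (l : ℝ) {γ : Type*}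
    [MeasurableSpace γ] {u τ : γ → ℝ} {y : γ → Vec d} (hu : Measurable u) (hτ : Measurable τ)
    (hy : Measurable y) : Measurable fun x => D.EΓ P X l (u x) (τ x) (y x) := by
  have := hP.finite
  unfold EΓ
  exact (h.measurable_ofReal_Γ l (hu.comp measurable_fst)
    (hP.joint_meas.comp ((hu.comp measurable_fst).prodMk measurable_snd)) (hτ.comp measurable_fst)
    (hy.comp measurable_fst)).lintegral_prod_right'

end flow

set_option maxHeartbeats 1000000 in
/-- Gaussian upper bound for the time-`u` term in Duhamel's formula. -/
theorem exists_enorm_integral_H_le (d : ℕ) {κ α T : ℝ} (hκ : 1 ≤ κ) (hα : α ∈ Ioc (0 : ℝ) 1) (hT : 0 < T) :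
    ∃ C : ℝ, 0 < C ∧ ∀ (D : Coeffs d) (s S : ℝ), D.Good κ α T s S → ∀ (Ω : Type) (_ : MeasurableSpace Ω)
      (r : ℝ) (P : Measure Ω) (X : ℝ → Ω → Vec d), FPFlow D.b D.a r S P X → s ≤ r → ∀ u τ : ℝ, r < u → u < τ →
      τ ≤ S → ∀ y : Vec d, ‖∫ ω, D.H u (X u ω) τ y ∂P‖ₑ ≤
        ENNReal.ofReal C * (ENNReal.ofReal ((τ - u) ^ (-1 + α / 2)) * D.EΓ P X (lam κ) r τ y) := by
  have hκ0 : 0 < κ := by linarith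
  have he : 0 < α / 2 := by linarith [hα.1]
  obtain ⟨C, hC, hCb⟩ := exists_H_bound d hκ hα hT
  have hl := lam_pos hκ0
  set G : ℝ := κ ^ d * (Real.pi / lam κ) ^ ((d : ℝ) / 2) with hG
  have hG0 : 0 < G := by positivity
  obtain ⟨μ, hμ, hw⟩ := exists_exp_weight he (mul_pos hC hG0)
  set Cq : ℝ := κ ^ ((d : ℝ) / 2) with hCq
  have hCq0 : 0 < Cq := by positivity
  refine ⟨C * (2 * Cq * Real.exp (μ * T) * G), by positivity, ?_⟩
  intro D s S h Ω _ r P X hP hsr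
  have := hP.finite
  set f : ℝ → Vec d → ℝ≥0∞ := fun τ y => ENNReal.ofReal (D.hk P X r τ y) with hf
  set Pi : ℝ → Vec d → ℝ≥0∞ := fun τ y =>
    ENNReal.ofReal (2 * Cq) * ENNReal.ofReal (Real.exp (μ * (τ - r))) * D.EΓ P X (lam κ) r τ y with hPi
  set Δ : ℝ → Vec d → ℝ≥0∞ := fun τ y => f τ y - Pi τ y with hΔ
  have hfm : Measurable (Function.uncurry f) := (h.measurable_hk hα.1 hP).ennreal_ofReal
  have hPm : Measurable (Function.uncurry Pi) := by
    refine (measurable_const.mul ?_).mul (h.measurable_EΓ hP _ measurable_const measurable_fst measurable_snd)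
    exact ((Real.measurable_exp.comp ((measurable_fst.sub_const r).const_mul μ))).ennreal_ofReal
  have hΔm : Measurable (Function.uncurry Δ) := hfm.sub hPm
  have hlaw : ∀ u τ, r < u → u < τ → τ ≤ S → ∀ y, D.EΓ P X (lam κ) u τ y ≤
      ENNReal.ofReal (2 * Cq) * ENNReal.ofReal (Real.exp (μ * (u - r))) *
        (ENNReal.ofReal G * D.EΓ P X (lam κ) r τ y) +
      ∫⁻ w, ENNReal.ofReal (D.Γ (lam κ) u w τ y) * Δ u w := by
    intro u τ hru huτ hτ y
    have hm := h.measurable_ofReal_Γ (lam κ) (measurable_const (a := u)) (measurable_id (α := Vec d))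
      (measurable_const (a := τ)) (measurable_const (a := y))
    have h1 := h.lintegral_law hκ hα hP hsr hru (huτ.le.trans hτ) hm
    simp only [id] at h1 hm
    unfold EΓ
    rw [h1]
    have h2 : ∀ w, ENNReal.ofReal (D.Γ (lam κ) u w τ y) * f u w ≤
        ENNReal.ofReal (2 * Cq) * ENNReal.ofReal (Real.exp (μ * (u - r))) *
          (ENNReal.ofReal (D.Γ (lam κ) u w τ y) * D.EΓ P X (lam κ) r u w) +
        ENNReal.ofReal (D.Γ (lam κ) u w τ y) * Δ u w := by
      intro w
      rw [mul_left_comm, ← mul_add]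
      exact mul_le_mul_right le_add_tsub _
    refine (lintegral_mono h2).trans ?_
    have hm' : Measurable fun w => ENNReal.ofReal (2 * Cq) * ENNReal.ofReal (Real.exp (μ * (u - r))) *
          (ENNReal.ofReal (D.Γ (lam κ) u w τ y) * D.EΓ P X (lam κ) r u w) :=
      (hm.mul (h.measurable_EΓ hP _ measurable_const measurable_const measurable_id)).const_mul _
    rw [lintegral_add_left hm', lintegral_const_mul' _ _ (ENNReal.mul_ne_top ENNReal.ofReal_ne_top
      ENNReal.ofReal_ne_top)]
    exact add_le_add_left (mul_le_mul_right (h.lintegral_Γ_mul_EΓ_le hκ hP hru huτ y) _) _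
  have hCb' : ∀ u τ, r < u → u < τ → τ ≤ S → ∀ z y : Vec d,
      |D.H u z τ y| ≤ C * ((τ - u) ^ (-1 + α / 2) * D.Γ (lam κ) u z τ y) := fun u τ hru huτ hτ =>
    hCb D s S h u τ huτ (by linarith [h.len])
  have hΔle : ∀ τ ∈ Ioc r S, ∀ y, Δ τ y ≤ ENNReal.ofReal C * ∫⁻ u in Ioo r τ,
      ENNReal.ofReal ((τ - u) ^ (-1 + α / 2)) * ∫⁻ w, ENNReal.ofReal (D.Γ (lam κ) u w τ y) * Δ u w := by
    intro τ hτ y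
    refine tsub_le_iff_left.2 ?_
    refine (h.ofReal_hk_le hκ hC hτ.1 (fun u hu => hCb' u τ hu.1 hu.2 hτ.2) y).trans ?_
    set A := D.EΓ P X (lam κ) r τ y with hA
    have h1 : ∫⁻ u in Ioo r τ, ENNReal.ofReal ((τ - u) ^ (-1 + α / 2)) * D.EΓ P X (lam κ) u τ y ≤
        ∫⁻ u in Ioo r τ, (ENNReal.ofReal ((τ - u) ^ (-1 + α / 2)) * ENNReal.ofReal (Real.exp (μ * (u - r))) *
          (ENNReal.ofReal (2 * Cq) * (ENNReal.ofReal G * A)) + ENNReal.ofReal ((τ - u) ^ (-1 + α / 2)) *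
            ∫⁻ w, ENNReal.ofReal (D.Γ (lam κ) u w τ y) * Δ u w) := by
      refine setLIntegral_mono' measurableSet_Ioo fun u hu => ?_
      refine (mul_le_mul_right (hlaw u τ hu.1 hu.2 hτ.2 y) _).trans (le_of_eq ?_)
      ring
    have h3 : Measurable fun u : ℝ => ENNReal.ofReal ((τ - u) ^ (-1 + α / 2)) *
        ENNReal.ofReal (Real.exp (μ * (u - r))) :=
      ((measurable_const.sub measurable_id).pow_const _).ennreal_ofReal.mul (by fun_prop)
    rw [lintegral_add_left (h3.mul_const _), lintegral_mul_const _ h3] at h1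
    refine (add_le_add_right (mul_le_mul_right h1 _) _).trans ?_
    rw [mul_add, ← add_assoc]
    refine add_le_add_left ?_ _
    have h4 := hw r τ
    have h5 : ENNReal.ofReal C * ((∫⁻ u in Ioo r τ, ENNReal.ofReal ((τ - u) ^ (-1 + α / 2)) *
        ENNReal.ofReal (Real.exp (μ * (u - r)))) * (ENNReal.ofReal (2 * Cq) * (ENNReal.ofReal G * A))) ≤
        2⁻¹ * Pi τ y := by
      rw [ENNReal.ofReal_mul hC.le] at h4
      calc _ = (ENNReal.ofReal C * ENNReal.ofReal G * (∫⁻ u in Ioo r τ, ENNReal.ofReal ((τ - u) ^ (-1 + α / 2)) *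
        ENNReal.ofReal (Real.exp (μ * (u - r))))) * (ENNReal.ofReal (2 * Cq) * A) := by ring
        _ ≤ 2⁻¹ * ENNReal.ofReal (Real.exp (μ * (τ - r))) * (ENNReal.ofReal (2 * Cq) * A) :=
          mul_le_mul_left h4 _
        _ = _ := by simp only [hPi]; ring
    have h6 : ENNReal.ofReal Cq * A ≤ 2⁻¹ * Pi τ y := by
      have h7 : (1 : ℝ≥0∞) ≤ ENNReal.ofReal (Real.exp (μ * (τ - r))) := by
        rw [← ENNReal.ofReal_one]
        exact ENNReal.ofReal_le_ofReal (Real.one_le_exp (mul_nonneg hμ.le (sub_nonneg.2 hτ.1.le)))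
      calc ENNReal.ofReal Cq * A ≤ ENNReal.ofReal Cq * A * ENNReal.ofReal (Real.exp (μ * (τ - r))) :=
            le_mul_of_one_le_right' h7
        _ = 2⁻¹ * 2 * (ENNReal.ofReal Cq * A * ENNReal.ofReal (Real.exp (μ * (τ - r)))) := by
            rw [ENNReal.inv_mul_cancel two_ne_zero ENNReal.ofNat_ne_top, one_mul]
        _ = _ := by
            simp only [hPi]
            rw [ENNReal.ofReal_mul zero_le_two, ENNReal.ofReal_ofNat]
            ring
    refine (add_le_add h6 h5).trans (le_of_eq ?_)
    rw [← add_mul, ENNReal.inv_two_add_inv_two, one_mul]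
  have hrec : ∀ τ ∈ Ioc r S, ∫⁻ y, Δ τ y ≤ ENNReal.ofReal (C * G) * ∫⁻ u in Ioo r τ,
      ENNReal.ofReal ((τ - u) ^ (-1 + α / 2)) * ∫⁻ y, Δ u y := by
    intro τ hτ
    refine (lintegral_mono (hΔle τ hτ)).trans ?_
    rw [lintegral_const_mul' _ _ ENNReal.ofReal_ne_top, ENNReal.ofReal_mul hC.le, mul_assoc]
    refine mul_le_mul_right ?_ _
    have hm1 : Measurable fun p : (Vec d × ℝ) × Vec d =>
        ENNReal.ofReal (D.Γ (lam κ) p.1.2 p.2 τ p.1.1) * Δ p.1.2 p.2 := by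
      have hΔm' : Measurable fun p : (Vec d × ℝ) × Vec d => Δ p.1.2 p.2 :=
        hΔm.comp (measurable_fst.snd.prodMk measurable_snd)
      exact (h.measurable_ofReal_Γ _ measurable_fst.snd measurable_snd measurable_const
        measurable_fst.fst).mul hΔm'
    have hp : Measurable fun p : Vec d × ℝ => ENNReal.ofReal ((τ - p.2) ^ (-1 + α / 2)) :=
      ((measurable_const.sub measurable_snd).pow_const _).ennreal_ofReal
    rw [lintegral_lintegral_swap (hp.mul hm1.lintegral_prod_right').aemeasurable,
      ← lintegral_const_mul' _ _ ENNReal.ofReal_ne_top]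
    refine setLIntegral_mono' measurableSet_Ioo fun u hu => ?_
    rw [lintegral_const_mul' _ _ ENNReal.ofReal_ne_top, mul_left_comm]
    refine mul_le_mul_right ?_ _
    have hm2 : Measurable fun p : Vec d × Vec d => ENNReal.ofReal (D.Γ (lam κ) u p.2 τ p.1) * Δ u p.2 :=
      hm1.comp (g := fun p : (Vec d × ℝ) × Vec d => _)
        (f := fun p : Vec d × Vec d => ((p.1, u), p.2))
        ((measurable_fst.prodMk measurable_const).prodMk measurable_snd)
    rw [lintegral_lintegral_swap hm2.aemeasurable, ← lintegral_const_mul' _ _ ENNReal.ofReal_ne_top]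
    refine lintegral_mono fun w => ?_
    have hm3 := h.measurable_ofReal_Γ (lam κ) (measurable_const (a := u)) (measurable_const (a := w))
      (measurable_const (a := τ)) (measurable_id (α := Vec d))
    simp only [id] at hm3
    rw [lintegral_mul_const _ hm3]
    exact mul_le_mul_left (h.lintegral_Γ_le hκ0 hl hu.2 w) _
  have hzero : ∀ τ ∈ Ioc r S, ∫⁻ y, Δ τ y = 0 :=
    singular_gronwall he (mul_pos hC hG0) ENNReal.one_ne_top (fun τ hτ =>
      (lintegral_mono fun y => tsub_le_self).trans (h.lintegral_hk_le hκ hα hP hsr hτ.1 hτ.2)) hrec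
  intro u τ hru huτ hτ y
  have hu0 : ∫⁻ w, Δ u w = 0 := hzero u ⟨hru, huτ.le.trans hτ⟩
  have hae := (lintegral_eq_zero_iff (hΔm.comp (measurable_prodMk_left (x := u)))).1 hu0
  have h0 : ∫⁻ w, ENNReal.ofReal (D.Γ (lam κ) u w τ y) * Δ u w = 0 := by
    refine (lintegral_congr_ae ?_).trans lintegral_zero
    filter_upwards [hae] with w hw
    have : Δ u w = 0 := hw
    rw [this, mul_zero]
  have h1 := hlaw u τ hru huτ hτ y
  rw [h0, add_zero] at h1
  refine (enorm_integral_H_le hC huτ (hCb' u τ hru huτ hτ) y).trans ?_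
  have h2 : ENNReal.ofReal (Real.exp (μ * (u - r))) ≤ ENNReal.ofReal (Real.exp (μ * T)) := by
    refine ENNReal.ofReal_le_ofReal (Real.exp_le_exp.2 (mul_le_mul_of_nonneg_left ?_ hμ.le))
    linarith [h.len]
  calc _ ≤ ENNReal.ofReal C * (ENNReal.ofReal ((τ - u) ^ (-1 + α / 2)) *
        (ENNReal.ofReal (2 * Cq) * ENNReal.ofReal (Real.exp (μ * T)) *
        (ENNReal.ofReal G * D.EΓ P X (lam κ) r τ y))) := by
        gcongr
        exact h1.trans (by gcongr)
    _ = _ := by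
        rw [ENNReal.ofReal_mul hC.le, ENNReal.ofReal_mul (p := 2 * Cq * Real.exp (μ * T)) (by positivity),
          ENNReal.ofReal_mul (p := 2 * Cq) (by positivity)]
        ring

end Coeffs

end

section

lemma lintegral_rpow_sub {e : ℝ} (he : 0 < e) {r τ : ℝ} (hr : r < τ) :
    ∫⁻ u in Ioo r τ, ENNReal.ofReal ((τ - u) ^ (-1 + e)) = ENNReal.ofReal ((τ - r) ^ e / e) := by
  have h1 : IntervalIntegrable (fun u : ℝ => (τ - u) ^ (-1 + e)) volume r τ := by
    have := (intervalIntegral.intervalIntegrable_rpow' (a := 0) (b := τ - r) (r := -1 + e)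
      (by linarith)).comp_sub_left τ
    simpa using this.symm
  have h2 : ∫ u in r..τ, (τ - u) ^ (-1 + e) = (τ - r) ^ e / e := by
    rw [intervalIntegral.integral_comp_sub_left (fun v : ℝ => v ^ (-1 + e)), sub_self,
      integral_rpow (Or.inl (by linarith))]
    rw [neg_add_cancel_comm, Real.zero_rpow he.ne', sub_zero]
  rw [← h2, intervalIntegral.integral_of_le hr.le, integral_Ioc_eq_integral_Ioo,
    ofReal_integral_eq_lintegral_ofReal]
  · rwa [intervalIntegrable_iff_integrableOn_Ioo_of_le hr.le] at h1
  · filter_upwards [ae_restrict_mem measurableSet_Ioo] with u hu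
    exact Real.rpow_nonneg (sub_nonneg.2 hu.2.le) _

namespace Coeffs

variable {d : ℕ} {D : Coeffs d} {κ α T s S : ℝ}

section flow

variable {Ω : Type} [MeasurableSpace Ω] {r : ℝ} {P : Measure Ω} {X : ℝ → Ω → Vec d}

lemma Γ_le_rpow {l : ℝ} (hl : 0 ≤ l) {u τ : ℝ} (hu : u < τ) (z y : Vec d) :
    D.Γ l u z τ y ≤ (τ - u) ^ (-(d : ℝ) / 2) := by
  have hδ : 0 < τ - u := sub_pos.2 hu
  unfold Γ gaussk
  refine mul_le_of_le_one_right (by positivity) (Real.exp_le_one_iff.2 ?_)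
  rw [neg_mul, neg_div]
  exact neg_nonpos.2 (by positivity)

lemma EΓ_le {l : ℝ} (hl : 0 ≤ l) {τ : ℝ} (hrτ : r < τ) (y : Vec d) :
    D.EΓ P X l r τ y ≤ ENNReal.ofReal ((τ - r) ^ (-(d : ℝ) / 2)) * P univ := by
  unfold EΓ
  rw [← lintegral_const]
  exact lintegral_mono fun ω => ENNReal.ofReal_le_ofReal (Γ_le_rpow hl hrτ _ _)

lemma EΓ_of_start [IsProbabilityMeasure P] {l : ℝ} {x : Vec d} (hx : ∀ᵐ ω ∂P, X r ω = x) (τ : ℝ) (y : Vec d) :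
    D.EΓ P X l r τ y = ENNReal.ofReal (D.Γ l r x τ y) := by
  unfold EΓ
  rw [lintegral_congr_ae (g := fun _ => ENNReal.ofReal (D.Γ l r x τ y)) (hx.mono fun ω h => by simp only [h])]
  simp

end flow

/-- The Duhamel correction is of lower order than the Gaussian average. -/
theorem exists_enorm_duhamel_le (d : ℕ) {κ α T : ℝ} (hκ : 1 ≤ κ) (hα : α ∈ Ioc (0 : ℝ) 1) (hT : 0 < T) :
    ∃ C : ℝ, 0 < C ∧ ∀ (D : Coeffs d) (s S : ℝ), D.Good κ α T s S → ∀ (Ω : Type) (_ : MeasurableSpace Ω)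
      (r : ℝ) (P : Measure Ω) (X : ℝ → Ω → Vec d), FPFlow D.b D.a r S P X → s ≤ r → ∀ τ : ℝ, r < τ →
      τ ≤ S → ∀ y : Vec d, ‖∫ u in r..τ, ∫ ω, D.H u (X u ω) τ y ∂P‖ₑ ≤
        ENNReal.ofReal C * (ENNReal.ofReal ((τ - r) ^ (α / 2)) * D.EΓ P X (lam κ) r τ y) := by
  obtain ⟨C, hC, hb⟩ := exists_enorm_integral_H_le d hκ hα hT
  have he : 0 < α / 2 := by linarith [hα.1]
  refine ⟨C / (α / 2), by positivity, fun D s S h Ω _ r P X hP hsr τ hrτ hτ y => ?_⟩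
  have hδ : 0 < τ - r := sub_pos.2 hrτ
  rw [intervalIntegral.integral_of_le hrτ.le, integral_Ioc_eq_integral_Ioo]
  refine (enorm_integral_le_lintegral_enorm _).trans ((setLIntegral_mono' measurableSet_Ioo fun u hu =>
      hb D s S h Ω _ r P X hP hsr u τ hu.1 hu.2 hτ y).trans (le_of_eq ?_))
  have hm : Measurable fun u : ℝ => ENNReal.ofReal ((τ - u) ^ (-1 + α / 2)) :=
    ((measurable_const.sub measurable_id).pow_const _).ennreal_ofReal
  rw [lintegral_const_mul' _ _ ENNReal.ofReal_ne_top, lintegral_mul_const _ hm, lintegral_rpow_sub he hrτ,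
    div_eq_mul_inv C, ENNReal.ofReal_mul hC.le, div_eq_mul_inv, ENNReal.ofReal_mul (by positivity)]
  ring

/-- Gaussian upper bound for the density. -/
theorem exists_hk_le (d : ℕ) {κ α T : ℝ} (hκ : 1 ≤ κ) (hα : α ∈ Ioc (0 : ℝ) 1) (hT : 0 < T) :
    ∃ C : ℝ, 0 < C ∧ ∀ (D : Coeffs d) (s S : ℝ), D.Good κ α T s S → ∀ (Ω : Type) (_ : MeasurableSpace Ω)
      (r : ℝ) (P : Measure Ω) (X : ℝ → Ω → Vec d), FPFlow D.b D.a r S P X → s ≤ r → ∀ τ : ℝ, r < τ →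
      τ ≤ S → ∀ y : Vec d, ENNReal.ofReal (D.hk P X r τ y) ≤ ENNReal.ofReal C * D.EΓ P X (lam κ) r τ y := by
  obtain ⟨C, hC, hb⟩ := exists_enorm_duhamel_le d hκ hα hT
  have hκ0 : 0 < κ := by linarith
  have he : 0 < α / 2 := by linarith [hα.1]
  refine ⟨κ ^ ((d : ℝ) / 2) + C * T ^ (α / 2), by positivity, fun D s S h Ω _ r P X hP hsr τ hrτ hτ y => ?_⟩
  have hδ : 0 < τ - r := sub_pos.2 hrτ
  rw [ENNReal.ofReal_add (by positivity) (by positivity), add_mul]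
  refine (ENNReal.ofReal_add_le).trans (add_le_add ?_ ?_)
  · rw [EΓ, ← lintegral_const_mul' _ _ ENNReal.ofReal_ne_top]
    refine (ENNReal.ofReal_le_ofReal (le_abs_self _)).trans ?_
    rw [← Real.enorm_eq_ofReal_abs]
    refine (enorm_integral_le_lintegral_enorm _).trans (lintegral_mono fun ω => ?_)
    rw [Real.enorm_eq_ofReal (D.q_nonneg _ _ _ _), ← ENNReal.ofReal_mul (by positivity)]
    exact ENNReal.ofReal_le_ofReal (h.q_le hκ0 hrτ _ _)
  · refine (ENNReal.ofReal_le_ofReal (le_abs_self _)).trans ?_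
    rw [← Real.enorm_eq_ofReal_abs]
    refine (hb D s S h Ω _ r P X hP hsr τ hrτ hτ y).trans ?_
    rw [ENNReal.ofReal_mul hC.le, mul_assoc]
    refine mul_le_mul_right (mul_le_mul_left (ENNReal.ofReal_le_ofReal ?_) _) _
    exact Real.rpow_le_rpow hδ.le (by linarith [h.len]) he.le

/-- Short-time lower bound for the density near the diagonal. -/
theorem exists_hk_ge (d : ℕ) {κ α T : ℝ} (hκ : 1 ≤ κ) (hα : α ∈ Ioc (0 : ℝ) 1) (hT : 0 < T) :
    ∃ δ c : ℝ, 0 < δ ∧ 0 < c ∧ ∀ (D : Coeffs d) (s S : ℝ), D.Good κ α T s S → ∀ (Ω : Type) (_ : MeasurableSpace Ω)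
      (r : ℝ) (P : Measure Ω) (X : ℝ → Ω → Vec d), FPFlow D.b D.a r S P X → s ≤ r → ∀ τ : ℝ, r < τ →
      τ ≤ S → τ - r ≤ δ → ∀ y : Vec d, (∀ᵐ ω ∂P, ‖D.E r (X r ω) - D.E τ y‖ ≤ 2 * Real.sqrt (τ - r)) →
        c * (τ - r) ^ (-(d : ℝ) / 2) * P.real univ ≤ D.hk P X r τ y := by
  obtain ⟨C, hC, hb⟩ := exists_enorm_duhamel_le d hκ hα hT
  have hκ0 : 0 < κ := by linarith
  have he : 0 < α / 2 := by linarith [hα.1]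
  set c : ℝ := (2 * Real.pi * κ) ^ (-(d : ℝ) / 2) * Real.exp (-(κ ^ 3 * 2 ^ 2 / 2)) with hc
  have hc0 : 0 < c := by have := Real.pi_pos; positivity
  refine ⟨(c / 2 / C) ^ (1 / (α / 2)), c / 2, by positivity, by positivity,
    fun D s S h Ω _ r P X hP hsr τ hrτ hτ hτδ y hy => ?_⟩
  have := hP.finite
  have hδ : 0 < τ - r := sub_pos.2 hrτ
  have h1 : c * (τ - r) ^ (-(d : ℝ) / 2) * P.real univ ≤ ∫ ω, D.q r (X r ω) τ y ∂P := by
    have hm : Measurable fun ω => D.q r (X r ω) τ y :=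
      h.measurable_q hα.1 measurable_const (hP.meas r) measurable_const measurable_const
    have hi : Integrable (fun ω => D.q r (X r ω) τ y) P := by
      refine Integrable.of_bound hm.aestronglyMeasurable (κ ^ ((d : ℝ) / 2) * (τ - r) ^ (-(d : ℝ) / 2))
        (Eventually.of_forall fun ω => ?_)
      rw [Real.norm_of_nonneg (D.q_nonneg _ _ _ _)]
      exact (h.q_le hκ0 hrτ _ _).trans (mul_le_mul_of_nonneg_left (Γ_le_rpow (lam_pos hκ0).le hrτ _ _)
        (by positivity))
    have h2 := integral_mono_ae (integrable_const (c * (τ - r) ^ (-(d : ℝ) / 2))) hi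
      (hy.mono fun ω hω => h.q_ge hκ0 hrτ hω)
    rwa [integral_const, smul_eq_mul, mul_comm] at h2
  have h2 : |∫ u in r..τ, ∫ ω, D.H u (X u ω) τ y ∂P| ≤
      C * ((τ - r) ^ (α / 2) * ((τ - r) ^ (-(d : ℝ) / 2) * P.real univ)) := by
    rw [← ENNReal.ofReal_le_ofReal_iff (by positivity), ← Real.enorm_eq_ofReal_abs,
      ENNReal.ofReal_mul hC.le, ENNReal.ofReal_mul (by positivity), ENNReal.ofReal_mul (by positivity),
      ofReal_measureReal]
    exact (hb D s S h Ω _ r P X hP hsr τ hrτ hτ y).trans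
      (mul_le_mul_right (mul_le_mul_right (EΓ_le (lam_pos hκ0).le hrτ y) _) _)
  have h3 : C * (τ - r) ^ (α / 2) ≤ c / 2 := by
    have h4 : (τ - r) ^ (α / 2) ≤ c / 2 / C := by
      have := Real.rpow_le_rpow hδ.le hτδ he.le
      rwa [← Real.rpow_mul (by positivity), one_div_mul_cancel he.ne', Real.rpow_one] at this
    rw [mul_comm]
    exact (le_div_iff₀ hC).1 h4
  have h5 : C * ((τ - r) ^ (α / 2) * ((τ - r) ^ (-(d : ℝ) / 2) * P.real univ)) ≤
      c / 2 * ((τ - r) ^ (-(d : ℝ) / 2) * P.real univ) := by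
    rw [← mul_assoc]
    exact mul_le_mul_of_nonneg_right h3 (by positivity)
  have h6 := (abs_le.1 h2).1
  unfold hk
  linarith

end Coeffs

end

section

namespace Coeffs

variable {d : ℕ} {D : Coeffs d} {κ α T s S : ℝ}

/-- The measures obtained from `P` by conditioning on the position at a given time solve the
Fokker–Planck equation afterwards. -/
def MarkovFlow (D : Coeffs d) (s S : ℝ) {Ω : Type} [MeasurableSpace Ω] (P : Measure Ω)
    (X : ℝ → Ω → Vec d) : Prop :=
  ∀ r ∈ Icc s S, ∀ B : Set (Vec d), MeasurableSet B → FPFlow D.b D.a r S (P.restrict (X r ⁻¹' B)) X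

lemma Good.le_volume_preimage (h : D.Good κ α T s S) (hκ : 0 < κ) (τ : ℝ) (w : Vec d) {ε : ℝ} (hε : 0 ≤ ε) :
    ENNReal.ofReal ((ε / κ) ^ d) * volume (Metric.ball (0 : Vec d) 1) ≤ volume {z | ‖D.E τ z - w‖ ≤ ε} := by
  have h1 := Measure.addHaar_closedBall (volume : Measure (Vec d)) (D.F τ w) (r := ε / κ) (by positivity)
  rw [finrank_euclideanSpace_fin] at h1
  rw [← h1]
  refine measure_mono fun z hz => ?_
  have h2 := h.E_lip τ z (D.F τ w)
  rw [h.EF] at h2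
  rw [mem_closedBall_iff_norm, le_div_iff₀ hκ] at hz
  exact h2.trans (by linarith)

lemma Good.measurableSet_tube (h : D.Good κ α T s S) (τ : ℝ) (w : Vec d) (ε : ℝ) :
    MeasurableSet {z | ‖D.E τ z - w‖ ≤ ε} := by
  have hc : Continuous (D.E τ) := h.E_cont.comp (Continuous.prodMk_right τ)
  exact measurableSet_le (hc.sub continuous_const).norm.measurable measurable_const

/-- One step of the chain of balls joining two points. -/
theorem exists_chain_step (d : ℕ) {κ α T : ℝ} (hκ : 1 ≤ κ) (hα : α ∈ Ioc (0 : ℝ) 1) (hT : 0 < T) :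
    ∃ δ c : ℝ, 0 < δ ∧ c ∈ Ioc (0 : ℝ) 1 ∧ ∀ (D : Coeffs d) (s S : ℝ), D.Good κ α T s S →
      ∀ (Ω : Type) (_ : MeasurableSpace Ω) (P : Measure Ω) (X : ℝ → Ω → Vec d), D.MarkovFlow s S P X →
      ∀ r τ : ℝ, s ≤ r → r < τ → τ ≤ S → τ - r ≤ δ → ∀ w w' : Vec d,
        ‖w - w'‖ ≤ Real.sqrt (τ - r) / 2 →
        c * P.real (X r ⁻¹' {z | ‖D.E r z - w‖ ≤ Real.sqrt (τ - r) / 2}) ≤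
          P.real (X τ ⁻¹' {z | ‖D.E τ z - w'‖ ≤ Real.sqrt (τ - r) / 2}) ∧
        ∀ y, ‖D.E τ y - w'‖ < Real.sqrt (τ - r) / 2 →
          c * (τ - r) ^ (-(d : ℝ) / 2) * P.real (X r ⁻¹' {z | ‖D.E r z - w‖ ≤ Real.sqrt (τ - r) / 2}) ≤
            D.hk (P.restrict (X r ⁻¹' {z | ‖D.E r z - w‖ ≤ Real.sqrt (τ - r) / 2})) X r τ y := by
  obtain ⟨δ, c, hδ, hc, hb⟩ := exists_hk_ge d hκ hα hT
  have hκ0 : 0 < κ := by linarith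
  set V : ℝ := (volume : Measure (Vec d)).real (Metric.ball (0 : Vec d) 1) with hV
  have hV0 : 0 < V := ENNReal.toReal_pos (Metric.measure_ball_pos _ _ one_pos).ne' measure_ball_lt_top.ne
  have hVe : volume (Metric.ball (0 : Vec d) 1) = ENNReal.ofReal V := (ofReal_measureReal measure_ball_lt_top.ne).symm
  set c' : ℝ := min 1 (min c (c * (2 * κ)⁻¹ ^ d * V)) with hc'
  have hc'0 : 0 < c' := lt_min one_pos (lt_min hc (by positivity))
  refine ⟨δ, c', hδ, ⟨hc'0, min_le_left _ _⟩, fun D s S h Ω _ P X hM r τ hsr hrτ hτ hτδ w w' hw => ?_⟩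
  have hη : 0 < τ - r := sub_pos.2 hrτ
  set B := {z | ‖D.E r z - w‖ ≤ Real.sqrt (τ - r) / 2} with hB
  set B' := {z | ‖D.E τ z - w'‖ ≤ Real.sqrt (τ - r) / 2} with hB'
  have hBm : MeasurableSet B := h.measurableSet_tube r w _
  have hBm' : MeasurableSet B' := h.measurableSet_tube τ w' _
  have hP := hM r ⟨hsr, (hrτ.le.trans hτ)⟩ B hBm
  have hPu := hM s ⟨le_rfl, h.le⟩ univ MeasurableSet.univ
  rw [preimage_univ, Measure.restrict_univ] at hPu
  have := hPu.finite
  set P' := P.restrict (X r ⁻¹' B) with hP'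
  have hm : P'.real univ = P.real (X r ⁻¹' B) := by
    rw [hP', measureReal_restrict_apply MeasurableSet.univ, univ_inter]
  have key : ∀ y ∈ B', c * (τ - r) ^ (-(d : ℝ) / 2) * P.real (X r ⁻¹' B) ≤ D.hk P' X r τ y := by
    intro y hy
    rw [← hm]
    refine hb D s S h Ω _ r P' X hP hsr τ hrτ hτ hτδ y ?_
    filter_upwards [ae_restrict_mem (hP.meas r hBm)] with ω hω
    have h1 : ‖D.E r (X r ω) - w‖ ≤ Real.sqrt (τ - r) / 2 := hω
    have h2 : ‖D.E τ y - w'‖ ≤ Real.sqrt (τ - r) / 2 := hy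
    calc ‖D.E r (X r ω) - D.E τ y‖ = ‖(D.E r (X r ω) - w) + (w - w') - (D.E τ y - w')‖ := by congr 1; abel
      _ ≤ ‖D.E r (X r ω) - w‖ + ‖w - w'‖ + ‖D.E τ y - w'‖ := (norm_sub_le _ _).trans (by gcongr; exact norm_add_le _ _)
      _ ≤ _ := by linarith [Real.sqrt_nonneg (τ - r)]
  refine ⟨?_, fun y hy => ?_⟩
  · have h1 : ENNReal.ofReal (c' * P.real (X r ⁻¹' B)) ≤ P (X τ ⁻¹' B') := by
      have h2 := (h.law_eq hκ hα hP hsr hrτ hτ).2.2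
      calc ENNReal.ofReal (c' * P.real (X r ⁻¹' B))
          ≤ ENNReal.ofReal (c * (τ - r) ^ (-(d : ℝ) / 2) * P.real (X r ⁻¹' B)) *
            (ENNReal.ofReal ((Real.sqrt (τ - r) / 2 / κ) ^ d) * volume (Metric.ball (0 : Vec d) 1)) := by
            rw [hVe, ← ENNReal.ofReal_mul (by positivity), ← ENNReal.ofReal_mul (by positivity)]
            refine ENNReal.ofReal_le_ofReal ?_
            have h3 : Real.sqrt (τ - r) ^ d = (τ - r) ^ ((d : ℝ) / 2) := by
              rw [Real.sqrt_eq_rpow, ← Real.rpow_natCast, ← Real.rpow_mul hη.le]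
              congr 1
              ring
            have h4 : (τ - r) ^ (-(d : ℝ) / 2) * (τ - r) ^ ((d : ℝ) / 2) = 1 := by
              rw [← Real.rpow_add hη, neg_div, neg_add_cancel, Real.rpow_zero]
            have h5 : (Real.sqrt (τ - r) / 2 / κ) ^ d = (τ - r) ^ ((d : ℝ) / 2) * (2 * κ)⁻¹ ^ d := by
              rw [div_div, div_eq_mul_inv, mul_pow, h3]
            rw [h5]
            calc c' * P.real (X r ⁻¹' B) ≤ (c * (2 * κ)⁻¹ ^ d * V) * P.real (X r ⁻¹' B) :=
                  mul_le_mul_of_nonneg_right ((min_le_right _ _).trans (min_le_right _ _)) measureReal_nonneg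
              _ = ((τ - r) ^ (-(d : ℝ) / 2) * (τ - r) ^ ((d : ℝ) / 2)) *
                  (c * (2 * κ)⁻¹ ^ d * V * P.real (X r ⁻¹' B)) := by rw [h4, one_mul]
              _ = _ := by ring
        _ ≤ ENNReal.ofReal (c * (τ - r) ^ (-(d : ℝ) / 2) * P.real (X r ⁻¹' B)) * volume B' :=
            mul_le_mul_right (h.le_volume_preimage hκ0 τ w' (by positivity)) _
        _ = ∫⁻ y in B', ENNReal.ofReal (c * (τ - r) ^ (-(d : ℝ) / 2) * P.real (X r ⁻¹' B)) := by
            rw [setLIntegral_const]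
        _ ≤ ∫⁻ y in B', ENNReal.ofReal (D.hk P' X r τ y) :=
            setLIntegral_mono' hBm' fun y hy => ENNReal.ofReal_le_ofReal (key y hy)
        _ = P' (X τ ⁻¹' B') := by
            rw [← Measure.map_apply (hP.meas τ) hBm', h2, withDensity_apply _ hBm']
        _ ≤ P (X τ ⁻¹' B') := Measure.restrict_apply_le _ _
    exact (ENNReal.ofReal_le_iff_le_toReal (measure_ne_top _ _)).1 h1
  · refine le_trans ?_ (key y (le_of_lt hy))
    have : c' ≤ c := (min_le_right _ _).trans (min_le_left _ _)
    gcongr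

/-- Gaussian lower bound for the density. -/
theorem exists_le_hk (d : ℕ) {κ α T : ℝ} (hκ : 1 ≤ κ) (hα : α ∈ Ioc (0 : ℝ) 1) (hT : 0 < T) :
    ∃ c L : ℝ, 0 < c ∧ 0 < L ∧ ∀ (D : Coeffs d) (s S : ℝ), D.Good κ α T s S → s < S →
      ∀ (Ω : Type) (_ : MeasurableSpace Ω) (P : Measure Ω) (X : ℝ → Ω → Vec d), D.MarkovFlow s S P X →
      IsProbabilityMeasure P → ∀ x, (∀ᵐ ω ∂P, X s ω = x) → Continuous (D.hk P X s S) → ∀ y,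
        c * gaussk d L (S - s) (D.E s x - D.E S y) ≤ D.hk P X s S y := by
  obtain ⟨δ, c, hδ, hc, hb⟩ := exists_chain_step d hκ hα hT
  set ℓ : ℝ := 1 - Real.log c with hℓ
  have hℓ0 : 0 < ℓ := by linarith [Real.log_nonpos hc.1.le hc.2]
  have hcℓ : ∀ A : ℝ, 0 ≤ A → ∀ n : ℕ, (n : ℝ) ≤ A → Real.exp (-(ℓ * A)) ≤ c ^ n := by
    intro A hA n hn
    rw [← Real.exp_log (pow_pos hc.1 n), Real.log_pow]
    refine Real.exp_le_exp.2 ?_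
    have h1 := Real.log_nonpos hc.1.le hc.2
    nlinarith
  refine ⟨Real.exp (-(ℓ * (2 + T / δ))), ℓ * 4, Real.exp_pos _, by positivity,
    fun D s S h hsS Ω _ P X hM hPp x hx hcont y => ?_⟩
  have hPu := hM s ⟨le_rfl, h.le⟩ univ MeasurableSet.univ
  rw [preimage_univ, Measure.restrict_univ] at hPu
  set A : ℝ := 4 * ‖D.E s x - D.E S y‖ ^ 2 / (S - s) with hA
  have hΔ : 0 < S - s := sub_pos.2 hsS
  have hA0 : 0 ≤ A := by positivity
  set n : ℕ := ⌈A + T / δ⌉₊ with hn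
  have hnA : A + T / δ ≤ n := Nat.le_ceil _
  have hn' : (n : ℝ) ≤ A + T / δ + 1 := (Nat.ceil_lt_add_one (by positivity)).le
  set N : ℝ := n + 1 with hN
  have hN0 : 0 < N := by positivity
  set η : ℝ := (S - s) / N with hη
  have hη0 : 0 < η := by positivity
  have hηδ : η ≤ δ := by
    rw [hη, div_le_iff₀ hN0]
    have : T / δ ≤ N := by linarith
    rw [div_le_iff₀ hδ] at this
    linarith [h.len]
  set w : ℕ → Vec d := fun k => D.E s x + ((k : ℝ) / N) • (D.E S y - D.E s x) with hw
  have hww : ∀ k, ‖w k - w (k + 1)‖ ≤ Real.sqrt η / 2 := by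
    intro k
    have h1 : w k - w (k + 1) = N⁻¹ • (D.E s x - D.E S y) := by
      simp only [hw]
      push_cast
      rw [add_div, add_smul, ← neg_sub (D.E s x) (D.E S y), one_div]
      simp only [smul_neg]
      abel
    rw [h1, norm_smul, Real.norm_of_nonneg (by positivity)]
    refine abs_le_of_sq_le_sq' ?_ (by positivity) |>.2
    rw [div_pow, Real.sq_sqrt hη0.le, mul_pow, hη]
    have h2 : A ≤ N := by have : 0 ≤ T / δ := by positivity
                          linarith
    rw [hA, div_le_iff₀ hΔ] at h2
    rw [inv_pow, inv_mul_le_iff₀ (by positivity)]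
    have : N ^ 2 * ((S - s) / N / 2 ^ 2) = N * (S - s) / 4 := by field_simp; norm_num
    rw [this]
    linarith
  set ρ : ℕ → ℝ := fun k => s + k * η with hρ
  have hρ1 : ∀ k, ρ (k + 1) - ρ k = η := fun k => by simp only [hρ]; push_cast; ring
  have hρN : ρ (n + 1) = S := by simp only [hρ, hη]; push_cast; rw [← hN]; field_simp; ring
  have hρs : ∀ k, s ≤ ρ k := fun k => by simp only [hρ]; linarith [mul_nonneg k.cast_nonneg hη0.le]
  have hρS : ∀ k, k ≤ n + 1 → ρ k ≤ S := fun k hk => by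
    rw [← hρN]
    simp only [hρ]
    gcongr
  have hstep : ∀ k, k ≤ n → _ := fun k hk =>
    hb D s S h Ω _ P X hM (ρ k) (ρ (k + 1)) (hρs k) (by linarith [hρ1 k]) (hρS _ (by omega))
      (by rw [hρ1]; exact hηδ) (w k) (w (k + 1)) (by rw [hρ1]; exact hww k)
  simp only [hρ1] at hstep
  have hchain : ∀ k, k ≤ n → c ^ k ≤ P.real (X (ρ k) ⁻¹' {z | ‖D.E (ρ k) z - w k‖ ≤ Real.sqrt η / 2}) := by
    intro k
    induction k with
    | zero =>
      intro _
      have h0 : ρ 0 = s := by simp [hρ]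
      have h1 : w 0 = D.E s x := by simp [hw]
      rw [h0, h1, pow_zero]
      refine (probReal_univ (μ := P)).symm.le.trans (le_of_eq ?_)
      refine measureReal_congr (eventuallyEq_univ.2 ?_).symm
      filter_upwards [hx] with ω hω
      show ‖D.E s (X s ω) - D.E s x‖ ≤ Real.sqrt η / 2
      rw [hω, sub_self, norm_zero]
      positivity
    | succ k ih =>
      intro hk
      rw [pow_succ, mul_comm]
      exact (mul_le_mul_of_nonneg_left (ih (by omega)) hc.1.le).trans (hstep k (by omega)).1
  have hlast := (hstep n le_rfl).2
  set B := X (ρ n) ⁻¹' {z | ‖D.E (ρ n) z - w n‖ ≤ Real.sqrt η / 2} with hB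
  have hwN : w (n + 1) = D.E S y := by
    simp only [hw]
    push_cast
    rw [← hN, div_self hN0.ne', one_smul, add_sub_cancel]
  rw [hρN, hwN] at hlast
  have hρnS : ρ n < S := by rw [← hρN]; linarith [hρ1 n]
  have hP' := hM (ρ n) ⟨hρs n, hρnS.le⟩ _ (h.measurableSet_tube (ρ n) (w n) (Real.sqrt η / 2))
  obtain ⟨hi', -, hl'⟩ := h.law_eq hκ hα hP' (hρs n) hρnS le_rfl
  obtain ⟨hi, -, hl⟩ := h.law_eq hκ hα hPu le_rfl hsS le_rfl
  have hcmp : (fun y => ENNReal.ofReal (D.hk (P.restrict B) X (ρ n) S y)) ≤ᵐ[volume]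
      fun y => ENNReal.ofReal (D.hk P X s S y) := by
    refine ae_le_of_forall_setLIntegral_le_of_sigmaFinite₀ hi'.1.aemeasurable.ennreal_ofReal fun A hAm _ => ?_
    rw [← withDensity_apply _ hAm, ← withDensity_apply _ hAm, ← hl, ← hl', Measure.map_apply (hPu.meas S) hAm,
      Measure.map_apply (hPu.meas S) hAm]
    exact Measure.restrict_apply_le _ _
  set m : ℝ := c * η ^ (-(d : ℝ) / 2) * P.real B with hm
  have hPB : c ^ n ≤ P.real B := hchain n le_rfl
  have hm0 : 0 < m := mul_pos (mul_pos hc.1 (by positivity)) ((pow_pos hc.1 n).trans_le hPB)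
  have hEc : Continuous (D.E S) := h.E_cont.comp (Continuous.prodMk_right S)
  have hmy : m ≤ D.hk P X s S y := by
    by_contra! hlt
    have hU : IsOpen ({z | ‖D.E S z - D.E S y‖ < Real.sqrt η / 2} ∩ {z | D.hk P X s S z < m}) :=
      (isOpen_lt (hEc.sub continuous_const).norm continuous_const).inter (isOpen_lt hcont continuous_const)
    have hne : ({z | ‖D.E S z - D.E S y‖ < Real.sqrt η / 2} ∩ {z | D.hk P X s S z < m}).Nonempty :=
      ⟨y, by
        show ‖D.E S y - D.E S y‖ < Real.sqrt η / 2
        rw [sub_self, norm_zero]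
        positivity, hlt⟩
    refine (hU.measure_pos volume hne).ne' (measure_mono_null ?_ (ae_iff.1 hcmp))
    intro z hz
    refine not_le.2 ((ENNReal.ofReal_lt_ofReal_iff hm0).2 hz.2 |>.trans_le ?_)
    exact ENNReal.ofReal_le_ofReal (hlast z hz.1)
  refine le_trans ?_ hmy
  have hηS : η ≤ S - s := div_le_self hΔ.le (by rw [hN]; linarith [n.cast_nonneg (α := ℝ)])
  have h1 : (S - s) ^ (-(d : ℝ) / 2) ≤ η ^ (-(d : ℝ) / 2) := by
    refine Real.rpow_le_rpow_of_nonpos hη0 hηS ?_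
    rw [neg_div]
    exact neg_nonpos.2 (by positivity)
  have h2 : Real.exp (-(ℓ * (2 + T / δ + A))) ≤ c ^ (n + 1) :=
    hcℓ _ (by positivity) (n + 1) (by push_cast; linarith)
  calc Real.exp (-(ℓ * (2 + T / δ))) * gaussk d (ℓ * 4) (S - s) (D.E s x - D.E S y)
      = (S - s) ^ (-(d : ℝ) / 2) * Real.exp (-(ℓ * (2 + T / δ + A))) := by
        unfold gaussk
        rw [mul_left_comm, ← Real.exp_add, hA]
        congr 2
        ring
    _ ≤ η ^ (-(d : ℝ) / 2) * c ^ (n + 1) := by gcongr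
    _ = c * η ^ (-(d : ℝ) / 2) * c ^ n := by ring
    _ ≤ m := mul_le_mul_of_nonneg_left hPB (mul_nonneg hc.1.le (by positivity))

end Coeffs

end

section

namespace Coeffs

variable {d : ℕ} {D : Coeffs d} {κ α T s S : ℝ}

/-- Uniform bound for the time-`u` term in Duhamel's formula. -/
theorem exists_abs_integral_H_le (d : ℕ) {κ α T : ℝ} (hκ : 1 ≤ κ) (hα : α ∈ Ioc (0 : ℝ) 1) (hT : 0 < T) :
    ∃ C : ℝ, 0 < C ∧ ∀ (D : Coeffs d) (s S : ℝ), D.Good κ α T s S → ∀ (Ω : Type) (_ : MeasurableSpace Ω)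
      (r : ℝ) (P : Measure Ω) (X : ℝ → Ω → Vec d), FPFlow D.b D.a r S P X → s ≤ r → ∀ u τ : ℝ, r < u → u < τ →
      τ ≤ S → ∀ y : Vec d, |∫ ω, D.H u (X u ω) τ y ∂P| ≤
        C * ((τ - u) ^ (-1 + α / 2) * (τ - r) ^ (-(d : ℝ) / 2)) := by
  obtain ⟨C, hC, hb⟩ := exists_enorm_integral_H_le d hκ hα hT
  refine ⟨C, hC, fun D s S h Ω _ r P X hP hsr u τ hru huτ hτ y => ?_⟩
  have h1 : 0 < τ - u := sub_pos.2 huτ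
  have h2 : 0 < τ - r := by linarith
  rw [← ENNReal.ofReal_le_ofReal_iff (by positivity), ← Real.enorm_eq_ofReal_abs,
    ENNReal.ofReal_mul hC.le, ENNReal.ofReal_mul (by positivity)]
  refine (hb D s S h Ω _ r P X hP hsr u τ hru huτ hτ y).trans
    (mul_le_mul_right (mul_le_mul_right ((EΓ_le (lam_pos (by linarith)).le (by linarith) y).trans ?_) _) _)
  exact mul_le_of_le_one_right' hP.mass

lemma intervalIntegrable_rpow_sub {e : ℝ} (he : 0 < e) (r τ : ℝ) :
    IntervalIntegrable (fun u : ℝ => (τ - u) ^ (-1 + e)) volume r τ := by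
  have := (intervalIntegral.intervalIntegrable_rpow' (a := 0) (b := τ - r) (r := -1 + e)
    (by linarith)).comp_sub_left τ
  simpa using this.symm

section flow

variable {Ω : Type} [MeasurableSpace Ω] {r : ℝ} {P P' : Measure Ω} {X X' : ℝ → Ω → Vec d}

lemma Good.measurable_J_time (h : D.Good κ α T s S) (hα : 0 < α) (hP : FPFlow D.b D.a r S P X) (τ : ℝ) (y : Vec d) :
    Measurable fun u => ∫ ω, D.H u (X u ω) τ y ∂P := by
  have := hP.finite
  have h1 : Measurable fun p : ℝ × Ω => D.H p.1 (X p.1 p.2) τ y :=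
    h.measurable_H hα measurable_fst hP.joint_meas measurable_const measurable_const
  exact h1.stronglyMeasurable.integral_prod_right'.measurable

lemma Good.intervalIntegrable_J (h : D.Good κ α T s S) (hκ : 1 ≤ κ) (hα : α ∈ Ioc (0 : ℝ) 1) (hT : 0 < T)
    (hP : FPFlow D.b D.a r S P X) (hsr : s ≤ r) {τ : ℝ} (hrτ : r < τ) (hτ : τ ≤ S) (y : Vec d) :
    IntervalIntegrable (fun u => ∫ ω, D.H u (X u ω) τ y ∂P) volume r τ := by
  obtain ⟨C, hC, hb⟩ := exists_abs_integral_H_le d hκ hα hT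
  have h1 : IntervalIntegrable (fun u : ℝ => C * ((τ - u) ^ (-1 + α / 2) * (τ - r) ^ (-(d : ℝ) / 2))) volume r τ :=
    ((intervalIntegrable_rpow_sub (half_pos hα.1) r τ).mul_const _).const_mul _
  rw [intervalIntegrable_iff_integrableOn_Ioo_of_le hrτ.le] at h1 ⊢
  refine h1.mono' (h.measurable_J_time hα.1 hP τ y).aestronglyMeasurable ?_
  filter_upwards [ae_restrict_mem measurableSet_Ioo] with u hu
  exact hb D s S h Ω _ r P X hP hsr u τ hu.1 hu.2 hτ y

lemma Good.integral_law (h : D.Good κ α T s S) (hκ : 1 ≤ κ) (hα : α ∈ Ioc (0 : ℝ) 1)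
    (hP : FPFlow D.b D.a r S P X) (hsr : s ≤ r) {u : ℝ} (hru : r < u) (hu : u ≤ S) {g : Vec d → ℝ}
    (hg : Measurable g) : ∫ ω, g (X u ω) ∂P = ∫ w, D.hk P X r u w * g w := by
  obtain ⟨h1, h2, h3⟩ := h.law_eq hκ hα hP hsr hru hu
  rw [← integral_map (hP.meas u).aemeasurable hg.aestronglyMeasurable, h3,
    integral_withDensity_eq_integral_toReal_smul₀ h1.1.aemeasurable.ennreal_ofReal
      (Eventually.of_forall fun _ => ENNReal.ofReal_lt_top)]
  refine integral_congr_ae (h2.mono fun y hy => ?_)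
  simp only [ENNReal.toReal_ofReal hy, smul_eq_mul]

/-- The `L¹` distance between the densities of two solutions. -/
def dist₁ (D : Coeffs d) (r : ℝ) {Ω : Type} [MeasurableSpace Ω] (P P' : Measure Ω) (X : ℝ → Ω → Vec d)
    (u : ℝ) : ℝ≥0∞ :=
  ∫⁻ w, ‖D.hk P X r u w - D.hk P' X r u w‖ₑ

lemma Good.measurable_hk_sub (h : D.Good κ α T s S) (hα : 0 < α) (hP : FPFlow D.b D.a r S P X)
    (hP' : FPFlow D.b D.a r S P' X) :
    Measurable fun p : ℝ × Vec d => ‖D.hk P X r p.1 p.2 - D.hk P' X r p.1 p.2‖ₑ :=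
  ((h.measurable_hk hα hP).sub (h.measurable_hk hα hP')).enorm

lemma Good.measurable_dist₁ (h : D.Good κ α T s S) (hα : 0 < α) (hP : FPFlow D.b D.a r S P X)
    (hP' : FPFlow D.b D.a r S P' X) : Measurable (D.dist₁ r P P' X) :=
  (h.measurable_hk_sub hα hP hP').lintegral_prod_right'

lemma Good.dist₁_le (h : D.Good κ α T s S) (hκ : 1 ≤ κ) (hα : α ∈ Ioc (0 : ℝ) 1)
    (hP : FPFlow D.b D.a r S P X) (hP' : FPFlow D.b D.a r S P' X) (hsr : s ≤ r) {u : ℝ} (hru : r < u)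
    (hu : u ≤ S) : D.dist₁ r P P' X u ≤ 2 := by
  have key : ∀ P : Measure Ω, FPFlow D.b D.a r S P X → ∫⁻ w, ‖D.hk P X r u w‖ₑ ≤ 1 := fun P hP => by
    refine le_trans (le_of_eq ?_) (h.lintegral_hk_le hκ hα hP hsr hru hu)
    exact lintegral_congr_ae ((h.law_eq hκ hα hP hsr hru hu).2.1.mono fun w hw => Real.enorm_eq_ofReal hw)
  have hm : Measurable fun w => ‖D.hk P X r u w‖ₑ :=
    ((h.measurable_hk hα.1 hP).comp (measurable_const (a := u) |>.prodMk measurable_id)).enorm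
  calc D.dist₁ r P P' X u ≤ ∫⁻ w, (‖D.hk P X r u w‖ₑ + ‖D.hk P' X r u w‖ₑ) :=
        lintegral_mono fun w => enorm_sub_le
    _ ≤ 1 + 1 := by
        rw [lintegral_add_left hm]
        exact add_le_add (key P hP) (key P' hP')
    _ = 2 := one_add_one_eq_two

lemma Good.enorm_integral_sub_le (h : D.Good κ α T s S) (hκ : 1 ≤ κ) (hα : α ∈ Ioc (0 : ℝ) 1)
    (hP : FPFlow D.b D.a r S P X) (hP' : FPFlow D.b D.a r S P' X) (hsr : s ≤ r) {u : ℝ} (hru : r < u)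
    (hu : u ≤ S) {g : Vec d → ℝ} (hg : Measurable g) {K : ℝ} (hK : ∀ w, |g w| ≤ K) :
    ‖∫ ω, g (X u ω) ∂P - ∫ ω, g (X u ω) ∂P'‖ₑ ≤
      ∫⁻ w, ‖D.hk P X r u w - D.hk P' X r u w‖ₑ * ‖g w‖ₑ := by
  rw [h.integral_law hκ hα hP hsr hru hu hg, h.integral_law hκ hα hP' hsr hru hu hg, ← integral_sub]
  · refine (enorm_integral_le_lintegral_enorm _).trans (le_of_eq (lintegral_congr fun w => ?_))
    rw [← sub_mul, enorm_mul]
  · exact (h.law_eq hκ hα hP hsr hru hu).1.mul_bdd hg.aestronglyMeasurable (Eventually.of_forall hK)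
  · exact (h.law_eq hκ hα hP' hsr hru hu).1.mul_bdd hg.aestronglyMeasurable (Eventually.of_forall hK)

end flow

/-- Integrating the terminal point of a Gaussian-weighted space-time integral. -/
lemma Good.lintegral_lintegral_Γ_mul_le (h : D.Good κ α T s S) (hκ : 0 < κ) {l : ℝ} (hl : 0 < l)
    {f : ℝ → Vec d → ℝ≥0∞} (hf : Measurable fun p : ℝ × Vec d => f p.1 p.2) (r τ e : ℝ) :
    ∫⁻ y, ∫⁻ u in Ioo r τ, ENNReal.ofReal ((τ - u) ^ e) * ∫⁻ w, ENNReal.ofReal (D.Γ l u w τ y) * f u w ≤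
      ENNReal.ofReal (κ ^ d * (Real.pi / l) ^ ((d : ℝ) / 2)) *
        ∫⁻ u in Ioo r τ, ENNReal.ofReal ((τ - u) ^ e) * ∫⁻ w, f u w := by
  have hm1 : Measurable fun p : (Vec d × ℝ) × Vec d =>
      ENNReal.ofReal (D.Γ l p.1.2 p.2 τ p.1.1) * f p.1.2 p.2 :=
    (h.measurable_ofReal_Γ _ measurable_fst.snd measurable_snd measurable_const
      measurable_fst.fst).mul (hf.comp (g := fun p : ℝ × Vec d => f p.1 p.2)
        (f := fun p : (Vec d × ℝ) × Vec d => (p.1.2, p.2)) (measurable_fst.snd.prodMk measurable_snd))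
  have hp : Measurable fun p : Vec d × ℝ => ENNReal.ofReal ((τ - p.2) ^ e) :=
    ((measurable_const.sub measurable_snd).pow_const _).ennreal_ofReal
  rw [lintegral_lintegral_swap (hp.mul hm1.lintegral_prod_right').aemeasurable,
    ← lintegral_const_mul' _ _ ENNReal.ofReal_ne_top]
  refine setLIntegral_mono' measurableSet_Ioo fun u hu => ?_
  rw [lintegral_const_mul' _ _ ENNReal.ofReal_ne_top, mul_left_comm]
  refine mul_le_mul_right ?_ _
  have hm2 : Measurable fun p : Vec d × Vec d => ENNReal.ofReal (D.Γ l u p.2 τ p.1) * f u p.2 :=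
    hm1.comp (g := fun p : (Vec d × ℝ) × Vec d =>
        ENNReal.ofReal (D.Γ l p.1.2 p.2 τ p.1.1) * f p.1.2 p.2)
      (f := fun p : Vec d × Vec d => ((p.1, u), p.2))
      ((measurable_fst.prodMk measurable_const).prodMk measurable_snd)
  rw [lintegral_lintegral_swap hm2.aemeasurable, ← lintegral_const_mul' _ _ ENNReal.ofReal_ne_top]
  refine lintegral_mono fun w => ?_
  have hm3 := h.measurable_ofReal_Γ l (measurable_const (a := u)) (measurable_const (a := w))
    (measurable_const (a := τ)) (measurable_id (α := Vec d))
  simp only [id] at hm3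
  rw [lintegral_mul_const _ hm3]
  exact mul_le_mul_left (h.lintegral_Γ_le hκ hl hu.2 w) _

set_option maxHeartbeats 1000000 in
/-- Integral inequality for the `L¹` distance between two solutions. -/
theorem exists_dist₁_le (d : ℕ) {κ α T : ℝ} (hκ : 1 ≤ κ) (hα : α ∈ Ioc (0 : ℝ) 1) (hT : 0 < T) :
    ∃ C : ℝ, 0 < C ∧ ∀ (D : Coeffs d) (s S : ℝ), D.Good κ α T s S → ∀ (Ω : Type) (_ : MeasurableSpace Ω)
      (r : ℝ) (P P' : Measure Ω) (X : ℝ → Ω → Vec d), FPFlow D.b D.a r S P X → FPFlow D.b D.a r S P' X →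
      s ≤ r → ∀ τ ∈ Ioc r S, D.dist₁ r P P' X τ ≤
        (∫⁻ w, ‖∫ ω, D.q r (X r ω) τ w ∂P - ∫ ω, D.q r (X r ω) τ w ∂P'‖ₑ) +
        ENNReal.ofReal C * ∫⁻ u in Ioo r τ, ENNReal.ofReal ((τ - u) ^ (-1 + α / 2)) * D.dist₁ r P P' X u := by
  obtain ⟨C, hC, hb⟩ := exists_H_bound d hκ hα hT
  have hκ0 : 0 < κ := by linarith
  have hl := lam_pos hκ0
  set G : ℝ := κ ^ d * (Real.pi / lam κ) ^ ((d : ℝ) / 2) with hG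
  have hG0 : 0 < G := by positivity
  refine ⟨C * G, by positivity, fun D s S h Ω _ r P P' X hP hP' hsr τ hτ => ?_⟩
  have := hP.finite
  have := hP'.finite
  set f : ℝ → Vec d → ℝ≥0∞ := fun u w => ‖D.hk P X r u w - D.hk P' X r u w‖ₑ with hf
  have hfm : Measurable fun p : ℝ × Vec d => f p.1 p.2 := h.measurable_hk_sub hα.1 hP hP'
  have hHm : ∀ u y, Measurable fun w => D.H u w τ y := fun u y =>
    h.measurable_H hα.1 measurable_const measurable_id measurable_const measurable_const
  have hJ : ∀ u ∈ Ioo r τ, ∀ y, ‖∫ ω, D.H u (X u ω) τ y ∂P - ∫ ω, D.H u (X u ω) τ y ∂P'‖ₑ ≤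
      ENNReal.ofReal C * (ENNReal.ofReal ((τ - u) ^ (-1 + α / 2)) *
        ∫⁻ w, ENNReal.ofReal (D.Γ (lam κ) u w τ y) * f u w) := by
    intro u hu y
    have hδ : 0 < τ - u := sub_pos.2 hu.2
    have hbu := fun z => hb D s S h u τ hu.2 (by linarith [h.len, hu.1, hτ.2]) z y
    refine (h.enorm_integral_sub_le hκ hα hP hP' hsr hu.1 (hu.2.le.trans hτ.2) (hHm u y)
      (K := C * ((τ - u) ^ (-1 + α / 2) * (τ - u) ^ (-(d : ℝ) / 2))) fun w => (hbu w).trans ?_).trans ?_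
    · have := Γ_le_rpow (D := D) hl.le hu.2 w y
      gcongr
    · rw [← lintegral_const_mul' _ _ ENNReal.ofReal_ne_top, ← lintegral_const_mul' _ _ ENNReal.ofReal_ne_top]
      refine lintegral_mono fun w => ?_
      have h1 : ‖D.H u w τ y‖ₑ ≤ ENNReal.ofReal C * (ENNReal.ofReal ((τ - u) ^ (-1 + α / 2)) *
          ENNReal.ofReal (D.Γ (lam κ) u w τ y)) := by
        rw [Real.enorm_eq_ofReal_abs, ← ENNReal.ofReal_mul (by positivity), ← ENNReal.ofReal_mul hC.le]
        exact ENNReal.ofReal_le_ofReal (hbu w)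
      refine (mul_le_mul_right h1 _).trans (le_of_eq ?_)
      simp only [hf]
      ring
  have hpt : ∀ y, f τ y ≤ ‖∫ ω, D.q r (X r ω) τ y ∂P - ∫ ω, D.q r (X r ω) τ y ∂P'‖ₑ +
      ENNReal.ofReal C * ∫⁻ u in Ioo r τ, ENNReal.ofReal ((τ - u) ^ (-1 + α / 2)) *
        ∫⁻ w, ENNReal.ofReal (D.Γ (lam κ) u w τ y) * f u w := by
    intro y
    have h1 : D.hk P X r τ y - D.hk P' X r τ y =
        (∫ ω, D.q r (X r ω) τ y ∂P - ∫ ω, D.q r (X r ω) τ y ∂P') +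
        ∫ u in r..τ, (∫ ω, D.H u (X u ω) τ y ∂P - ∫ ω, D.H u (X u ω) τ y ∂P') := by
      rw [intervalIntegral.integral_sub (h.intervalIntegrable_J hκ hα hT hP hsr hτ.1 hτ.2 y)
        (h.intervalIntegrable_J hκ hα hT hP' hsr hτ.1 hτ.2 y)]
      unfold hk
      ring
    simp only [hf]
    rw [h1]
    refine (enorm_add_le _ _).trans (add_le_add_right ?_ _)
    rw [intervalIntegral.integral_of_le hτ.1.le, integral_Ioc_eq_integral_Ioo,
      ← lintegral_const_mul' _ _ ENNReal.ofReal_ne_top]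
    exact (enorm_integral_le_lintegral_enorm _).trans (setLIntegral_mono' measurableSet_Ioo fun u hu => hJ u hu y)
  have hqm : ∀ P : Measure Ω, IsFiniteMeasure P → Measurable fun y => ∫ ω, D.q r (X r ω) τ y ∂P := fun P _ => by
    have h1 : Measurable fun p : Vec d × Ω => D.q r (X r p.2) τ p.1 :=
      h.measurable_q hα.1 measurable_const ((hP.meas r).comp measurable_snd) measurable_const measurable_fst
    exact h1.stronglyMeasurable.integral_prod_right'.measurable
  have hqm' : Measurable fun y => ‖∫ ω, D.q r (X r ω) τ y ∂P - ∫ ω, D.q r (X r ω) τ y ∂P'‖ₑ :=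
    ((hqm P inferInstance).sub (hqm P' inferInstance)).enorm
  refine (lintegral_mono hpt).trans ?_
  rw [lintegral_add_left hqm']
  refine add_le_add_right (a := ∫⁻ w, ‖∫ ω, D.q r (X r ω) τ w ∂P - ∫ ω, D.q r (X r ω) τ w ∂P'‖ₑ) ?_
  rw [lintegral_const_mul' _ _ ENNReal.ofReal_ne_top, ENNReal.ofReal_mul hC.le, mul_assoc]
  refine mul_le_mul_right ?_ _
  exact h.lintegral_lintegral_Γ_mul_le hκ0 hl hfm r τ _

end Coeffs

end

section

namespace Coeffs

variable {d : ℕ} {D : Coeffs d} {κ α T s S : ℝ}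

/-- Gaussian kernels with nearby centres are comparable after halving the exponent. -/
lemma gaussk_le_of_norm_sub_le {d : ℕ} {l δ R : ℝ} (hl : 0 < l) (hδ : 0 < δ) {x y : Vec d} (hxy : ‖x - y‖ ≤ R) :
    gaussk d l δ x ≤ Real.exp (l * R ^ 2 / δ) * gaussk d (l / 2) δ y := by
  have h1 : ‖y‖ ^ 2 ≤ 2 * ‖x‖ ^ 2 + 2 * R ^ 2 := by
    have h2 : ‖y‖ ≤ ‖x‖ + R := by
      have := norm_sub_norm_le y x
      rw [norm_sub_rev] at this
      linarith
    nlinarith [sq_nonneg (‖x‖ - R), norm_nonneg y, norm_nonneg x, (norm_nonneg _).trans hxy]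
  unfold gaussk
  rw [mul_left_comm, ← Real.exp_add, ← add_div]
  refine mul_le_mul_of_nonneg_left (Real.exp_le_exp.2 (div_le_div_of_nonneg_right ?_ hδ.le)) (by positivity)
  nlinarith

lemma Good.tendsto_lintegral_q_sub (h : D.Good κ α T s S) (hκ : 1 ≤ κ) (hα : 0 < α) {τ : ℝ} (hτ : s < τ) {x : ℕ → Vec d}
    {x₀ : Vec d} (hx : Tendsto x atTop (𝓝 x₀)) :
    Tendsto (fun n => ∫⁻ w, ‖D.q s (x n) τ w - D.q s x₀ τ w‖ₑ) atTop (𝓝 0) := by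
  have hκ0 : 0 < κ := by linarith
  have hl := lam_pos hκ0
  have hδ : 0 < τ - s := sub_pos.2 hτ
  set K : ℝ := κ ^ ((d : ℝ) / 2) * Real.exp (lam κ * 1 ^ 2 / (τ - s)) with hK
  have hK0 : 0 < K := by positivity
  have hbd : ∀ z, ‖D.E s z - D.E s x₀‖ ≤ 1 → ∀ w,
      ‖D.q s z τ w‖ₑ ≤ ENNReal.ofReal K * ENNReal.ofReal (D.Γ (lam κ / 2) s x₀ τ w) := by
    intro z hz w
    rw [Real.enorm_eq_ofReal (D.q_nonneg _ _ _ _), ← ENNReal.ofReal_mul hK0.le]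
    refine ENNReal.ofReal_le_ofReal ((h.q_le hκ0 hτ z w).trans ?_)
    rw [hK, mul_assoc]
    refine mul_le_mul_of_nonneg_left (gaussk_le_of_norm_sub_le hl hδ ?_) (by positivity)
    rwa [sub_sub_sub_cancel_right]
  have hE : Tendsto (fun n => ‖D.E s (x n) - D.E s x₀‖) atTop (𝓝 0) := by
    have h1 : Continuous fun z => D.E s z := h.E_cont.comp (Continuous.prodMk_right s)
    exact tendsto_iff_norm_sub_tendsto_zero.1 ((h1.tendsto x₀).comp hx)
  have hqm : ∀ z, Measurable fun w => D.q s z τ w := fun z =>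
    h.measurable_q hα measurable_const measurable_const measurable_const measurable_id
  have := tendsto_lintegral_filter_of_dominated_convergence (μ := volume)
    (F := fun n w => ‖D.q s (x n) τ w - D.q s x₀ τ w‖ₑ) (f := fun _ : Vec d => 0) (l := atTop)
    (fun w => 2 * (ENNReal.ofReal K * ENNReal.ofReal (D.Γ (lam κ / 2) s x₀ τ w)))
    (Eventually.of_forall fun n => ((hqm _).sub (hqm _)).enorm)
    ((hE.eventually_le_const one_pos).mono fun n hn => Eventually.of_forall fun w => by
      refine enorm_sub_le.trans ?_
      rw [two_mul]
      exact add_le_add (hbd _ hn w) (hbd x₀ (by simp) w)) ?_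
    (Eventually.of_forall fun w => ?_)
  · simpa using this
  · rw [lintegral_const_mul' _ _ (by norm_num), lintegral_const_mul' _ _ ENNReal.ofReal_ne_top]
    exact ENNReal.mul_ne_top (by norm_num) (ENNReal.mul_ne_top ENNReal.ofReal_ne_top
      (ne_top_of_le_ne_top ENNReal.ofReal_ne_top (h.lintegral_Γ_le hκ0 (half_pos hl) hτ x₀)))
  · have h1 := h.tendsto_q hκ0 hα hτ tendsto_const_nhds hx tendsto_const_nhds (tendsto_const_nhds (x := w))
    have h2 := ((h1.sub_const (D.q s x₀ τ w)).enorm)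
    simpa using h2

variable {Ω : Type} [MeasurableSpace Ω] {P : Vec d → Measure Ω} {X : ℝ → Ω → Vec d}

lemma integral_q_start {P : Measure Ω} [IsProbabilityMeasure P] {x : Vec d} (hx : ∀ᵐ ω ∂P, X s ω = x) (τ : ℝ)
    (y : Vec d) : ∫ ω, D.q s (X s ω) τ y ∂P = D.q s x τ y := by
  rw [integral_congr_ae (hx.mono fun ω h => by simp only [h] : _ =ᵐ[P] fun _ => D.q s x τ y)]
  simp

lemma Good.tendsto_dist₁ (h : D.Good κ α T s S) (hκ : 1 ≤ κ) (hα : α ∈ Ioc (0 : ℝ) 1) (hT : 0 < T)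
    (hP : ∀ x, FPFlow D.b D.a s S (P x) X) (hPr : ∀ x, IsProbabilityMeasure (P x))
    (hst : ∀ x, ∀ᵐ ω ∂P x, X s ω = x) {x : ℕ → Vec d} {x₀ : Vec d} (hx : Tendsto x atTop (𝓝 x₀)) :
    ∀ τ ∈ Ioc s S, Tendsto (fun n => D.dist₁ s (P (x n)) (P x₀) X τ) atTop (𝓝 0) := by
  obtain ⟨C, hC, hb⟩ := exists_dist₁_le d hκ hα hT
  have hzero := singular_gronwall (half_pos hα.1) hC (r := s) (S := S)
    (φ := fun τ => limsup (fun n => D.dist₁ s (P (x n)) (P x₀) X τ) atTop) (B := 2) (by norm_num)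
    (fun τ hτ => Filter.limsup_le_of_le (by isBoundedDefault) (Eventually.of_forall fun n =>
      h.dist₁_le hκ hα (hP _) (hP _) le_rfl hτ.1 hτ.2)) ?_
  · intro τ hτ
    exact tendsto_of_le_liminf_of_limsup_le bot_le (hzero τ hτ).le
  · intro τ hτ
    have h1 : ∀ n, D.dist₁ s (P (x n)) (P x₀) X τ ≤ (∫⁻ w, ‖D.q s (x n) τ w - D.q s x₀ τ w‖ₑ) +
        ENNReal.ofReal C * ∫⁻ u in Ioo s τ, ENNReal.ofReal ((τ - u) ^ (-1 + α / 2)) *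
          D.dist₁ s (P (x n)) (P x₀) X u := fun n => by
      have := hb D s S h Ω _ s (P (x n)) (P x₀) X (hP _) (hP _) le_rfl τ hτ
      simpa only [integral_q_start (hst _)] using this
    refine (limsup_le_limsup (Eventually.of_forall h1)).trans ?_
    have h2 := ENNReal.limsup_add_of_left_tendsto_zero (h.tendsto_lintegral_q_sub hκ hα.1 hτ.1 hx)
      (fun n => ENNReal.ofReal C * ∫⁻ u in Ioo s τ, ENNReal.ofReal ((τ - u) ^ (-1 + α / 2)) *
          D.dist₁ s (P (x n)) (P x₀) X u)
    refine (le_of_eq h2).trans ?_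
    rw [ENNReal.limsup_const_mul_of_ne_top ENNReal.ofReal_ne_top]
    refine mul_le_mul_right ?_ _
    have hw : Measurable fun u : ℝ => ENNReal.ofReal ((τ - u) ^ (-1 + α / 2)) :=
      ((measurable_const.sub measurable_id).pow_const _).ennreal_ofReal
    refine (limsup_lintegral_le (fun u => ENNReal.ofReal ((τ - u) ^ (-1 + α / 2)) * 2)
      (fun n => hw.mul (h.measurable_dist₁ hα.1 (hP _) (hP _))) (fun n => ?_) ?_).trans (le_of_eq ?_)
    · filter_upwards [ae_restrict_mem measurableSet_Ioo] with u hu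
      exact mul_le_mul_right (h.dist₁_le hκ hα (hP _) (hP _) le_rfl hu.1 (hu.2.le.trans hτ.2)) _
    · rw [lintegral_mul_const _ hw]
      exact ENNReal.mul_ne_top (lintegral_rpow_sub_lt_top (half_pos hα.1) s τ).ne (by norm_num)
    · refine lintegral_congr fun u => ?_
      simp only [Pi.mul_apply]
      rw [ENNReal.limsup_const_mul_of_ne_top ENNReal.ofReal_ne_top]

theorem Good.continuous_hk (h : D.Good κ α T s S) (hκ : 1 ≤ κ) (hα : α ∈ Ioc (0 : ℝ) 1) (hT : 0 < T) (hsS : s < S)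
    (hP : ∀ x, FPFlow D.b D.a s S (P x) X) (hPr : ∀ x, IsProbabilityMeasure (P x))
    (hst : ∀ x, ∀ᵐ ω ∂P x, X s ω = x) : Continuous fun p : Vec d × Vec d => D.hk (P p.1) X s S p.2 := by
  have hκ0 : 0 < κ := by linarith
  refine continuous_iff_seqContinuous.2 fun p p₀ hp => ?_
  have hx : Tendsto (fun n => (p n).1) atTop (𝓝 p₀.1) := (continuous_fst.tendsto p₀).comp hp
  have hy : Tendsto (fun n => (p n).2) atTop (𝓝 p₀.2) := (continuous_snd.tendsto p₀).comp hp
  obtain ⟨C, hC, hb⟩ := exists_H_bound d hκ hα hT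
  obtain ⟨C', hC', hb'⟩ := exists_abs_integral_H_le d hκ hα hT
  have hJ : ∀ u ∈ Ioo s S, Tendsto (fun n => ∫ ω, D.H u (X u ω) S (p n).2 ∂P (p n).1) atTop
      (𝓝 (∫ ω, D.H u (X u ω) S p₀.2 ∂P p₀.1)) := by
    intro u hu
    have hδ : 0 < S - u := sub_pos.2 hu.2
    set K : ℝ := C * ((S - u) ^ (-1 + α / 2) * (S - u) ^ (-(d : ℝ) / 2)) with hK
    have hbK : ∀ w y, |D.H u w S y| ≤ K := fun w y => by
      refine (hb D s S h u S hu.2 (by linarith [h.len, hu.1]) w y).trans ?_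
      have := Γ_le_rpow (D := D) (lam_pos hκ0).le hu.2 w y
      rw [hK]
      gcongr
    have hHm : ∀ y, Measurable fun w => D.H u w S y := fun y =>
      h.measurable_H hα.1 measurable_const measurable_id measurable_const measurable_const
    have h2 : Tendsto (fun n => ∫ ω, D.H u (X u ω) S (p n).2 ∂P p₀.1) atTop
        (𝓝 (∫ ω, D.H u (X u ω) S p₀.2 ∂P p₀.1)) :=
      tendsto_integral_filter_of_dominated_convergence (fun _ => K)
        (Eventually.of_forall fun n => ((hHm _).comp ((hP p₀.1).meas u)).aestronglyMeasurable)
        (Eventually.of_forall fun n => Eventually.of_forall fun ω => hbK _ _) (integrable_const _)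
        (Eventually.of_forall fun ω => h.tendsto_H hκ0 hα.1 hu.2 hy)
    have h3 : Tendsto (fun n => D.dist₁ s (P (p n).1) (P p₀.1) X u * ENNReal.ofReal K) atTop (𝓝 0) := by
      have := ENNReal.Tendsto.mul_const (h.tendsto_dist₁ hκ hα hT hP hPr hst hx u ⟨hu.1, hu.2.le⟩)
        (b := ENNReal.ofReal K) (Or.inr ENNReal.ofReal_ne_top)
      simpa using this
    have h4 : Tendsto (fun n => ∫ ω, D.H u (X u ω) S (p n).2 ∂P (p n).1 - ∫ ω, D.H u (X u ω) S (p n).2 ∂P p₀.1)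
        atTop (𝓝 0) := by
      refine tendsto_iff_edist_tendsto_0.2 ?_
      refine tendsto_of_tendsto_of_tendsto_of_le_of_le tendsto_const_nhds h3 (fun _ => bot_le) fun n => ?_
      rw [edist_zero_right]
      refine (h.enorm_integral_sub_le hκ hα (hP _) (hP _) le_rfl hu.1 hu.2.le (hHm _) fun w => hbK w _).trans ?_
      unfold dist₁
      rw [← lintegral_mul_const' _ _ ENNReal.ofReal_ne_top]
      refine lintegral_mono fun w => mul_le_mul_right ?_ _
      rw [Real.enorm_eq_ofReal_abs]
      exact ENNReal.ofReal_le_ofReal (hbK _ _)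
    simpa using h4.add h2
  have hI : Tendsto (fun n => ∫ u in s..S, ∫ ω, D.H u (X u ω) S (p n).2 ∂P (p n).1) atTop
      (𝓝 (∫ u in s..S, ∫ ω, D.H u (X u ω) S p₀.2 ∂P p₀.1)) := by
    have hne : ∀ᵐ u : ℝ, u ≠ S := by simp [ae_iff]
    refine intervalIntegral.tendsto_integral_filter_of_dominated_convergence
      (fun u : ℝ => C' * ((S - u) ^ (-1 + α / 2) * (S - s) ^ (-(d : ℝ) / 2)))
      (Eventually.of_forall fun n => (h.measurable_J_time hα.1 (hP _) S _).aestronglyMeasurable)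
      (Eventually.of_forall fun n => ?_)
      (((intervalIntegrable_rpow_sub (half_pos hα.1) s S).mul_const _).const_mul _) ?_
    · filter_upwards [hne] with u hu hu'
      rw [uIoc_of_le hsS.le] at hu'
      exact hb' D s S h Ω _ s _ X (hP _) le_rfl u S hu'.1 (lt_of_le_of_ne hu'.2 hu) le_rfl _
    · filter_upwards [hne] with u hu hu'
      rw [uIoc_of_le hsS.le] at hu'
      exact hJ u ⟨hu'.1, lt_of_le_of_ne hu'.2 hu⟩
  have hq := h.tendsto_q hκ0 hα.1 hsS (tendsto_const_nhds (x := s)) hx (tendsto_const_nhds (x := S)) hy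
  have := hq.add hI
  show Tendsto (fun n => D.hk (P (p n).1) X s S (p n).2) atTop (𝓝 (D.hk (P p₀.1) X s S p₀.2))
  unfold hk
  simpa only [integral_q_start (hst _)] using this

end Coeffs

end

section

/-- Integral form of Grönwall's inequality. -/
lemma le_exp_of_le_integral {s S A K : ℝ} (hK : 0 < K) (hA : 0 ≤ A) {δ : ℝ → ℝ} (hc : ContinuousOn δ (Icc s S))
    (h : ∀ τ ∈ Icc s S, δ τ ≤ A + K * ∫ r in s..τ, δ r) :
    ∀ τ ∈ Icc s S, δ τ ≤ 2 * A * Real.exp (2 * K * (τ - s)) := by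
  intro τ₁ hτ₁
  obtain ⟨r₀, hr₀, hmax⟩ := isCompact_Icc.exists_isMaxOn ⟨τ₁, hτ₁⟩
    (f := fun r => Real.exp (-(2 * K * (r - s))) * δ r) ((by fun_prop : Continuous fun r : ℝ =>
      Real.exp (-(2 * K * (r - s)))).continuousOn.mul hc)
  set m := Real.exp (-(2 * K * (r₀ - s))) * δ r₀ with hm
  have hb : ∀ r ∈ Icc s S, δ r ≤ m * Real.exp (2 * K * (r - s)) := by
    intro r hr
    have h1 : Real.exp (-(2 * K * (r - s))) * δ r ≤ m := hmax hr
    have h2 : δ r = Real.exp (2 * K * (r - s)) * (Real.exp (-(2 * K * (r - s))) * δ r) := by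
      rw [← mul_assoc, ← Real.exp_add, add_neg_cancel, Real.exp_zero, one_mul]
    rw [h2, mul_comm m]
    exact mul_le_mul_of_nonneg_left h1 (Real.exp_pos _).le
  have h_intg : ∫ r in s..r₀, m * Real.exp (2 * K * (r - s)) = m * ((Real.exp (2 * K * (r₀ - s)) - 1) / (2 * K)) := by
    rw [intervalIntegral.integral_const_mul]
    congr 1
    have : ∀ r ∈ uIcc s r₀, HasDerivAt (fun r => Real.exp (2 * K * (r - s)) / (2 * K)) (Real.exp (2 * K * (r - s))) r := by
      intro r _
      have h1 : HasDerivAt (fun r => 2 * K * (r - s)) (2 * K) r := by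
        simpa using ((hasDerivAt_id r).sub_const s).const_mul (2 * K)
      have := h1.exp.div_const (2 * K)
      rwa [mul_div_assoc, div_self (by positivity), mul_one] at this
    rw [intervalIntegral.integral_eq_sub_of_hasDerivAt this ((by fun_prop : Continuous fun r : ℝ =>
      Real.exp (2 * K * (r - s))).intervalIntegrable _ _)]
    simp [sub_div]
  have h3 : ∫ r in s..r₀, δ r ≤ m * ((Real.exp (2 * K * (r₀ - s)) - 1) / (2 * K)) := by
    rw [← h_intg]
    refine intervalIntegral.integral_mono_on hr₀.1 ?_ ((by fun_prop : Continuous fun r : ℝ =>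
      m * Real.exp (2 * K * (r - s))).intervalIntegrable _ _) fun r hr => hb r ⟨hr.1, hr.2.trans hr₀.2⟩
    exact (hc.mono (by rw [uIcc_of_le hr₀.1]; exact Icc_subset_Icc_right hr₀.2)).intervalIntegrable
  have h4 := (h r₀ hr₀).trans (add_le_add_right (mul_le_mul_of_nonneg_left h3 hK.le) A)
  have h5 : δ r₀ = m * Real.exp (2 * K * (r₀ - s)) := by
    rw [hm, mul_right_comm, ← Real.exp_add, neg_add_cancel, Real.exp_zero, one_mul]
  have h6 : K * (m * ((Real.exp (2 * K * (r₀ - s)) - 1) / (2 * K))) =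
      m * Real.exp (2 * K * (r₀ - s)) / 2 - m / 2 := by
    field_simp
  rw [h5, h6] at h4
  have h7 : 1 ≤ Real.exp (2 * K * (r₀ - s)) := Real.one_le_exp (by have := hr₀.1; nlinarith)
  have h8 : m ≤ 2 * A := by
    by_contra! hcon
    nlinarith
  refine (hb τ₁ hτ₁).trans (mul_le_mul_of_nonneg_right h8 (Real.exp_pos _).le)

section ode

variable {d : ℕ} {f : ℝ → Vec d → Vec d} {s S K M : ℝ} {φ ψ : ℝ → Vec d} {x y : Vec d}

/-- A continuous function satisfying the integral equation is bounded. -/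
lemma norm_le_of_integral_eq (hK : 0 < K) (hM : 0 ≤ M) (hf0 : ∀ r ∈ Icc s S, ‖f r 0‖ ≤ M)
    (hfK : ∀ r ∈ Icc s S, ∀ x y, ‖f r x - f r y‖ ≤ K * ‖x - y‖)
    (hφ : ∀ τ ∈ Icc s S, φ τ = x + ∫ r in s..τ, f r (φ r))
    (hc : ContinuousOn φ (Icc s S)) :
    ∀ τ ∈ Icc s S, ‖φ τ‖ ≤ 2 * (‖x‖ + M * (S - s)) * Real.exp (2 * K * (S - s)) := by
  intro τ₀ hτ₀
  have hsS : s ≤ S := hτ₀.1.trans hτ₀.2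
  have h0 : 0 ≤ ‖x‖ + M * (S - s) := by have := mul_nonneg hM (sub_nonneg.2 hsS); positivity
  refine (le_exp_of_le_integral hK h0 hc.norm (fun τ hτ => ?_) τ₀ hτ₀).trans ?_
  · have hsub : uIcc s τ ⊆ Icc s S := by rw [uIcc_of_le hτ.1]; exact Icc_subset_Icc_right hτ.2
    have hi1 : IntervalIntegrable (fun r => ‖φ r‖) volume s τ := (hc.norm.mono hsub).intervalIntegrable
    calc ‖φ τ‖ ≤ ‖x‖ + ‖∫ r in s..τ, f r (φ r)‖ := by rw [hφ τ hτ]; exact norm_add_le _ _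
      _ ≤ ‖x‖ + ∫ r in s..τ, (M + K * ‖φ r‖) := by
          refine add_le_add_right (intervalIntegral.norm_integral_le_of_norm_le hτ.1
            (Eventually.of_forall fun r hr => ?_) (intervalIntegrable_const.add (hi1.const_mul K))) _
          have hr' : r ∈ Icc s S := ⟨hr.1.le, hr.2.trans hτ.2⟩
          have h1 := hfK r hr' (φ r) 0
          rw [sub_zero] at h1
          have h2 := norm_le_insert' (f r (φ r)) (f r 0)
          linarith [hf0 r hr']
      _ = ‖x‖ + (M * (τ - s) + K * ∫ r in s..τ, ‖φ r‖) := by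
          rw [intervalIntegral.integral_add intervalIntegrable_const (hi1.const_mul K),
            intervalIntegral.integral_const, intervalIntegral.integral_const_mul, smul_eq_mul, mul_comm M]
      _ ≤ ‖x‖ + M * (S - s) + K * ∫ r in s..τ, ‖φ r‖ := by
          have := mul_le_mul_of_nonneg_left (sub_le_sub_right hτ.2 s) hM
          linarith
  · have := hτ₀.2
    gcongr

lemma continuousOn_of_integral_eq (hφ : ∀ τ ∈ Icc s S, φ τ = x + ∫ r in s..τ, f r (φ r))
    (hi : IntervalIntegrable (fun r => f r (φ r)) volume s S) : ContinuousOn φ (Icc s S) := by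
  rcases lt_or_ge S s with h | h
  · simp [Icc_eq_empty_of_lt h]
  have h1 := intervalIntegral.continuousOn_primitive_interval' hi left_mem_uIcc
  rw [uIcc_of_le h] at h1
  exact (continuousOn_const.add h1).congr hφ

/-- The right-hand side of a Lipschitz integral equation is automatically integrable. -/
lemma intervalIntegrable_of_integral_eq (hsS : s ≤ S) (hf : Measurable (Function.uncurry f)) (hK : 0 < K) (hM : 0 ≤ M)
    (hf0 : ∀ r ∈ Icc s S, ‖f r 0‖ ≤ M) (hfK : ∀ r ∈ Icc s S, ∀ x y, ‖f r x - f r y‖ ≤ K * ‖x - y‖)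
    (hφ : ∀ τ ∈ Icc s S, φ τ = x + ∫ r in s..τ, f r (φ r)) :
    IntervalIntegrable (fun r => f r (φ r)) volume s S := by
  set g := fun r => f r (φ r) with hg
  set A := {τ | τ ∈ Icc s S ∧ IntervalIntegrable g volume s τ} with hA
  have hsA : s ∈ A := ⟨⟨le_rfl, hsS⟩, IntervalIntegrable.refl⟩
  have hbdd : BddAbove A := ⟨S, fun τ hτ => hτ.1.2⟩
  set c := sSup A with hc
  have hsc : s ≤ c := le_csSup hbdd hsA
  have hcS : c ≤ S := csSup_le ⟨s, hsA⟩ fun τ hτ => hτ.1.2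
  have hlt : ∀ τ, s ≤ τ → τ < c → τ ∈ A := by
    intro τ h1 h2
    obtain ⟨τ', hτ', h3⟩ := exists_lt_of_lt_csSup ⟨s, hsA⟩ h2
    refine ⟨⟨h1, h2.le.trans hcS⟩, hτ'.2.mono_set ?_⟩
    rw [uIcc_of_le h1, uIcc_of_le hτ'.1.1]
    exact Icc_subset_Icc_right h3.le
  have hcont : ∀ τ ∈ A, ContinuousOn φ (Icc s τ) := fun τ hτ =>
    continuousOn_of_integral_eq (fun r hr => hφ r ⟨hr.1, hr.2.trans hτ.1.2⟩) hτ.2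
  have hco : ContinuousOn φ (Ico s c) := by
    intro r hr
    obtain ⟨r', h1, h2⟩ := exists_between hr.2
    have h3 := hcont r' (hlt r' (hr.1.trans h1.le) h2) r ⟨hr.1, h1.le⟩
    refine h3.mono_of_mem_nhdsWithin ?_
    filter_upwards [self_mem_nhdsWithin, mem_nhdsWithin_of_mem_nhds (Iio_mem_nhds h1)] with z hz hz'
    exact ⟨hz.1, (mem_Iio.1 hz').le⟩
  set B := 2 * (‖x‖ + M * (S - s)) * Real.exp (2 * K * (S - s)) with hB
  have hbound : ∀ r ∈ Ico s c, ‖φ r‖ ≤ B := by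
    intro r hr
    have hr' := hlt r hr.1 hr.2
    refine (norm_le_of_integral_eq hK hM (fun u hu => hf0 u ⟨hu.1, hu.2.trans hr'.1.2⟩)
      (fun u hu => hfK u ⟨hu.1, hu.2.trans hr'.1.2⟩) (fun u hu => hφ u ⟨hu.1, hu.2.trans hr'.1.2⟩)
      (hcont r hr') r ⟨hr.1, le_rfl⟩).trans ?_
    have := hr'.1.2
    rw [hB]
    have h0 : 0 ≤ r - s := sub_nonneg.2 hr.1
    gcongr
  have hbd : ∀ r ∈ Icc s S, ∀ z, ‖f r z‖ ≤ M + K * ‖z‖ := by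
    intro r hr z
    have h1 := hfK r hr z 0
    rw [sub_zero] at h1
    have h2 := norm_le_insert' (f r z) (f r 0)
    linarith [hf0 r hr]
  have hcA : c ∈ A := by
    refine ⟨⟨hsc, hcS⟩, ?_⟩
    rw [intervalIntegrable_iff_integrableOn_Ico_of_le hsc]
    have hm : AEStronglyMeasurable g (volume.restrict (Ico s c)) := by
      have h1 : AEMeasurable φ (volume.restrict (Ico s c)) := hco.aemeasurable measurableSet_Ico
      exact (hf.comp_aemeasurable (aemeasurable_id.prodMk h1)).aestronglyMeasurable
    refine IntegrableOn.of_bound (by simp) hm (M + K * B) ?_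
    filter_upwards [ae_restrict_mem measurableSet_Ico] with r hr
    refine (hbd r ⟨hr.1, hr.2.le.trans hcS⟩ _).trans ?_
    have := hbound r hr
    gcongr
  rcases hcS.eq_or_lt with h | h
  · rw [← h]; exact hcA.2
  · exfalso
    have hx : ∀ τ ∈ Ioc c S, φ τ = x := by
      intro τ hτ
      rw [hφ τ ⟨hsc.trans hτ.1.le, hτ.2⟩, intervalIntegral.integral_undef, add_zero]
      intro hi
      exact absurd (le_csSup hbdd (show τ ∈ A from ⟨⟨hsc.trans hτ.1.le, hτ.2⟩, hi⟩)) (not_le.2 hτ.1)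
    have h2 : IntervalIntegrable g volume c S := by
      have h3 : IntervalIntegrable (fun r => f r x) volume c S := by
        rw [intervalIntegrable_iff_integrableOn_Ioc_of_le hcS]
        refine IntegrableOn.of_bound (by simp)
          (hf.comp (measurable_id.prodMk measurable_const)).aestronglyMeasurable (M + K * ‖x‖) ?_
        filter_upwards [ae_restrict_mem measurableSet_Ioc] with r hr
        exact hbd r ⟨hsc.trans hr.1.le, hr.2⟩ x
      refine h3.congr fun r hr => ?_
      rw [uIoc_of_le hcS] at hr
      simp only [hg, hx r hr]
    exact absurd (le_csSup hbdd (show S ∈ A from ⟨⟨hsS, le_rfl⟩, hcA.2.trans h2⟩)) (not_le.2 h)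

/-- Lipschitz dependence on the initial condition. -/
lemma norm_sub_le_of_integral_eq (hK : 0 < K) (hfK : ∀ r ∈ Icc s S, ∀ x y, ‖f r x - f r y‖ ≤ K * ‖x - y‖)
    (hφ : ∀ τ ∈ Icc s S, φ τ = x + ∫ r in s..τ, f r (φ r)) (hψ : ∀ τ ∈ Icc s S, ψ τ = y + ∫ r in s..τ, f r (ψ r))
    (hiφ : IntervalIntegrable (fun r => f r (φ r)) volume s S)
    (hiψ : IntervalIntegrable (fun r => f r (ψ r)) volume s S) :
    ∀ τ ∈ Icc s S, ‖φ τ - ψ τ‖ ≤ 2 * ‖x - y‖ * Real.exp (2 * K * (τ - s)) := by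
  have hc := (continuousOn_of_integral_eq hφ hiφ).sub (continuousOn_of_integral_eq hψ hiψ)
  refine le_exp_of_le_integral hK (norm_nonneg _) hc.norm fun τ hτ => ?_
  have hsub : uIcc s τ ⊆ Icc s S := by rw [uIcc_of_le hτ.1]; exact Icc_subset_Icc_right hτ.2
  have hsub' : uIcc s τ ⊆ uIcc s S := by rwa [uIcc_of_le (hτ.1.trans hτ.2)]
  rw [hφ τ hτ, hψ τ hτ, add_sub_add_comm, ← intervalIntegral.integral_sub (hiφ.mono_set hsub') (hiψ.mono_set hsub'),
    ← intervalIntegral.integral_const_mul]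
  refine (norm_add_le _ _).trans (add_le_add_right (intervalIntegral.norm_integral_le_of_norm_le hτ.1
    (Eventually.of_forall fun r hr => hfK r ⟨hr.1.le, hr.2.trans hτ.2⟩ _ _) ?_) _)
  exact ((hc.norm.mono hsub).intervalIntegrable).const_mul K

end ode

end

section

section flow

variable {d : ℕ} {f : ℝ → Vec d → Vec d} {θ : ℝ → ℝ → Vec d → Vec d} {s S K M : ℝ}

lemma IsFlow.self (h : IsFlow d f θ) {s : ℝ} (hs : 0 ≤ s) (x : Vec d) : θ s s x = x := by
  rw [h s s hs hs x, intervalIntegral.integral_same, add_zero]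

lemma integral_reflect (g : ℝ → Vec d) (s S τ : ℝ) :
    ∫ r in S..(s + S - τ), g r = ∫ r in s..τ, -g (s + S - r) := by
  rw [intervalIntegral.integral_neg, intervalIntegral.integral_comp_sub_left g (s + S),
    add_sub_cancel_left, intervalIntegral.integral_symm]

lemma IsFlow.reflected (h : IsFlow d f θ) (hs : 0 ≤ s) (x : Vec d) :
    ∀ τ ∈ Icc s S, θ (s + S - τ) S x = x + ∫ r in s..τ, -f (s + S - r) (θ (s + S - r) S x) := by
  intro τ hτ
  have h1 := hτ.1
  have h2 := hτ.2
  rw [h S (s + S - τ) (by linarith) (by linarith) x, integral_reflect (fun r => f r (θ r S x))]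

variable (hf : Measurable (Function.uncurry f)) (hK : 0 < K) (hM : 0 ≤ M) (hf0 : ∀ r, 0 ≤ r → ‖f r 0‖ ≤ M)
  (hfK : ∀ r, 0 ≤ r → ∀ x y, ‖f r x - f r y‖ ≤ K * ‖x - y‖)

section
include hfK

lemma reflected_lip (hs : 0 ≤ s) : ∀ r ∈ Icc s S, ∀ x y, ‖-f (s + S - r) x - -f (s + S - r) y‖ ≤ K * ‖x - y‖ := by
  intro r hr x y
  rw [neg_sub_neg, norm_sub_rev]
  exact hfK _ (by linarith [hr.2]) x y

end

include hf hK hM hf0 hfK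

lemma IsFlow.intervalIntegrable_forward (h : IsFlow d f θ) (hs : 0 ≤ s) (hsS : s ≤ S) (x : Vec d) :
    IntervalIntegrable (fun r => f r (θ r s x)) volume s S :=
  intervalIntegrable_of_integral_eq (φ := fun r => θ r s x) hsS hf hK hM (fun r hr => hf0 r (hs.trans hr.1))
    (fun r hr => hfK r (hs.trans hr.1)) fun τ hτ => h s τ hs (hs.trans hτ.1) x

lemma IsFlow.intervalIntegrable_reflected (h : IsFlow d f θ) (hs : 0 ≤ s) (hsS : s ≤ S) (x : Vec d) :
    IntervalIntegrable (fun r => -f (s + S - r) (θ (s + S - r) S x)) volume s S := by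
  refine intervalIntegrable_of_integral_eq (f := fun r x => -f (s + S - r) x) (φ := fun r => θ (s + S - r) S x)
    hsS ?_ hK hM (fun r hr => ?_) (reflected_lip hfK hs) (h.reflected hs x)
  · exact (hf.comp ((measurable_const.sub measurable_fst).prodMk measurable_snd)).neg
  · rw [norm_neg]
    exact hf0 _ (by linarith [hr.2])

lemma IsFlow.intervalIntegrable_backward (h : IsFlow d f θ) (hs : 0 ≤ s) (hsS : s ≤ S) (x : Vec d) :
    IntervalIntegrable (fun r => f r (θ r S x)) volume s S := by
  have := (h.intervalIntegrable_reflected hf hK hM hf0 hfK hs hsS x).neg.comp_sub_left (s + S)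
  simpa using this.symm

lemma IsFlow.norm_sub_le_forward (h : IsFlow d f θ) (hs : 0 ≤ s) (hsS : s ≤ S) (x y : Vec d) :
    ‖θ S s x - θ S s y‖ ≤ 2 * ‖x - y‖ * Real.exp (2 * K * (S - s)) :=
  norm_sub_le_of_integral_eq (φ := fun r => θ r s x) (ψ := fun r => θ r s y) hK (fun r hr => hfK r (hs.trans hr.1))
    (fun τ hτ => h s τ hs (hs.trans hτ.1) x) (fun τ hτ => h s τ hs (hs.trans hτ.1) y)
    (h.intervalIntegrable_forward hf hK hM hf0 hfK hs hsS x)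
    (h.intervalIntegrable_forward hf hK hM hf0 hfK hs hsS y) S ⟨hsS, le_rfl⟩

lemma IsFlow.norm_sub_le_backward (h : IsFlow d f θ) (hs : 0 ≤ s) (hsS : s ≤ S) (x y : Vec d) :
    ‖θ s S x - θ s S y‖ ≤ 2 * ‖x - y‖ * Real.exp (2 * K * (S - s)) := by
  have := norm_sub_le_of_integral_eq (f := fun r x => -f (s + S - r) x) (φ := fun r => θ (s + S - r) S x)
    (ψ := fun r => θ (s + S - r) S y) hK (reflected_lip hfK hs)
    (h.reflected hs x) (h.reflected hs y)
    (h.intervalIntegrable_reflected hf hK hM hf0 hfK hs hsS x)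
    (h.intervalIntegrable_reflected hf hK hM hf0 hfK hs hsS y) S ⟨hsS, le_rfl⟩
  simpa using this

lemma IsFlow.forward_backward (h : IsFlow d f θ) (hs : 0 ≤ s) (hsS : s ≤ S) (x : Vec d) :
    θ S s (θ s S x) = x := by
  have hb := h.intervalIntegrable_backward hf hK hM hf0 hfK hs hsS x
  have h1 := norm_sub_le_of_integral_eq (φ := fun r => θ r s (θ s S x)) (ψ := fun r => θ r S x) (y := θ s S x) hK
    (fun r hr => hfK r (hs.trans hr.1)) (fun τ hτ => h s τ hs (hs.trans hτ.1) (θ s S x)) (fun τ hτ => ?_)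
    (h.intervalIntegrable_forward hf hK hM hf0 hfK hs hsS _) hb S ⟨hsS, le_rfl⟩
  · rw [sub_self, norm_zero, mul_zero, zero_mul] at h1
    have h2 := sub_eq_zero.1 (norm_le_zero_iff.1 h1)
    simpa only [h.self (hs.trans hsS)] using h2
  · rw [h S τ (hs.trans hsS) (hs.trans hτ.1) x, h S s (hs.trans hsS) hs x, add_assoc,
      intervalIntegral.integral_add_adjacent_intervals hb.symm]
    exact hb.mono_set (by rw [uIcc_of_le hτ.1, uIcc_of_le hsS]; exact Icc_subset_Icc_right hτ.2)

lemma IsFlow.backward_forward (h : IsFlow d f θ) (hs : 0 ≤ s) (hsS : s ≤ S) (x : Vec d) :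
    θ s S (θ S s x) = x := by
  have hb := h.intervalIntegrable_forward hf hK hM hf0 hfK hs hsS x
  have hr : IntervalIntegrable (fun r => -f (s + S - r) (θ (s + S - r) s x)) volume s S := by
    have := hb.comp_sub_left (s + S)
    rw [add_sub_cancel_left, add_sub_cancel_right] at this
    exact this.symm.neg
  have h1 := norm_sub_le_of_integral_eq (f := fun r x => -f (s + S - r) x)
    (φ := fun r => θ (s + S - r) S (θ S s x)) (ψ := fun r => θ (s + S - r) s x) (y := θ S s x) hK
    (reflected_lip hfK hs) (h.reflected hs (θ S s x)) (fun τ hτ => ?_)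
    (h.intervalIntegrable_reflected hf hK hM hf0 hfK hs hsS _) hr S ⟨hsS, le_rfl⟩
  · rw [sub_self, norm_zero, mul_zero, zero_mul] at h1
    have h2 := sub_eq_zero.1 (norm_le_zero_iff.1 h1)
    simpa only [add_sub_cancel_right, h.self hs] using h2
  · have hτ1 := hτ.1
    have hτ2 := hτ.2
    rw [← integral_reflect (fun r => f r (θ r s x)), h s (s + S - τ) hs (by linarith) x,
      h s S hs (hs.trans hsS) x, add_assoc, intervalIntegral.integral_add_adjacent_intervals hb]
    refine hb.symm.mono_set ?_
    rw [uIcc_of_ge hsS, uIcc_of_ge (by linarith)]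
    exact Icc_subset_Icc_left (by linarith)

end flow

end

section

section mollifier

variable {d : ℕ} {ρ : Vec d → ℝ} {b : ℝ → Vec d → Vec d} {κ₁ : ℝ}

lemma IsMollifier.hasCompactSupport (hρ : IsMollifier d ρ) : HasCompactSupport ρ :=
  HasCompactSupport.intro (isCompact_closedBall 0 1) fun _ hx => by
    by_contra h
    exact hx (hρ.support_subset h)

lemma IsMollifier.integrable (hρ : IsMollifier d ρ) : Integrable ρ :=
  hρ.smooth.continuous.integrable_of_hasCompactSupport hρ.hasCompactSupport

lemma IsMollifier.eq_zero (hρ : IsMollifier d ρ) {x : Vec d} (hx : 1 < ‖x‖) : ρ x = 0 := by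
  by_contra h
  have := hρ.support_subset h
  rw [mem_closedBall_zero_iff] at this
  linarith

lemma mollifiedDrift_one (ρ : Vec d → ℝ) (b : ℝ → Vec d → Vec d) (t : ℝ) (x : Vec d) :
    mollifiedDrift d ρ 1 b t x = ∫ y, ρ (x - y) • b t y := by
  simp [mollifiedDrift]

lemma HolderDrift.norm_sub_le (hb : HolderDrift d b κ₁ 0) {t : ℝ} (ht : 0 ≤ t) (x y : Vec d) :
    ‖b t x - b t y‖ ≤ κ₁ * max 1 ‖x - y‖ := by
  simpa using hb.2.2 t ht x y

lemma HolderDrift.norm_mollifier_smul_le (hb : HolderDrift d b κ₁ 0) (hρ : IsMollifier d ρ) {t : ℝ} (ht : 0 ≤ t)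
    (x y : Vec d) : ‖ρ (x - y) • (b t y - b t x)‖ ≤ κ₁ * ρ (x - y) := by
  rw [norm_smul, Real.norm_of_nonneg (hρ.nonneg _), mul_comm]
  rcases le_or_gt ‖x - y‖ 1 with h | h
  · refine mul_le_mul_of_nonneg_right ?_ (hρ.nonneg _)
    have := hb.norm_sub_le ht y x
    rwa [norm_sub_rev y x, max_eq_left h, mul_one] at this
  · simp [hρ.eq_zero h]

lemma HolderDrift.integrable_sub (hb : HolderDrift d b κ₁ 0) (hρ : IsMollifier d ρ) {t : ℝ} (ht : 0 ≤ t) (x : Vec d) :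
    Integrable fun y => ρ (x - y) • (b t y - b t x) := by
  have h1 : Measurable (b t) := hb.1.comp (measurable_const (a := t) |>.prodMk measurable_id)
  have h2 : Measurable fun y : Vec d => ρ (x - y) :=
    (hρ.smooth.continuous.comp (by fun_prop : Continuous fun y : Vec d => x - y)).measurable
  have h3 : Measurable fun y => b t y - b t x := h1.sub_const _
  exact ((hρ.integrable.comp_sub_left x).const_mul κ₁).mono' (h2.smul h3).aestronglyMeasurable
    (Eventually.of_forall (hb.norm_mollifier_smul_le hρ ht x))

lemma HolderDrift.integrable_mollifier (hb : HolderDrift d b κ₁ 0) (hρ : IsMollifier d ρ) {t : ℝ} (ht : 0 ≤ t)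
    (x : Vec d) : Integrable fun y => ρ (x - y) • b t y := by
  have h1 := (hb.integrable_sub hρ ht x).add ((hρ.integrable.comp_sub_left x).smul_const (b t x))
  refine h1.congr (Eventually.of_forall fun y => ?_)
  simp only [Pi.add_apply]
  rw [← smul_add, sub_add_cancel]

lemma HolderDrift.mollified_sub (hb : HolderDrift d b κ₁ 0) (hρ : IsMollifier d ρ) {t : ℝ} (ht : 0 ≤ t) (x : Vec d)
    (v : Vec d) : mollifiedDrift d ρ 1 b t x - v = ∫ y, ρ (x - y) • (b t y - v) := by
  have h1 : ∫ y, ρ (x - y) • v = v := by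
    rw [integral_smul_const, integral_sub_left_eq_self ρ volume x, hρ.integral_eq_one, one_smul]
  rw [mollifiedDrift_one]
  conv_lhs => rw [← h1]
  rw [← integral_sub (hb.integrable_mollifier hρ ht x) ((hρ.integrable.comp_sub_left x).smul_const v)]
  simp_rw [smul_sub]

lemma HolderDrift.norm_mollified_sub_le (hb : HolderDrift d b κ₁ 0) (hρ : IsMollifier d ρ) {t : ℝ} (ht : 0 ≤ t)
    (x : Vec d) : ‖mollifiedDrift d ρ 1 b t x - b t x‖ ≤ κ₁ := by
  rw [hb.mollified_sub hρ ht]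
  refine (norm_integral_le_of_norm_le ((hρ.integrable.comp_sub_left x).const_mul κ₁)
    (Eventually.of_forall (hb.norm_mollifier_smul_le hρ ht x))).trans ?_
  rw [integral_const_mul, integral_sub_left_eq_self ρ volume x, hρ.integral_eq_one, mul_one]

lemma HolderDrift.norm_mollified_zero_le (hb : HolderDrift d b κ₁ 0) (hρ : IsMollifier d ρ) {t : ℝ} (ht : 0 ≤ t) :
    ‖mollifiedDrift d ρ 1 b t 0‖ ≤ 2 * κ₁ := by
  have h1 := hb.norm_mollified_sub_le hρ ht 0
  have h2 := hb.2.1 t ht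
  have h3 := norm_le_insert' (mollifiedDrift d ρ 1 b t 0) (b t 0)
  linarith

lemma HolderDrift.measurable_mollified (hb : HolderDrift d b κ₁ 0) (hρ : IsMollifier d ρ) :
    Measurable (Function.uncurry (mollifiedDrift d ρ 1 b)) := by
  have h1 : Function.uncurry (mollifiedDrift d ρ 1 b) =
      fun p : ℝ × Vec d => ∫ y, ρ (p.2 - y) • b p.1 y := by
    ext1 p
    exact mollifiedDrift_one ρ b p.1 p.2
  rw [h1]
  have h2 : Measurable fun q : (ℝ × Vec d) × Vec d => ρ (q.1.2 - q.2) • b q.1.1 q.2 := by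
    have h3 : Measurable fun q : (ℝ × Vec d) × Vec d => ρ (q.1.2 - q.2) :=
      (hρ.smooth.continuous.comp
        (by fun_prop : Continuous fun q : (ℝ × Vec d) × Vec d => q.1.2 - q.2)).measurable
    have h4 : Measurable fun q : (ℝ × Vec d) × Vec d => b q.1.1 q.2 :=
      hb.1.comp (g := Function.uncurry b) (f := fun q : (ℝ × Vec d) × Vec d => (q.1.1, q.2))
        (measurable_fst.fst.prodMk measurable_snd)
    exact h3.smul h4
  exact h2.stronglyMeasurable.integral_prod_right'.measurable

/-- The mollified drift is Lipschitz, with a constant depending only on the mollifier and the growth of `b`. -/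
lemma exists_mollified_lip (hρ : IsMollifier d ρ) (hκ₁ : 0 < κ₁) : ∃ K : ℝ, 0 < K ∧ ∀ b : ℝ → Vec d → Vec d,
    HolderDrift d b κ₁ 0 → ∀ t, 0 ≤ t → ∀ x y : Vec d,
      ‖mollifiedDrift d ρ 1 b t x - mollifiedDrift d ρ 1 b t y‖ ≤ K * ‖x - y‖ := by
  obtain ⟨L, hL⟩ := (hρ.smooth.of_le (m := 1) (by exact_mod_cast le_top)).lipschitzWith_of_hasCompactSupport
    hρ.hasCompactSupport (by norm_num)
  set V : ℝ := (volume (Metric.closedBall (0 : Vec d) 2)).toReal with hV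
  refine ⟨3 * κ₁ + 2 * κ₁ * L * V, by positivity, fun b hb t ht x y => ?_⟩
  have hn := norm_nonneg (x - y)
  rcases lt_or_ge 1 ‖x - y‖ with h | h
  · have h1 := hb.norm_mollified_sub_le hρ ht x
    have h2 := hb.norm_mollified_sub_le hρ ht y
    have h3 := hb.norm_sub_le ht x y
    rw [max_eq_right h.le] at h3
    have h4 : mollifiedDrift d ρ 1 b t x - mollifiedDrift d ρ 1 b t y =
        (mollifiedDrift d ρ 1 b t x - b t x) + (b t x - b t y) - (mollifiedDrift d ρ 1 b t y - b t y) := by abel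
    rw [h4]
    have h5 := norm_sub_le ((mollifiedDrift d ρ 1 b t x - b t x) + (b t x - b t y))
      (mollifiedDrift d ρ 1 b t y - b t y)
    have h6 := norm_add_le (mollifiedDrift d ρ 1 b t x - b t x) (b t x - b t y)
    have h7 : 0 ≤ 2 * κ₁ * L * V * ‖x - y‖ := by positivity
    nlinarith
  · have hix : Integrable fun z => ρ (x - z) • (b t z - b t x) := hb.integrable_sub hρ ht x
    have hiy : Integrable fun z => ρ (y - z) • (b t z - b t x) := by
      have := (hb.integrable_mollifier hρ ht y).sub ((hρ.integrable.comp_sub_left y).smul_const (b t x))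
      refine this.congr (Eventually.of_forall fun z => ?_)
      simp only [Pi.sub_apply, smul_sub]
    have h1 : mollifiedDrift d ρ 1 b t x - mollifiedDrift d ρ 1 b t y =
        ∫ z, (ρ (x - z) - ρ (y - z)) • (b t z - b t x) := by
      rw [← sub_sub_sub_cancel_right _ _ (b t x), hb.mollified_sub hρ ht x, hb.mollified_sub hρ ht y,
        ← integral_sub hix hiy]
      simp_rw [sub_smul]
    have h2 : ∀ z, ‖(ρ (x - z) - ρ (y - z)) • (b t z - b t x)‖ ≤
        (Metric.closedBall x 2).indicator (fun _ => L * ‖x - y‖ * (2 * κ₁)) z := by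
      intro z
      by_cases hz : z ∈ Metric.closedBall x 2
      · rw [indicator_of_mem hz, norm_smul]
        have h3 : ‖ρ (x - z) - ρ (y - z)‖ ≤ L * ‖x - y‖ := by
          have := hL.dist_le_mul (x - z) (y - z)
          rwa [dist_eq_norm, dist_eq_norm, sub_sub_sub_cancel_right] at this
        have h4 : ‖b t z - b t x‖ ≤ 2 * κ₁ := by
          refine (hb.norm_sub_le ht z x).trans ?_
          rw [mul_comm 2]
          refine mul_le_mul_of_nonneg_left (max_le (by norm_num) ?_) hκ₁.le
          rwa [mem_closedBall_iff_norm] at hz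
        gcongr
      · rw [indicator_of_notMem hz]
        rw [mem_closedBall_iff_norm, not_le, norm_sub_rev] at hz
        have h5 : 1 < ‖y - z‖ := by
          have := norm_sub_le_norm_sub_add_norm_sub x y z
          linarith
        rw [hρ.eq_zero (by linarith), hρ.eq_zero h5, sub_self, zero_smul, norm_zero]
    have h6 : ∫ z, (Metric.closedBall x 2).indicator (fun _ => L * ‖x - y‖ * (2 * κ₁)) z =
        V * (L * ‖x - y‖ * (2 * κ₁)) := by
      rw [integral_indicator_const _ Metric.isClosed_closedBall.measurableSet, smul_eq_mul, Measure.real,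
        Measure.addHaar_closedBall_center, hV]
    have h7 : Integrable ((Metric.closedBall x 2).indicator fun _ => L * ‖x - y‖ * (2 * κ₁)) :=
      (integrable_indicator_iff Metric.isClosed_closedBall.measurableSet).2
        (integrableOn_const (measure_closedBall_lt_top.ne) enorm_ne_top)
    rw [h1]
    refine (norm_integral_le_of_norm_le h7 (Eventually.of_forall h2)).trans ?_
    rw [h6]
    have h8 : 0 ≤ 3 * κ₁ * ‖x - y‖ := by positivity
    linarith

end mollifier

end

section

section diffusion

variable {d : ℕ} {σ : ℝ → Vec d → Matrix (Fin d) (Fin d) ℝ} {κ₀ α : ℝ}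

lemma norm_toEuclideanCLM_le {B : Matrix (Fin d) (Fin d) ℝ} {M : ℝ} (hM : ∀ i j, |B i j| ≤ M) :
    ‖(Matrix.toEuclideanCLM (𝕜 := ℝ) B : Lin d)‖ ≤ d * d * M := by
  rcases Nat.eq_zero_or_pos d with rfl | hd
  · rw [Subsingleton.elim (Matrix.toEuclideanCLM (𝕜 := ℝ) B) (0 : Lin 0)]
    simp
  have hM0 : 0 ≤ M := (abs_nonneg _).trans (hM ⟨0, hd⟩ ⟨0, hd⟩)
  refine ContinuousLinearMap.opNorm_le_bound _ (by positivity) fun v => ?_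
  have h1 : ‖(Matrix.toEuclideanCLM (𝕜 := ℝ) B : Lin d) v‖ ≤
      ∑ i, |(Matrix.toEuclideanCLM (𝕜 := ℝ) B : Lin d) v i| := by
    rw [EuclideanSpace.norm_eq]
    refine Real.sqrt_le_iff.2 ⟨by positivity, ?_⟩
    exact Finset.sum_sq_le_sq_sum_of_nonneg fun i _ => abs_nonneg _
  refine h1.trans ?_
  have h2 : ∀ i, |(Matrix.toEuclideanCLM (𝕜 := ℝ) B : Lin d) v i| ≤ d * M * ‖v‖ := by
    intro i
    rw [Matrix.ofLp_toEuclideanCLM, Matrix.mulVec, dotProduct]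
    refine (Finset.abs_sum_le_sum_abs _ _).trans ?_
    have : ∀ j ∈ Finset.univ, |B i j * v j| ≤ M * ‖v‖ := by
      intro j _
      rw [abs_mul]
      exact mul_le_mul (hM i j) (PiLp.norm_apply_le v j) (abs_nonneg _) hM0
    refine (Finset.sum_le_card_nsmul _ _ _ this).trans (le_of_eq ?_)
    simp
    ring
  refine (Finset.sum_le_card_nsmul _ _ _ fun i _ => h2 i).trans (le_of_eq ?_)
  simp
  ring

lemma measurable_toEuclideanCLM {γ : Type*} [MeasurableSpace γ] {B : γ → Matrix (Fin d) (Fin d) ℝ}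
    (hB : ∀ i j, Measurable fun x => B x i j) :
    Measurable fun x => (Matrix.toEuclideanCLM (𝕜 := ℝ) (B x) : Lin d) := by
  have h1 : Continuous fun M : Fin d → Fin d → ℝ => (Matrix.toEuclideanCLM (𝕜 := ℝ) (Matrix.of M) : Lin d) :=
    LinearMap.continuous_of_finiteDimensional
      ({ toFun := fun M => (Matrix.toEuclideanCLM (𝕜 := ℝ) (Matrix.of M) : Lin d)
         map_add' := fun M N => map_add (Matrix.toEuclideanCLM (𝕜 := ℝ)) (Matrix.of M) (Matrix.of N)
         map_smul' := fun c M => map_smul (Matrix.toEuclideanCLM (𝕜 := ℝ)) c (Matrix.of M) } :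
        (Fin d → Fin d → ℝ) →ₗ[ℝ] Lin d)
  exact h1.measurable.comp (g := fun M : Fin d → Fin d → ℝ => (Matrix.toEuclideanCLM (𝕜 := ℝ) (Matrix.of M) : Lin d))
    (f := fun x i j => B x i j) (measurable_pi_lambda _ fun i => measurable_pi_lambda _ fun j => hB i j)

/-- The diffusion operator of `σ`. -/
def diffOp (σ : ℝ → Vec d → Matrix (Fin d) (Fin d) ℝ) (t : ℝ) (x : Vec d) : Lin d :=
  Matrix.toEuclideanCLM (𝕜 := ℝ) (sqMat d σ t x)

lemma inner_diffOp (t : ℝ) (x v w : Vec d) :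
    ⟪diffOp σ t x v, w⟫ = (sqMat d σ t x).mulVec v.ofLp ⬝ᵥ w.ofLp := by
  rw [diffOp, EuclideanSpace.inner_eq_star_dotProduct, Matrix.ofLp_toEuclideanCLM, star_trivial, dotProduct_comm]

lemma sqMat_symm (t : ℝ) (x : Vec d) (i j : Fin d) : sqMat d σ t x i j = sqMat d σ t x j i := by
  simp only [sqMat, Matrix.mul_apply, Matrix.transpose_apply]
  exact Finset.sum_congr rfl fun k _ => mul_comm _ _

lemma diffOp_sym (t : ℝ) (x v w : Vec d) : ⟪diffOp σ t x v, w⟫ = ⟪v, diffOp σ t x w⟫ := by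
  have h : (sqMat d σ t x)ᵀ = sqMat d σ t x := by
    ext i j
    exact sqMat_symm t x j i
  rw [real_inner_comm (diffOp σ t x w) v, inner_diffOp, inner_diffOp, dotProduct_comm,
    Matrix.dotProduct_mulVec, ← Matrix.mulVec_transpose, h]

lemma measurable_diffOp (hσ : EllipticHolder d σ κ₀ α) : Measurable (Function.uncurry (diffOp σ)) := by
  refine measurable_toEuclideanCLM (B := fun p : ℝ × Vec d => sqMat d σ p.1 p.2) fun i j => ?_
  simp only [sqMat, Matrix.mul_apply, Matrix.transpose_apply]
  exact Finset.measurable_sum _ fun k _ => (hσ.1 i k).mul (hσ.1 j k)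

namespace EllipticHolder

variable (hσ : EllipticHolder d σ κ₀ α) (hκ₀ : 1 ≤ κ₀) {t : ℝ} (ht : 0 ≤ t)
include hσ hκ₀ ht

lemma abs_apply_le (x : Vec d) (i j : Fin d) : |σ t x i j| ≤ κ₀ := by
  have h1 := (hσ.2.1 t ht x (Pi.single i 1)).2
  have h2 : (sqMat d σ t x).mulVec (Pi.single i 1) ⬝ᵥ Pi.single i 1 = ∑ k, σ t x i k ^ 2 := by
    simp [sqMat, Matrix.mul_apply, sq]
  have h3 : (Pi.single i 1 : Fin d → ℝ) ⬝ᵥ Pi.single i 1 = 1 := by simp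
  rw [h2, h3, mul_one] at h1
  have h4 : σ t x i j ^ 2 ≤ ∑ k, σ t x i k ^ 2 :=
    Finset.single_le_sum (f := fun k => σ t x i k ^ 2) (fun k _ => sq_nonneg _) (Finset.mem_univ j)
  refine abs_le_of_sq_le_sq ?_ (by linarith)
  nlinarith

lemma norm_diffOp_le (x : Vec d) : ‖diffOp σ t x‖ ≤ d * d * (d * κ₀ ^ 2) := by
  refine norm_toEuclideanCLM_le fun i j => ?_
  simp only [sqMat, Matrix.mul_apply, Matrix.transpose_apply]
  refine (Finset.abs_sum_le_sum_abs _ _).trans ?_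
  have : ∀ k ∈ Finset.univ, |σ t x i k * σ t x j k| ≤ κ₀ ^ 2 := by
    intro k _
    rw [abs_mul, sq]
    exact mul_le_mul (hσ.abs_apply_le hκ₀ ht x i k) (hσ.abs_apply_le hκ₀ ht x j k) (abs_nonneg _) (by linarith)
  refine (Finset.sum_le_card_nsmul _ _ _ this).trans (le_of_eq ?_)
  simp

lemma norm_diffOp_sub_le (x y : Vec d) :
    ‖diffOp σ t x - diffOp σ t y‖ ≤ d * d * (d * (2 * κ₀ ^ 2 * ‖x - y‖ ^ α)) := by
  rw [diffOp, diffOp, ← map_sub]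
  refine norm_toEuclideanCLM_le fun i j => ?_
  simp only [sqMat, Matrix.sub_apply, Matrix.mul_apply, Matrix.transpose_apply]
  rw [← Finset.sum_sub_distrib]
  refine (Finset.abs_sum_le_sum_abs _ _).trans ?_
  have : ∀ k ∈ Finset.univ, |σ t x i k * σ t x j k - σ t y i k * σ t y j k| ≤ 2 * κ₀ ^ 2 * ‖x - y‖ ^ α := by
    intro k _
    have h1 : σ t x i k * σ t x j k - σ t y i k * σ t y j k =
        (σ t x i k - σ t y i k) * σ t x j k + σ t y i k * (σ t x j k - σ t y j k) := by ring
    rw [h1]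
    refine (abs_add_le _ _).trans ?_
    rw [abs_mul, abs_mul]
    have h2 := hσ.2.2 t ht x y i k
    have h3 := hσ.2.2 t ht x y j k
    have h4 := mul_le_mul h2 (hσ.abs_apply_le hκ₀ ht x j k) (abs_nonneg _) ((abs_nonneg _).trans h2)
    have h5 := mul_le_mul (hσ.abs_apply_le hκ₀ ht y i k) h3 (abs_nonneg _) (by linarith)
    nlinarith
  refine (Finset.sum_le_card_nsmul _ _ _ this).trans (le_of_eq ?_)
  simp

omit hκ₀ in
lemma le_inner_diffOp (x v : Vec d) : κ₀⁻¹ * ‖v‖ ^ 2 ≤ ⟪diffOp σ t x v, v⟫ := by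
  rw [inner_diffOp, ← real_inner_self_eq_norm_sq, EuclideanSpace.inner_eq_star_dotProduct, star_trivial]
  exact (hσ.2.1 t ht x v.ofLp).1

end EllipticHolder

end diffusion

end

section

/-- Projection of a time onto the interval `[s, S]`. -/
def clamp (s S u : ℝ) : ℝ := max s (min S u)

lemma continuous_clamp (s S : ℝ) : Continuous (clamp s S) := by
  unfold clamp
  fun_prop

lemma clamp_mem {s S : ℝ} (h : s ≤ S) (u : ℝ) : clamp s S u ∈ Icc s S :=
  ⟨le_max_left _ _, max_le h (min_le_left _ _)⟩

lemma clamp_of_mem {s S u : ℝ} (h : u ∈ Icc s S) : clamp s S u = u := by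
  rw [clamp, min_eq_right h.2, max_eq_right h.1]

section driftflow

variable {d : ℕ} {f : ℝ → Vec d → Vec d} {θ : ℝ → ℝ → Vec d → Vec d} {K M s S T κ : ℝ}

/-- The coefficients of the diffusion, with time frozen outside `[s, S]`. -/
def flowCoeffs (b : ℝ → Vec d → Vec d) (σ : ℝ → Vec d → Matrix (Fin d) (Fin d) ℝ) (f : ℝ → Vec d → Vec d)
    (θ : ℝ → ℝ → Vec d → Vec d) (s S : ℝ) : Coeffs d where
  a u x := diffOp σ (clamp s S u) x
  b u x := b (clamp s S u) x
  β u x := f (clamp s S u) x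
  F u x := θ (clamp s S u) s x
  E u x := θ s (clamp s S u) x

lemma measurable_clamp_time {γ : Type*} [MeasurableSpace γ] {g : ℝ → Vec d → γ}
    (hg : Measurable (Function.uncurry g)) (s S : ℝ) :
    Measurable (Function.uncurry fun u x => g (clamp s S u) x) :=
  hg.comp (g := Function.uncurry g) (f := fun p : ℝ × Vec d => (clamp s S p.1, p.2))
    (((continuous_clamp s S).measurable.comp measurable_fst).prodMk measurable_snd)

lemma continuous_uncurry_of_lip {F : ℝ → Vec d → Vec d} (hκ : 0 ≤ κ) (hF : ∀ x, Continuous fun u => F u x)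
    (hF' : ∀ u x y, ‖F u x - F u y‖ ≤ κ * ‖x - y‖) : Continuous (Function.uncurry F) := by
  have h1 : Continuous fun p : Vec d × ℝ => F p.2 p.1 := by
    refine continuous_prod_of_continuous_lipschitzWith _ ⟨κ, hκ⟩ hF fun u => ?_
    refine LipschitzWith.of_dist_le_mul fun x y => ?_
    rw [dist_eq_norm, dist_eq_norm]
    exact hF' u x y
  exact h1.comp continuous_swap

lemma flowCoeffs_good {b : ℝ → Vec d → Vec d} {σ : ℝ → Vec d → Matrix (Fin d) (Fin d) ℝ} {κ₀ κ₁ α : ℝ}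
    (hσ : EllipticHolder d σ κ₀ α) (hκ₀ : 1 ≤ κ₀) (hb : Measurable (Function.uncurry b))
    (hf : Measurable (Function.uncurry f)) (hK : 0 < K) (hM : 0 ≤ M)
    (hf0 : ∀ r, 0 ≤ r → ‖f r 0‖ ≤ M) (hfK : ∀ r, 0 ≤ r → ∀ x y, ‖f r x - f r y‖ ≤ K * ‖x - y‖)
    (hbf : ∀ r, 0 ≤ r → ∀ x, ‖b r x - f r x‖ ≤ κ₁) (hθ : IsFlow d f θ)
    (hs : 0 ≤ s) (hsS : s ≤ S) (hST : S - s ≤ T)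
    (h₀ : κ₀ ≤ κ) (h₁ : κ₁ ≤ κ) (hMκ : M ≤ κ) (hKκ : K ≤ κ) (hdκ : d * d * (d * (2 * κ₀ ^ 2)) ≤ κ)
    (hTκ : 2 * Real.exp (2 * K * T) ≤ κ) :
    (flowCoeffs b σ f θ s S).Good κ α T s S := by
  have hc : ∀ u, 0 ≤ clamp s S u := fun u => hs.trans (clamp_mem hsS u).1
  have hκ : 0 ≤ κ := by linarith
  have hexp : ∀ (u : ℝ) (x y : Vec d), 2 * ‖x - y‖ * Real.exp (2 * K * (clamp s S u - s)) ≤ κ * ‖x - y‖ := by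
    intro u x y
    have h1 : Real.exp (2 * K * (clamp s S u - s)) ≤ Real.exp (2 * K * T) := by
      have := (clamp_mem hsS u).2
      gcongr
      linarith
    have := norm_nonneg (x - y)
    nlinarith
  have hFE : ∀ u x, (flowCoeffs b σ f θ s S).F u ((flowCoeffs b σ f θ s S).E u x) = x := fun u x =>
    hθ.forward_backward hf hK hM hf0 hfK hs (clamp_mem hsS u).1 x
  have hEF : ∀ u x, (flowCoeffs b σ f θ s S).E u ((flowCoeffs b σ f θ s S).F u x) = x := fun u x =>
    hθ.backward_forward hf hK hM hf0 hfK hs (clamp_mem hsS u).1 x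
  have hF_lip : ∀ u x y, ‖(flowCoeffs b σ f θ s S).F u x - (flowCoeffs b σ f θ s S).F u y‖ ≤ κ * ‖x - y‖ :=
    fun u x y => (hθ.norm_sub_le_forward hf hK hM hf0 hfK hs (clamp_mem hsS u).1 x y).trans (hexp u x y)
  have hE_lip : ∀ u x y, ‖(flowCoeffs b σ f θ s S).E u x - (flowCoeffs b σ f θ s S).E u y‖ ≤ κ * ‖x - y‖ :=
    fun u x y => (hθ.norm_sub_le_backward hf hK hM hf0 hfK hs (clamp_mem hsS u).1 x y).trans (hexp u x y)
  have h_intg : ∀ x, IntervalIntegrable (fun r => f r (θ r s x)) volume s S := fun x =>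
    hθ.intervalIntegrable_forward hf hK hM hf0 hfK hs hsS x
  have hFc : ∀ x, Continuous fun u => (flowCoeffs b σ f θ s S).F u x := by
    intro x
    have h1 : ContinuousOn (fun u => θ u s x) (Icc s S) :=
      continuousOn_of_integral_eq (fun τ hτ => hθ s τ hs (hs.trans hτ.1) x) (h_intg x)
    exact h1.comp_continuous (continuous_clamp s S) (clamp_mem hsS)
  have hEc : ∀ x, Continuous fun u => (flowCoeffs b σ f θ s S).E u x := by
    intro x
    refine continuous_iff_continuousAt.2 fun u => ?_
    have h1 : Tendsto (fun v => κ * ‖x - (flowCoeffs b σ f θ s S).F v ((flowCoeffs b σ f θ s S).E u x)‖) (𝓝 u) (𝓝 0) := by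
      have := ((((hFc ((flowCoeffs b σ f θ s S).E u x)).tendsto u).const_sub x).norm.const_mul κ)
      rwa [hFE, sub_self, norm_zero, mul_zero] at this
    refine tendsto_iff_norm_sub_tendsto_zero.2 (squeeze_zero (fun _ => norm_nonneg _) (fun v => ?_) h1)
    have := hE_lip v x ((flowCoeffs b σ f θ s S).F v ((flowCoeffs b σ f θ s S).E u x))
    rwa [hEF] at this
  exact
    { le := hsS
      len := hST
      a_sym := fun u x v w => diffOp_sym _ x v w
      a_lb := fun u x v => le_trans (by gcongr) (hσ.le_inner_diffOp (hc u) x v)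
      a_ub := fun u x => (hσ.norm_diffOp_le hκ₀ (hc u) x).trans (le_trans (by gcongr; nlinarith) hdκ)
      a_hol := fun u x y => by
        refine (hσ.norm_diffOp_sub_le hκ₀ (hc u) x y).trans ?_
        have h1 : 0 ≤ ‖x - y‖ ^ α := by positivity
        nlinarith
      a_meas := measurable_clamp_time (measurable_diffOp hσ) s S
      b_meas := measurable_clamp_time hb s S
      β_meas := measurable_clamp_time hf s S
      b_sub := fun u x => (hbf _ (hc u) x).trans h₁
      β_lip := fun u x y => (hfK _ (hc u) x y).trans (by gcongr)
      β_zero := fun u => (hf0 _ (hc u)).trans hMκ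
      F_cont := continuous_uncurry_of_lip hκ hFc hF_lip
      E_cont := continuous_uncurry_of_lip hκ hEc hE_lip
      FE := hFE
      EF := hEF
      F_lip := hF_lip
      E_lip := hE_lip
      F_int := by
        intro u hu v hv x
        have hsu : uIcc s u ⊆ uIcc s S := by rw [uIcc_of_le hu.1, uIcc_of_le hsS]; exact Icc_subset_Icc_right hu.2
        have hsv : uIcc s v ⊆ uIcc s S := by rw [uIcc_of_le hv.1, uIcc_of_le hsS]; exact Icc_subset_Icc_right hv.2
        have h1 : ∫ r in u..v, (flowCoeffs b σ f θ s S).β r ((flowCoeffs b σ f θ s S).F r x) =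
            ∫ r in u..v, f r (θ r s x) := by
          refine intervalIntegral.integral_congr fun r hr => ?_
          have hr' : r ∈ Icc s S := uIcc_subset_Icc hu hv hr
          simp only [flowCoeffs, clamp_of_mem hr']
        rw [h1, ← intervalIntegral.integral_interval_sub_left ((h_intg x).mono_set hsv) ((h_intg x).mono_set hsu)]
        simp only [flowCoeffs, clamp_of_mem hu, clamp_of_mem hv]
        rw [hθ s u hs (hs.trans hu.1), hθ s v hs (hs.trans hv.1), add_sub_add_left_eq_sub] }

end driftflow

end

section

section martingaleProblem

variable {d : ℕ} {b : ℝ → Vec d → Vec d} {σ : ℝ → Vec d → Matrix (Fin d) (Fin d) ℝ}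

lemma eq_sum_smul_ee (v : Vec d) : v = ∑ i, v i • ee i := by
  conv_lhs => rw [← (EuclideanSpace.basisFun (Fin d) ℝ).sum_repr v]
  simp

lemma genApply_eq_gen (u : ℝ) (f : Vec d → ℝ) (z : Vec d) :
    genApply d b σ u f z = gen (b u z) (diffOp σ u z) f z := by
  have h1 : fderiv ℝ f z (b u z) = ∑ i, b u z i * fderiv ℝ f z (ee i) := by
    conv_lhs => rw [eq_sum_smul_ee (b u z)]
    simp only [map_sum, map_smul, smul_eq_mul]
  have h2 : ∀ j, fderiv ℝ (fderiv ℝ f) z (diffOp σ u z (ee j)) (ee j) =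
      ∑ i, sqMat d σ u z i j * fderiv ℝ (fderiv ℝ f) z (ee i) (ee j) := by
    intro j
    have h3 : diffOp σ u z (ee j) = ∑ i, sqMat d σ u z i j • ee i := by
      conv_lhs => rw [eq_sum_smul_ee (diffOp σ u z (ee j))]
      refine Finset.sum_congr rfl fun i _ => ?_
      rw [diffOp, Matrix.ofLp_toEuclideanCLM]
      simp
    rw [h3]
    simp only [map_sum, map_smul, _root_.sum_apply, _root_.smul_apply, smul_eq_mul]
  rw [genApply, gen, h1, Finset.sum_comm]
  simp only [h2, iteratedFDeriv_two_apply, Matrix.cons_val_zero, Matrix.cons_val_one]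

/-- The generator is bounded on test functions. -/
lemma Coeffs.Good.exists_abs_gen_le {D : Coeffs d} {κ α T s S : ℝ} (h : D.Good κ α T s S) (hκ : 0 < κ)
    {f : Vec d → ℝ} (hf : ContDiff ℝ (⊤ : ℕ∞) f) (hfc : HasCompactSupport f) :
    ∃ B : ℝ, ∀ u z, |gen (D.b u z) (D.a u z) f z| ≤ B := by
  have c1 : Continuous fun z => (1 + ‖z‖) * ‖fderiv ℝ f z‖ :=
    (continuous_const.add continuous_norm).mul (hf.continuous_fderiv (by simp)).norm
  have c2 : Continuous fun z => ‖iteratedFDeriv ℝ 2 f z‖ :=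
    (hf.continuous_iteratedFDeriv (m := 2) two_le_infty).norm
  obtain ⟨M1, hM1⟩ := c1.bounded_above_of_compact_support
    (HasCompactSupport.mul_left (hfc.fderiv (𝕜 := ℝ)).norm)
  obtain ⟨M2, hM2⟩ := c2.bounded_above_of_compact_support (hfc.iteratedFDeriv (𝕜 := ℝ) 2).norm
  refine ⟨M1 * (3 * κ) + d * (M2 * κ), fun u z => (abs_gen_le _ _ _ _).trans ?_⟩
  have h1 := (le_abs_self _).trans (hM1 z)
  have h2 := (le_abs_self _).trans (hM2 z)
  have h3 := h.a_ub u z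
  have h4 := h.b_growth hκ u z
  have h5 := norm_nonneg (fderiv ℝ f z)
  have h6 := norm_nonneg (iteratedFDeriv ℝ 2 f z)
  have h8 : 0 ≤ M2 := h6.trans h2
  have h7 : ‖fderiv ℝ f z‖ * ‖D.b u z‖ ≤ M1 * (3 * κ) := by
    calc ‖fderiv ℝ f z‖ * ‖D.b u z‖ ≤ ‖fderiv ℝ f z‖ * ((3 * κ) * (1 + ‖z‖)) := by gcongr
      _ = (1 + ‖z‖) * ‖fderiv ℝ f z‖ * (3 * κ) := by ring
      _ ≤ M1 * (3 * κ) := by gcongr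
  gcongr

variable {f : ℝ → Vec d → Vec d} {θ : ℝ → ℝ → Vec d → Vec d} {κ α T s S : ℝ} {Ω : Type} [MeasurableSpace Ω]
  {P : Measure Ω} {X : ℝ → Ω → Vec d} {x : Vec d}

lemma MartingaleProblemSolution.markovFlow (hX : MartingaleProblemSolution d b σ s x P X)
    (h : (flowCoeffs b σ f θ s S).Good κ α T s S) (hκ : 0 < κ) :
    (flowCoeffs b σ f θ s S).MarkovFlow s S P fun u => X (clamp s S u) := by
  intro r hr B hB
  have := hX.isProb
  have hcont : ∀ ω, Continuous fun u => X (clamp s S u) ω := fun ω =>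
    (hX.cont_paths ω).comp_continuous (continuous_clamp s S) fun u => (clamp_mem h.le u).1
  have hmeas : ∀ u, Measurable fun ω => X (clamp s S u) ω := fun u => hX.measurable_X _
  have hjoint : Measurable fun p : ℝ × Ω => X (clamp s S p.1) p.2 :=
    measurable_uncurry_of_continuous_of_measurable (u := fun u => X (clamp s S u)) hcont hmeas
  refine ⟨?_, hmeas, hcont, ?_⟩
  · rw [Measure.restrict_apply_univ]
    exact prob_le_one
  intro g hg hgc u v hru huv hvS
  obtain ⟨C, hC⟩ := h.exists_abs_gen_le hκ hg hgc
  have hsu : s ≤ u := hr.1.trans hru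
  have hu : u ∈ Icc s S := ⟨hsu, huv.trans hvS⟩
  have hv : v ∈ Icc s S := ⟨hsu.trans huv, hvS⟩
  set D := flowCoeffs b σ f θ s S with hD
  set G : ℝ → Ω → ℝ := fun ρ ω =>
    gen (D.b ρ (X (clamp s S ρ) ω)) (D.a ρ (X (clamp s S ρ) ω)) g (X (clamp s S ρ) ω) with hG
  have hGm : Measurable (Function.uncurry G) := by
    have hj : Measurable fun p : ℝ × Ω => (p.1, X (clamp s S p.1) p.2) := measurable_fst.prodMk hjoint
    exact measurable_gen (hg.of_le two_le_infty)
      (h.b_meas.comp (g := Function.uncurry D.b) (f := fun p : ℝ × Ω => (p.1, X (clamp s S p.1) p.2)) hj)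
      (h.a_meas.comp (g := Function.uncurry D.a) (f := fun p : ℝ × Ω => (p.1, X (clamp s S p.1) p.2)) hj) hjoint
  have hGC : ∀ ρ ω, ‖G ρ ω‖ ≤ C := fun ρ ω => hC _ _
  set A := (fun ω => X (clamp s S r) ω) ⁻¹' B with hA
  have hAm : MeasurableSet[pathSigma d X s u] A := by
    have h1 : MeasurableSpace.comap (X r) inferInstance ≤ pathSigma d X s u :=
      le_iSup₂_of_le (f := fun r (_ : r ∈ Icc s u) => MeasurableSpace.comap (X r) inferInstance) r ⟨hr.1, hru⟩ le_rfl
    refine h1 _ ⟨B, hB, ?_⟩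
    rw [hA, clamp_of_mem hr]
  have hI : ∀ w ∈ Icc s S, ∀ ω, ∫ ρ in s..w, genApply d b σ ρ g (X ρ ω) = ∫ ρ in s..w, G ρ ω := by
    intro w hw ω
    refine intervalIntegral.integral_congr fun ρ hρ => ?_
    have hρ' : ρ ∈ Icc s S := uIcc_subset_Icc ⟨le_rfl, h.le⟩ hw hρ
    simp only [genApply_eq_gen, hG, hD, flowCoeffs, clamp_of_mem hρ']
  have hgi : ∀ w, Integrable (fun ω => g (X w ω)) P := by
    intro w
    obtain ⟨C', hC'⟩ := hg.continuous.bounded_above_of_compact_support hgc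
    exact Integrable.of_bound (hg.continuous.measurable.comp (hX.measurable_X w)).aestronglyMeasurable C'
      (Eventually.of_forall fun ω => hC' _)
  have hIi : ∀ w ∈ Icc s S, Integrable (fun ω => ∫ ρ in s..w, G ρ ω) P := by
    intro w hw
    refine ((hgi w).sub (hX.integrable g hg hgc w hw.1)).congr (Eventually.of_forall fun ω => ?_)
    simp only [Pi.sub_apply, sub_sub_cancel]
    exact hI w hw ω
  have hm := hX.martingale g hg hgc u v hsu huv A hAm
  simp only [hI u hu, hI v hv] at hm
  rw [integral_sub (hgi v).integrableOn (hIi v hv).integrableOn,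
    integral_sub (hgi u).integrableOn (hIi u hu).integrableOn] at hm
  have hpath : ∀ ω w, IntervalIntegrable (fun ρ => G ρ ω) volume s w := fun ω w =>
    intervalIntegrable_const (c := C) |>.mono_fun
      (hGm.comp (g := Function.uncurry G) (f := fun ρ => (ρ, ω)) (measurable_id.prodMk measurable_const)).aestronglyMeasurable
      (Eventually.of_forall fun ρ => (hGC ρ ω).trans (le_abs_self C))
  have hsplit : ∀ ω, (∫ ρ in s..v, G ρ ω) - ∫ ρ in s..u, G ρ ω = ∫ ρ in u..v, G ρ ω := fun ω =>
    intervalIntegral.integral_interval_sub_left (hpath ω v) (hpath ω u)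
  have hfin : IsFiniteMeasure (volume.restrict (uIoc u v)) := ⟨by simp [uIoc]⟩
  have hswap : ∫ ρ in u..v, ∫ ω in A, G ρ ω ∂P = ∫ ω in A, (∫ ρ in u..v, G ρ ω) ∂P :=
    intervalIntegral_integral_swap (Integrable.of_bound hGm.aestronglyMeasurable C
      (Eventually.of_forall fun p => hGC p.1 p.2))
  simp only [clamp_of_mem hu, clamp_of_mem hv]
  refine Eq.trans ?_ hswap.symm
  simp only [← hsplit]
  rw [integral_sub (hIi v hv).integrableOn (hIi u hu).integrableOn]
  linarith

end martingaleProblem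

end

section

section bounds

variable {d : ℕ}

lemma gaussk_mono {l l' t : ℝ} (ht : 0 < t) {x y : Vec d} (h : l' * ‖y‖ ^ 2 ≤ l * ‖x‖ ^ 2) :
    gaussk d l t x ≤ gaussk d l' t y := by
  unfold gaussk
  exact mul_le_mul_of_nonneg_left
    (Real.exp_le_exp.2 (div_le_div_of_nonneg_right (by linarith) ht.le)) (by positivity)

/-- Constants for which the flow coefficients of any admissible drift and diffusion are controlled. -/
lemma exists_flowCoeffs_good {T α κ₀ κ₁ : ℝ} (hκ₀ : 1 ≤ κ₀) (hκ₁ : 0 < κ₁) {ρ : Vec d → ℝ}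
    (hρ : IsMollifier d ρ) : ∃ κ : ℝ, 1 ≤ κ ∧
      ∀ (b : ℝ → Vec d → Vec d) (σ : ℝ → Vec d → Matrix (Fin d) (Fin d) ℝ) (θ : ℝ → ℝ → Vec d → Vec d),
        EllipticHolder d σ κ₀ α → HolderDrift d b κ₁ 0 → IsFlow d (mollifiedDrift d ρ 1 b) θ →
        ∀ s t : ℝ, 0 ≤ s → s < t → t - s < T →
          (flowCoeffs b σ (mollifiedDrift d ρ 1 b) θ s t).Good κ α T s t := by
  obtain ⟨K, hK, hKb⟩ := exists_mollified_lip hρ hκ₁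
  have h1 : (0 : ℝ) ≤ d * d * (d * (2 * κ₀ ^ 2)) := by positivity
  have h2 : 0 ≤ 2 * Real.exp (2 * K * T) := by positivity
  refine ⟨κ₀ + 2 * κ₁ + K + d * d * (d * (2 * κ₀ ^ 2)) + 2 * Real.exp (2 * K * T), by linarith,
    fun b σ θ hσ hb hθ s t hs hst hT => ?_⟩
  refine flowCoeffs_good hσ hκ₀ hb.1 (hb.measurable_mollified hρ) hK (M := 2 * κ₁) (κ₁ := κ₁) (by linarith)
    (fun r hr => hb.norm_mollified_zero_le hρ hr) (hKb b hb) (fun r hr x => ?_) hθ hs hst.le hT.le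
    (by linarith) (by linarith) (by linarith) (by linarith) (by linarith) (by linarith)
  rw [norm_sub_rev]
  exact hb.norm_mollified_sub_le hρ hr x

end bounds

end

end Parametrix

/-- **Two-sided heat kernel bounds.** Under (H^σ_α) and (H^b_0), for any
`T > 0` there exist `λ₀ ∈ (0,1]` and `C₀ ≥ 1` depending only on `Θ = (T,α,0,κ₀,κ₁,d)` such
that for every `(s,t) ∈ 𝔻^T_0` and every family of solutions of the martingale problem for
`(b,σ)` started at `(s,x)`, the law of `X_t` has a density `p(s,x,t,·)`, jointly continuous
in `(x,y)`, satisfying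
`C₀⁻¹ g_{λ₀⁻¹}(t−s, θ^{(1)}_{t,s}(x)−y) ≤ p(s,x,t,y) ≤ C₀ g_{λ₀}(t−s, θ^{(1)}_{t,s}(x)−y)`. -/
theorem two_sided_heat_kernel_bounds
    (d : ℕ) (T α κ₀ κ₁ : ℝ) (hT : 0 < T) (hα : α ∈ Set.Ioc (0 : ℝ) 1)
    (hκ₀ : 1 ≤ κ₀) (hκ₁ : 0 < κ₁) (ρ : Vec d → ℝ) (hρ : IsMollifier d ρ) :
    ∃ l₀ ∈ Set.Ioc (0 : ℝ) 1, ∃ C₀ : ℝ, 1 ≤ C₀ ∧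
      ∀ (b : ℝ → Vec d → Vec d) (σ : ℝ → Vec d → Matrix (Fin d) (Fin d) ℝ)
        (θ1 : ℝ → ℝ → Vec d → Vec d),
        EllipticHolder d σ κ₀ α → HolderDrift d b κ₁ 0 →
        IsFlow d (mollifiedDrift d ρ 1 b) θ1 →
      ∀ s t : ℝ, 0 ≤ s → s < t → t - s < T →
      ∀ (Ω : Type) (mΩ : MeasurableSpace Ω)
        (P : Vec d → MeasureTheory.Measure Ω) (X : ℝ → Ω → Vec d),
        (∀ x : Vec d, MartingaleProblemSolution d b σ s x (P x) X) →
        ∃ p : Vec d → Vec d → ℝ,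
          Continuous (fun q : Vec d × Vec d => p q.1 q.2) ∧
          (∀ x : Vec d,
            MeasureTheory.Measure.map (X t) (P x) =
              MeasureTheory.volume.withDensity fun y => ENNReal.ofReal (p x y)) ∧
          ∀ x y : Vec d,
            C₀⁻¹ * gaussk d l₀⁻¹ (t - s) (θ1 t s x - y) ≤ p x y ∧
            p x y ≤ C₀ * gaussk d l₀ (t - s) (θ1 t s x - y) := by

  obtain ⟨κ, hκ, hgood⟩ := exists_flowCoeffs_good (T := T) (α := α) hκ₀ hκ₁ hρ
  obtain ⟨C, hC, hup⟩ := Coeffs.exists_hk_le d hκ hα hT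
  obtain ⟨c, L, hc, hL, hlow⟩ := Coeffs.exists_le_hk d hκ hα hT
  have hκ0 : 0 < κ := by linarith
  have hlam := Coeffs.lam_pos hκ0
  set l₀ := min 1 (min (Coeffs.lam κ / κ ^ 2) (L * κ ^ 2)⁻¹) with hl₀
  have hl₀0 : 0 < l₀ := by positivity
  have hl₁ : l₀ * κ ^ 2 ≤ Coeffs.lam κ := by
    rw [← le_div_iff₀ (by positivity)]
    exact (min_le_right _ _).trans (min_le_left _ _)
  have hl₂ : L * κ ^ 2 ≤ l₀⁻¹ := by
    rw [le_inv_comm₀ (by positivity) hl₀0]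
    exact (min_le_right _ _).trans (min_le_right _ _)
  have hC₀ : 0 < 1 + C + c⁻¹ := by positivity
  refine ⟨l₀, ⟨hl₀0, min_le_left _ _⟩, 1 + C + c⁻¹, by linarith [inv_pos.2 hc], ?_⟩
  intro b σ θ1 hσ hb hθ s t hs hst hT' Ω mΩ P X hX
  have h := hgood b σ θ1 hσ hb hθ s t hs hst hT'
  set D := flowCoeffs b σ (mollifiedDrift d ρ 1 b) θ1 s t with hD
  set Y : ℝ → Ω → Vec d := fun u => X (clamp s t u) with hY
  have hYs : Y s = X s := by rw [hY]; simp only [clamp_of_mem (left_mem_Icc.2 hst.le)]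
  have hYt : Y t = X t := by rw [hY]; simp only [clamp_of_mem (right_mem_Icc.2 hst.le)]
  have hM : ∀ x, D.MarkovFlow s t (P x) Y := fun x => (hX x).markovFlow h hκ0
  have hFP : ∀ x, FPFlow D.b D.a s t (P x) Y := fun x => by
    simpa using hM x s (left_mem_Icc.2 hst.le) univ MeasurableSet.univ
  have hPr : ∀ x, IsProbabilityMeasure (P x) := fun x => (hX x).isProb
  have hst' : ∀ x, ∀ᵐ ω ∂P x, Y s ω = x := fun x => by rw [hYs]; exact (hX x).start
  have hcont := h.continuous_hk hκ hα hT hst hFP hPr hst'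
  have hEs : ∀ x, D.E s x = x := fun x => by
    simp only [hD, flowCoeffs, clamp_of_mem (left_mem_Icc.2 hst.le)]
    exact hθ.self hs x
  have hFt : ∀ x, D.F t x = θ1 t s x := fun x => by
    simp only [hD, flowCoeffs, clamp_of_mem (right_mem_Icc.2 hst.le)]
  refine ⟨fun x y => D.hk (P x) Y s t y, hcont, fun x => ?_, fun x y => ⟨?_, ?_⟩⟩
  · rw [← hYt]
    exact (h.law_eq hκ hα (hFP x) le_rfl hst le_rfl).2.2
  · have h1 := hlow D s t h hst Ω mΩ (P x) Y (hM x) (hPr x) x (hst' x)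
      (hcont.comp (Continuous.prodMk_right x)) y
    rw [hEs] at h1
    have h2 : ‖x - D.E t y‖ ≤ κ * ‖θ1 t s x - y‖ := by
      have := h.E_lip t (D.F t x) y
      rwa [h.EF, hFt] at this
    have h3 : gaussk d l₀⁻¹ (t - s) (θ1 t s x - y) ≤ gaussk d L (t - s) (x - D.E t y) := by
      refine gaussk_mono (sub_pos.2 hst) ?_
      calc L * ‖x - D.E t y‖ ^ 2 ≤ L * (κ * ‖θ1 t s x - y‖) ^ 2 := by gcongr
        _ = L * κ ^ 2 * ‖θ1 t s x - y‖ ^ 2 := by ring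
        _ ≤ l₀⁻¹ * ‖θ1 t s x - y‖ ^ 2 := by gcongr
    refine le_trans (mul_le_mul ?_ h3 (gaussk_nonneg (sub_nonneg.2 hst.le) _) hc.le) h1
    rw [inv_le_comm₀ hC₀ hc]
    linarith
  · have h1 := hup D s t h Ω mΩ s (P x) Y (hFP x) le_rfl t hst le_rfl y
    have hpx := hPr x
    rw [Coeffs.EΓ_of_start (hst' x), ← ENNReal.ofReal_mul hC.le] at h1
    have h0 : 0 ≤ D.Γ (Coeffs.lam κ) s x t y := gaussk_nonneg (sub_nonneg.2 hst.le) _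
    have h2 := (ENNReal.ofReal_le_ofReal_iff (mul_nonneg hC.le h0)).1 h1
    have h3 : ‖θ1 t s x - y‖ ≤ κ * ‖x - D.E t y‖ := by
      have := h.F_lip t x (D.E t y)
      rwa [h.FE, hFt] at this
    have h4 : D.Γ (Coeffs.lam κ) s x t y ≤ gaussk d l₀ (t - s) (θ1 t s x - y) := by
      unfold Coeffs.Γ
      rw [hEs]
      refine gaussk_mono (sub_pos.2 hst) ?_
      calc l₀ * ‖θ1 t s x - y‖ ^ 2 ≤ l₀ * (κ * ‖x - D.E t y‖) ^ 2 := by gcongr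
        _ = l₀ * κ ^ 2 * ‖x - D.E t y‖ ^ 2 := by ring
        _ ≤ Coeffs.lam κ * ‖x - D.E t y‖ ^ 2 := by gcongr
    refine h2.trans (mul_le_mul (by linarith [inv_pos.2 hc]) h4 h0 hC₀.le)
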